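/- Let L ⊂ ℝ^2 be a two-dimensional lattice of covolume 1 that is not the image of the hexagonal lattice Σ under a linear isometry of ℝ^2. If F is a real number such that N_L(x)·√(log x)/x → F as x → ∞, then F > 2^{-3/2}·3^{1/4}·∏_{p prime, p ≡ 2 (mod 3)} (1 - p^{-2})^{-1/2}. -/

import Mathlib

open Filter Real

/-- The lattice (set of all integral linear combinations) spanned by `v₁` and `v₂`. -/
def latticeOf (v₁ v₂ : EuclideanSpace ℝ (Fin 2)) : Set (EuclideanSpace ℝ (Fin 2)) :=
  {v | ∃ m n : ℤ, v = m • v₁ + n • v₂}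

/-- `NL Λ x` is the number of distinct values `0 < r ≤ x` taken by the squared Euclidean
norm on the lattice `Λ`. -/
noncomputable def NL (Λ : Set (EuclideanSpace ℝ (Fin 2))) (x : ℝ) : ℕ :=
  Set.ncard {r : ℝ | 0 < r ∧ r ≤ x ∧ ∃ v ∈ Λ, ‖v‖ ^ 2 = r}

/-- The hexagonal lattice of covolume 1, spanned by `√(2/√3)·(1,0)` and
`√(2/√3)·(1/2, √3/2)`. -/
noncomputable def hexLattice : Set (EuclideanSpace ℝ (Fin 2)) :=
  latticeOf ((WithLp.equiv 2 (Fin 2 → ℝ)).symm ![Real.sqrt (2 / Real.sqrt 3), 0])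
    ((WithLp.equiv 2 (Fin 2 → ℝ)).symm
      ![Real.sqrt (2 / Real.sqrt 3) * (1 / 2), Real.sqrt (2 / Real.sqrt 3) * (Real.sqrt 3 / 2)])

/-- The Erdős number of the hexagonal lattice:
`2^{-3/2}·3^{1/4}·∏_{p ≡ 2 mod 3} (1 - p^{-2})^{-1/2}`. -/
noncomputable def hexErdos : ℝ :=
  2 ^ (-(3 : ℝ) / 2) * 3 ^ ((1 : ℝ) / 4) *
    ∏' p : {p : ℕ // p.Prime ∧ p % 3 = 2}, (1 - (p.1 : ℝ) ^ (-(2 : ℝ))) ^ (-(1 : ℝ) / 2)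

set_option linter.unusedSectionVars false
set_option linter.style.haveILetI false

/-! ### Proper lattices of an imaginary quadratic order and their class group -/

namespace QuadLat

open Complex (I)

/-- `D` is the absolute value of a negative discriminant. -/
class NegDisc (D : ℕ) : Prop where
  pos : 0 < D
  mod_four : D % 4 = 0 ∨ D % 4 = 3

/-- The cyclic additive subgroup of `ℂ` generated by `α`. -/
noncomputable def sc (α : ℂ) : Submodule ℤ ℂ := Submodule.span ℤ {α}

lemma sc_mul (α β : ℂ) : sc (α * β) = sc α * sc β := by
  simp [sc, Submodule.span_mul_span]

lemma sc_one : sc 1 = 1 := by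
  rw [sc, Submodule.one_eq_span]

lemma mem_sc_mul {α z : ℂ} {L : Submodule ℤ ℂ} : z ∈ sc α * L ↔ ∃ w ∈ L, α * w = z := by
  simp [sc, Submodule.mem_span_singleton_mul]

/-- Complex conjugation of additive subgroups of `ℂ`. -/
noncomputable def cj (L : Submodule ℤ ℂ) : Submodule ℤ ℂ :=
  L.map ((starRingEnd ℂ).toIntAlgHom).toLinearMap

lemma mem_cj {L : Submodule ℤ ℂ} {z : ℂ} : z ∈ cj L ↔ (starRingEnd ℂ) z ∈ L := by
  constructor
  · rintro ⟨w, hw, rfl⟩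
    simpa using hw
  · intro h
    exact ⟨_, h, by simp⟩

lemma cj_mul (L M : Submodule ℤ ℂ) : cj (L * M) = cj L * cj M :=
  Submodule.map_mul _ _ _

lemma cj_cj (L : Submodule ℤ ℂ) : cj (cj L) = L := by
  ext z; simp [mem_cj]

lemma cj_sc (α : ℂ) : cj (sc α) = sc ((starRingEnd ℂ) α) := by
  simp [cj, sc, Submodule.map_span]

lemma cj_mono {L M : Submodule ℤ ℂ} (h : L ≤ M) : cj L ≤ cj M := Submodule.map_mono h

lemma cj_sup (L M : Submodule ℤ ℂ) : cj (L ⊔ M) = cj L ⊔ cj M := Submodule.map_sup _ _ _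

/-- The generator `(D + i √D) / 2` of the quadratic order of discriminant `-D`. -/
noncomputable def omega (D : ℕ) : ℂ := ⟨D / 2, √D / 2⟩

/-- The quadratic order of discriminant `-D`. -/
noncomputable def ord (D : ℕ) : Submodule ℤ ℂ := Submodule.span ℤ {1, omega D}

lemma mem_ord {D : ℕ} {z : ℂ} : z ∈ ord D ↔ ∃ x y : ℤ, (x : ℂ) + y * omega D = z := by
  simp [ord, Submodule.mem_span_pair]

lemma one_mem_ord (D : ℕ) : (1 : ℂ) ∈ ord D := mem_ord.2 ⟨1, 0, by simp⟩

lemma int_mem_ord (D : ℕ) (n : ℤ) : (n : ℂ) ∈ ord D := mem_ord.2 ⟨n, 0, by simp⟩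

lemma omega_mem_ord (D : ℕ) : omega D ∈ ord D := mem_ord.2 ⟨0, 1, by simp⟩

lemma NegDisc.exists_mul_succ (D : ℕ) [h : NegDisc D] : ∃ k : ℕ, D * (D + 1) = 4 * k := by
  obtain h | h := h.mod_four
  · exact ⟨D / 4 * (D + 1), by rw [← mul_assoc]; congr 1; omega⟩
  · exact ⟨D * ((D + 1) / 4), by rw [mul_left_comm]; congr 1; omega⟩

lemma omega_sq (D : ℕ) {k : ℕ} (hk : D * (D + 1) = 4 * k) :
    omega D * omega D = D * omega D - k := by
  have h := Real.mul_self_sqrt (Nat.cast_nonneg (α := ℝ) D)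
  have hk' : (D : ℝ) * (D + 1) = 4 * k := by exact_mod_cast hk
  apply Complex.ext
  · simp [omega]; nlinarith
  · simp [omega]; ring

lemma conj_omega (D : ℕ) : (starRingEnd ℂ) (omega D) = D - omega D := by
  apply Complex.ext
  · simp [omega]; ring
  · simp [omega]

lemma ord_mul_ord (D : ℕ) [NegDisc D] : ord D * ord D = ord D := by
  obtain ⟨k, hk⟩ := NegDisc.exists_mul_succ D
  apply le_antisymm
  · rw [Submodule.mul_le]
    intro a ha b hb
    obtain ⟨x, y, rfl⟩ := mem_ord.1 ha
    obtain ⟨u, v, rfl⟩ := mem_ord.1 hb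
    refine mem_ord.2 ⟨x * u - y * v * k, x * v + y * u + D * y * v, ?_⟩
    push_cast
    linear_combination (-(y : ℂ) * v) * omega_sq D hk
  · intro a ha
    simpa using Submodule.mul_mem_mul (one_mem_ord D) ha

lemma cj_ord (D : ℕ) : cj (ord D) = ord D := by
  have key : ord D ≤ cj (ord D) := by
    intro z hz
    obtain ⟨x, y, rfl⟩ := mem_ord.1 hz
    refine mem_cj.2 (mem_ord.2 ⟨x + D * y, -y, ?_⟩)
    simp [conj_omega]; ring
  refine le_antisymm ?_ key
  simpa [cj_cj] using cj_mono key

lemma real_mem_ord {D : ℕ} [hD : NegDisc D] {r : ℝ} (h : (r : ℂ) ∈ ord D) : ∃ n : ℤ, r = n := by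
  obtain ⟨x, y, hxy⟩ := mem_ord.1 h
  have him := congrArg Complex.im hxy
  have hre := congrArg Complex.re hxy
  have hD' : (0 : ℝ) < √D := Real.sqrt_pos.2 (by exact_mod_cast hD.pos)
  have hy : (y : ℝ) = 0 := by
    simp [omega] at him
    rcases him with h | h
    · exact_mod_cast h
    · exact absurd h hD.pos.ne'
  refine ⟨x, ?_⟩
  simp [omega] at hre
  rw [← hre]
  have : y = 0 := by exact_mod_cast hy
  simp [this]

/-- A proper invertible lattice for the quadratic order of discriminant `-D`, with its norm. -/
@[ext]
structure Lat (D : ℕ) where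
  carrier : Submodule ℤ ℂ
  nrm : ℝ
  nrm_pos : 0 < nrm
  mul_ord : carrier * ord D = carrier
  mul_cj : carrier * cj carrier = sc nrm * ord D

variable {D : ℕ} [hD : NegDisc D]

lemma sc_mul_ord_le {r s : ℝ} (hr : 0 < r) (hs : 0 < s) (h : sc r * ord D ≤ sc s * ord D) :
    ∃ n : ℕ, 0 < n ∧ r = s * n := by
  have h1 : (r : ℂ) ∈ sc s * ord D := h (mem_sc_mul.2 ⟨1, one_mem_ord D, by simp⟩)
  obtain ⟨w, hw, hws⟩ := mem_sc_mul.1 h1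
  have hs' : (s : ℂ) ≠ 0 := by exact_mod_cast hs.ne'
  have hw' : w = ((r / s : ℝ) : ℂ) := by
    push_cast; field_simp; rw [← hws]; ring
  obtain ⟨n, hn⟩ := real_mem_ord (hw' ▸ hw)
  have hn0 : 0 < n := by
    have : (0 : ℝ) < n := hn ▸ div_pos hr hs
    exact_mod_cast this
  lift n to ℕ using hn0.le
  refine ⟨n, by exact_mod_cast hn0, ?_⟩
  have : r / s = n := by simpa using hn
  field_simp at this
  linarith

lemma sc_mul_ord_inj {r s : ℝ} (hr : 0 < r) (hs : 0 < s) (h : sc r * ord D = sc s * ord D) :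
    r = s := by
  obtain ⟨n, hn, h1⟩ := sc_mul_ord_le hr hs h.le
  obtain ⟨m, hm, h2⟩ := sc_mul_ord_le hs hr h.ge
  have hn' : (1 : ℝ) ≤ n := by exact_mod_cast hn
  have hm' : (1 : ℝ) ≤ m := by exact_mod_cast hm
  nlinarith

namespace Lat

lemma ext' {L M : Lat D} (h : L.carrier = M.carrier) : L = M := by
  refine Lat.ext h (sc_mul_ord_inj (D := D) L.nrm_pos M.nrm_pos ?_)
  rw [← L.mul_cj, ← M.mul_cj, h]

noncomputable instance : Mul (Lat D) where
  mul L M :=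
    { carrier := L.carrier * M.carrier
      nrm := L.nrm * M.nrm
      nrm_pos := mul_pos L.nrm_pos M.nrm_pos
      mul_ord := by rw [mul_assoc, M.mul_ord]
      mul_cj := by
        rw [cj_mul, mul_mul_mul_comm, L.mul_cj, M.mul_cj, mul_mul_mul_comm, ord_mul_ord,
          ← sc_mul]
        push_cast; rfl }

noncomputable instance : One (Lat D) where
  one :=
    { carrier := ord D
      nrm := 1
      nrm_pos := one_pos
      mul_ord := ord_mul_ord D
      mul_cj := by rw [cj_ord, ord_mul_ord]; simp [sc_one] }

noncomputable instance : Inv (Lat D) where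
  inv L :=
    { carrier := sc ((L.nrm⁻¹ : ℝ) : ℂ) * cj L.carrier
      nrm := L.nrm⁻¹
      nrm_pos := inv_pos.2 L.nrm_pos
      mul_ord := by
        rw [mul_assoc]; congr 1
        conv_rhs => rw [← L.mul_ord, cj_mul, cj_ord]
      mul_cj := by
        rw [cj_mul, cj_cj, cj_sc, mul_mul_mul_comm, mul_comm (cj _), L.mul_cj, Complex.conj_ofReal,
          ← mul_assoc, ← sc_mul, ← sc_mul]
        have : (L.nrm : ℂ) ≠ 0 := by exact_mod_cast L.nrm_pos.ne'
        congr 2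
        push_cast
        field_simp }

lemma mul_carrier (L M : Lat D) : (L * M).carrier = L.carrier * M.carrier := rfl
lemma one_carrier : (1 : Lat D).carrier = ord D := rfl
lemma inv_carrier (L : Lat D) : (L⁻¹).carrier = sc ((L.nrm⁻¹ : ℝ) : ℂ) * cj L.carrier := rfl
lemma mul_nrm (L M : Lat D) : (L * M).nrm = L.nrm * M.nrm := rfl
lemma one_nrm : (1 : Lat D).nrm = 1 := rfl
lemma inv_nrm (L : Lat D) : (L⁻¹).nrm = L.nrm⁻¹ := rfl

noncomputable instance : CommGroup (Lat D) where
  mul_assoc a b c := ext' (mul_assoc _ _ _)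
  one_mul a := ext' (by rw [mul_carrier, one_carrier, mul_comm, a.mul_ord])
  mul_one a := ext' (by rw [mul_carrier, one_carrier, a.mul_ord])
  mul_comm a b := ext' (mul_comm _ _)
  inv_mul_cancel a := ext' (by
    rw [mul_carrier, inv_carrier, one_carrier, mul_assoc, mul_comm (cj _), a.mul_cj, ← mul_assoc,
      ← sc_mul]
    have : (a.nrm : ℂ) ≠ 0 := by exact_mod_cast a.nrm_pos.ne'
    have h2 : ((a.nrm⁻¹ : ℝ) : ℂ) * (a.nrm : ℂ) = 1 := by push_cast; field_simp
    rw [h2, sc_one, one_mul])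

/-- The conjugate lattice. -/
noncomputable def conj (L : Lat D) : Lat D where
  carrier := cj L.carrier
  nrm := L.nrm
  nrm_pos := L.nrm_pos
  mul_ord := by conv_rhs => rw [← L.mul_ord, cj_mul, cj_ord]
  mul_cj := by rw [cj_cj, mul_comm, L.mul_cj]

lemma conj_carrier (L : Lat D) : L.conj.carrier = cj L.carrier := rfl
lemma conj_nrm (L : Lat D) : L.conj.nrm = L.nrm := rfl
lemma conj_mul (L M : Lat D) : (L * M).conj = L.conj * M.conj := ext' (cj_mul _ _)

variable (D) in
/-- The principal lattice generated by `α`. -/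
noncomputable def princ (α : ℂˣ) : Lat D where
  carrier := sc α * ord D
  nrm := Complex.normSq α
  nrm_pos := Complex.normSq_pos.2 α.ne_zero
  mul_ord := by rw [mul_assoc, ord_mul_ord]
  mul_cj := by
    rw [cj_mul, cj_ord, cj_sc, mul_mul_mul_comm, ord_mul_ord, ← sc_mul, Complex.mul_conj]

variable (D) in
/-- Principal lattices as a homomorphism. -/
noncomputable def princHom : ℂˣ →* Lat D where
  toFun := princ D
  map_one' := ext' (by simp [princ, sc_one, one_carrier])
  map_mul' a b := ext' (by
    rw [mul_carrier]
    simp only [princ, Units.val_mul, sc_mul]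
    rw [mul_mul_mul_comm, ord_mul_ord])

lemma princHom_carrier (α : ℂˣ) : (princHom D α).carrier = sc α * ord D := rfl
lemma princHom_nrm (α : ℂˣ) : (princHom D α).nrm = Complex.normSq α := rfl

end Lat

/-- The class group of the quadratic order of discriminant `-D`. -/
abbrev Cl (D : ℕ) [NegDisc D] : Type := Lat D ⧸ (Lat.princHom D).range

/-- The class of a lattice. -/
noncomputable def cls : Lat D →* Cl D := QuotientGroup.mk' _

lemma cls_eq_one_iff {L : Lat D} : cls L = 1 ↔ ∃ α, Lat.princHom D α = L := by
  simp [cls]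

lemma cls_princ (α : ℂˣ) : cls (Lat.princHom D α) = 1 := cls_eq_one_iff.2 ⟨α, rfl⟩

lemma cls_surjective : Function.Surjective (cls : Lat D → Cl D) := QuotientGroup.mk'_surjective _

lemma cls_conj (L : Lat D) : cls L.conj = (cls L)⁻¹ := by
  rw [eq_inv_iff_mul_eq_one, ← map_mul, cls_eq_one_iff]
  have h : (L.nrm : ℂ) ≠ 0 := by exact_mod_cast L.nrm_pos.ne'
  refine ⟨Units.mk0 _ h, Lat.ext' ?_⟩
  rw [Lat.princHom_carrier, Lat.mul_carrier, Lat.conj_carrier, mul_comm (cj _), L.mul_cj]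
  rfl

end QuadLat

/-! ### Integral lattices and lattices of prime norm -/

namespace QuadLat

variable {D : ℕ} [hD : NegDisc D]

lemma mul_mono_left {L M P : Submodule ℤ ℂ} (h : L ≤ M) : L * P ≤ M * P := mul_le_mul' h le_rfl

lemma mul_mono_right {L M P : Submodule ℤ ℂ} (h : L ≤ M) : P * L ≤ P * M := mul_le_mul' le_rfl h

namespace Lat

/-- Integral lattices: those contained in the order. -/
def IsInt (L : Lat D) : Prop := L.carrier ≤ ord D

/-- The norm as a natural number (meaningful for integral lattices). -/
noncomputable def nn (L : Lat D) : ℕ := ⌊L.nrm⌋₊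

lemma IsInt.mul {L M : Lat D} (hL : L.IsInt) (hM : M.IsInt) : (L * M).IsInt := by
  have h := mul_le_mul' hL hM
  rw [ord_mul_ord] at h
  exact h

lemma isInt_one : (1 : Lat D).IsInt := le_refl _

lemma IsInt.conj {L : Lat D} (hL : L.IsInt) : L.conj.IsInt := by
  have h := cj_mono hL
  rwa [cj_ord] at h

lemma le_iff {L M : Lat D} : M.carrier ≤ L.carrier ↔ (M * L⁻¹).IsInt := by
  constructor
  · intro h
    have h1 : M.carrier * (L⁻¹).carrier ≤ L.carrier * (L⁻¹).carrier := mul_mono_left h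
    rwa [← mul_carrier, ← mul_carrier, mul_inv_cancel] at h1
  · intro h
    have h1 : (M * L⁻¹).carrier * L.carrier ≤ (1 : Lat D).carrier * L.carrier :=
      mul_mono_left h
    rwa [← mul_carrier, ← mul_carrier, inv_mul_cancel_right, one_mul] at h1

lemma IsInt.exists_nrm {L : Lat D} (hL : L.IsInt) : ∃ n : ℕ, 0 < n ∧ L.nrm = n := by
  have h : sc L.nrm * ord D ≤ sc (1 : ℝ) * ord D := by
    have h0 : (L * L.conj).carrier ≤ ord D := hL.mul hL.conj
    rw [mul_carrier, conj_carrier, L.mul_cj] at h0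
    rwa [Complex.ofReal_one, sc_one, one_mul]
  obtain ⟨n, hn, h1⟩ := sc_mul_ord_le L.nrm_pos one_pos h
  exact ⟨n, hn, by rw [h1, one_mul]⟩

lemma IsInt.nrm_eq {L : Lat D} (hL : L.IsInt) : L.nrm = L.nn := by
  obtain ⟨n, -, hn⟩ := hL.exists_nrm
  simp [nn, hn]

lemma IsInt.nn_pos {L : Lat D} (hL : L.IsInt) : 0 < L.nn := by
  obtain ⟨n, hn0, hn⟩ := hL.exists_nrm
  simpa [nn, hn] using hn0

lemma nn_one : (1 : Lat D).nn = 1 := by simp [nn, one_nrm]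

lemma nn_conj (L : Lat D) : L.conj.nn = L.nn := rfl

lemma IsInt.nn_mul {L M : Lat D} (hL : L.IsInt) (hM : M.IsInt) : (L * M).nn = L.nn * M.nn := by
  have h := (hL.mul hM).nrm_eq
  rw [mul_nrm, hL.nrm_eq, hM.nrm_eq] at h
  exact_mod_cast h.symm

lemma IsInt.eq_one {L : Lat D} (hL : L.IsInt) (h : L.nn = 1) : L = 1 := by
  apply ext'
  refine le_antisymm hL ?_
  have h1 : ord D = L.carrier * L.conj.carrier := by
    rw [conj_carrier, L.mul_cj, hL.nrm_eq, h]; simp [sc_one]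
  rw [one_carrier, h1]
  calc _ ≤ L.carrier * ord D := mul_mono_right hL.conj
    _ = L.carrier := L.mul_ord

lemma IsInt.nn_mem {L : Lat D} (hL : L.IsInt) : (L.nn : ℂ) ∈ L.carrier := by
  have h1 : (L.nn : ℂ) ∈ L.carrier * cj L.carrier := by
    rw [L.mul_cj, hL.nrm_eq]
    exact mem_sc_mul.2 ⟨1, one_mem_ord D, by simp⟩
  have h2 := mul_mono_right (P := L.carrier) hL.conj h1
  rwa [L.mul_ord] at h2

/-- The principal lattice generated by a positive natural number. -/
noncomputable def ofNat (D : ℕ) [NegDisc D] (n : ℕ) [NeZero n] : Lat D :=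
  princHom D (Units.mk0 (n : ℂ) (by exact_mod_cast NeZero.ne n))

variable {n : ℕ} [NeZero n]

lemma ofNat_carrier : (ofNat D n).carrier = sc n * ord D := rfl

lemma ofNat_nrm : (ofNat D n).nrm = n ^ 2 := by
  rw [ofNat, princHom_nrm]; simp [sq, Complex.normSq]

lemma ofNat_nn : (ofNat D n).nn = n ^ 2 := by
  rw [nn, ofNat_nrm]; exact_mod_cast Nat.floor_natCast (n ^ 2)

lemma cls_ofNat : cls (ofNat D n) = 1 := cls_princ _

lemma ofNat_conj : (ofNat D n).conj = ofNat D n := by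
  apply ext'
  rw [conj_carrier, ofNat_carrier, cj_mul, cj_ord, cj_sc]; simp

lemma mul_ord_le_of_mem_ord {z : ℂ} (hz : z ∈ ord D) {M : Submodule ℤ ℂ} (hM : M * ord D = M) :
    sc z * M ≤ M := by
  intro w hw
  obtain ⟨u, hu, rfl⟩ := mem_sc_mul.1 hw
  rw [← hM, mul_comm M]
  exact Submodule.mul_mem_mul hz hu

lemma ofNat_isInt : (ofNat D n).IsInt := by
  have := mul_ord_le_of_mem_ord (D := D) (z := (n : ℂ)) (by exact_mod_cast int_mem_ord D n)
    (ord_mul_ord D)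
  exact this

lemma mul_conj_eq {L : Lat D} (h : L.nrm = n) : L * L.conj = ofNat D n := by
  apply ext'
  rw [mul_carrier, conj_carrier, L.mul_cj, h]; rfl

/-- `ord D ≤ M` as soon as `1 ∈ M`. -/
lemma ord_le_of_one_mem {M : Submodule ℤ ℂ} (hM : M * ord D = M) (h : (1 : ℂ) ∈ M) :
    ord D ≤ M := by
  intro z hz
  rw [← hM]
  simpa using Submodule.mul_mem_mul h hz

lemma mem_sc_ord_of_trace {p : ℕ} (hp : p.Prime) (hpD : ¬ p ∣ D) {z : ℂ} (hz : z ∈ ord D)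
    (h1 : ∃ n : ℤ, z + (starRingEnd ℂ) z = p * n)
    (h2 : ∃ n : ℤ, z * omega D + (starRingEnd ℂ) (z * omega D) = p * n) :
    z ∈ sc p * ord D := by
  obtain ⟨k, hk⟩ := NegDisc.exists_mul_succ D
  obtain ⟨x, y, rfl⟩ := mem_ord.1 hz
  obtain ⟨m, hm⟩ := h1
  obtain ⟨n, hn⟩ := h2
  simp only [map_add, map_mul, conj_omega, map_intCast] at hm hn
  have e1 : 2 * x + D * y = p * m := by
    have : ((2 * x + D * y : ℤ) : ℂ) = ((p * m : ℤ) : ℂ) := by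
      push_cast; rw [← hm]; ring
    exact_mod_cast this
  have e2 : D * x + (D ^ 2 - 2 * k) * y = p * n := by
    have : ((D * x + (D ^ 2 - 2 * k) * y : ℤ) : ℂ) = ((p * n : ℤ) : ℂ) := by
      push_cast; rw [← hn]; linear_combination (-2 * y : ℂ) * omega_sq D hk
    exact_mod_cast this
  have hk' : (D : ℤ) * (D + 1) = 4 * k := by exact_mod_cast hk
  have hpi : Prime (p : ℤ) := Nat.prime_iff_prime_int.1 hp
  have hpD' : ¬ (p : ℤ) ∣ D := by exact_mod_cast hpD
  have hx : (p : ℤ) ∣ D * x := ⟨-((D ^ 2 - 2 * k) * m - D * n), by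
    linear_combination (-(D ^ 2 - 2 * k : ℤ)) * e1 + D * e2 + x * hk'⟩
  have hy : (p : ℤ) ∣ D * y := ⟨-(2 * n - D * m), by
    linear_combination (-2 : ℤ) * e2 + D * e1 + y * hk'⟩
  obtain ⟨u, hu⟩ := (hpi.dvd_or_dvd hx).resolve_left hpD'
  obtain ⟨v, hv⟩ := (hpi.dvd_or_dvd hy).resolve_left hpD'
  refine mem_sc_mul.2 ⟨u + v * omega D, mem_ord.2 ⟨u, v, rfl⟩, ?_⟩
  rw [hu, hv]; push_cast; ring

lemma le_or_exists_sup {p : ℕ} (hp : p.Prime) (hpD : ¬ p ∣ D) {a : Lat D} (ha : a.IsInt)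
    (hpa : p ∣ a.nn) :
    a.carrier ≤ sc p * ord D ∨
      ∃ P : Lat D, P.IsInt ∧ P.nrm = p ∧ P.carrier = a.carrier ⊔ sc p * ord D := by
  by_cases hle : a.carrier ≤ sc p * ord D
  · exact Or.inl hle
  right
  haveI : NeZero p := ⟨hp.ne_zero⟩
  have hpO : sc (p : ℂ) * ord D ≤ ord D := ofNat_isInt (D := D) (n := p)
  have hPO : (a.carrier ⊔ sc p * ord D) * ord D = a.carrier ⊔ sc p * ord D := by
    rw [Submodule.sup_mul, a.mul_ord, mul_assoc, ord_mul_ord]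
  have hcj : cj (a.carrier ⊔ sc p * ord D) = cj a.carrier ⊔ sc p * ord D := by
    rw [cj_sup, cj_mul, cj_ord, cj_sc]; simp
  obtain ⟨m, hm⟩ := hpa
  set J : Submodule ℤ ℂ := sc m * ord D ⊔ a.carrier ⊔ cj a.carrier ⊔ sc p * ord D with hJ
  have hJO : J * ord D = J := by
    have := a.conj.mul_ord
    rw [conj_carrier] at this
    rw [hJ, Submodule.sup_mul, Submodule.sup_mul, Submodule.sup_mul, a.mul_ord, mul_assoc,
      ord_mul_ord, mul_assoc, ord_mul_ord, this]
  have hmul : (a.carrier ⊔ sc p * ord D) * cj (a.carrier ⊔ sc p * ord D) = sc p * J := by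
    rw [hcj, hJ, Submodule.sup_mul, Submodule.mul_sup, Submodule.mul_sup, a.mul_cj, ha.nrm_eq, hm]
    have e1 : a.carrier * (sc p * ord D) = sc p * a.carrier := by
      rw [mul_left_comm, a.mul_ord]
    have e2 : sc p * ord D * cj a.carrier = sc p * cj a.carrier := by
      rw [mul_assoc, mul_comm (ord D)]
      have := a.conj.mul_ord
      rw [conj_carrier] at this
      rw [this]
    rw [e1, e2, mul_assoc, mul_left_comm (ord D), ord_mul_ord, Submodule.mul_sup,
      Submodule.mul_sup, Submodule.mul_sup]
    push_cast
    rw [sc_mul, mul_assoc]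
    generalize sc (p : ℂ) * (sc (m : ℂ) * ord D) = x₁
    generalize sc (p : ℂ) * a.carrier = x₂
    generalize sc (p : ℂ) * cj a.carrier = x₃
    generalize sc (p : ℂ) * (sc (p : ℂ) * ord D) = x₄
    ac_rfl
  have haJ : a.carrier ≤ J := le_sup_of_le_left (le_sup_of_le_left le_sup_right)
  have hcJ : cj a.carrier ≤ J := le_sup_of_le_left le_sup_right
  have hpJ : (p : ℂ) ∈ J :=
    (le_sup_right : sc (p : ℂ) * ord D ≤ J) (mem_sc_mul.2 ⟨1, one_mem_ord D, by simp⟩)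
  have hmO : sc (m : ℂ) * ord D ≤ ord D :=
    mul_ord_le_of_mem_ord (by exact_mod_cast int_mem_ord D m) (ord_mul_ord D)
  have hJle : J ≤ ord D := sup_le (sup_le (sup_le hmO ha) ha.conj) hpO
  have htr : ∀ z ∈ a.carrier, ∃ n : ℤ, z + (starRingEnd ℂ) z = n := by
    intro z hz
    obtain ⟨n, hn⟩ := real_mem_ord (D := D) (r := 2 * z.re) (by
      have := add_mem (ha hz) (ha.conj (mem_cj.2 (by simpa using hz)) :
        (starRingEnd ℂ) z ∈ ord D)
      rwa [Complex.add_conj] at this)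
    refine ⟨n, ?_⟩
    rw [Complex.add_conj, hn]; simp
  have hone : (1 : ℂ) ∈ J := by
    by_contra hcon
    have hdvd : ∀ z ∈ a.carrier, ∃ n : ℤ, z + (starRingEnd ℂ) z = p * n := by
      intro z hz
      obtain ⟨t, ht⟩ := htr z hz
      by_cases hd : (p : ℤ) ∣ t
      · obtain ⟨u, hu⟩ := hd
        exact ⟨u, by rw [ht, hu]; push_cast; rfl⟩
      exfalso
      apply hcon
      have hcop : IsCoprime (p : ℤ) t :=
        (Nat.prime_iff_prime_int.1 hp).coprime_iff_not_dvd.2 hd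
      obtain ⟨u, v, huv⟩ := hcop
      have htJ : (t : ℂ) ∈ J := by
        rw [← ht]; exact add_mem (haJ hz) (hcJ (mem_cj.2 (by simpa using hz)))
      have : (1 : ℂ) = u • (p : ℂ) + v • (t : ℂ) := by
        simp only [zsmul_eq_mul]; exact_mod_cast huv.symm
      rw [this]
      exact add_mem (Submodule.smul_mem _ _ hpJ) (Submodule.smul_mem _ _ htJ)
    apply hle
    intro z hz
    refine mem_sc_ord_of_trace hp hpD (ha hz) (hdvd z hz) (hdvd _ ?_)
    rw [← a.mul_ord]
    exact Submodule.mul_mem_mul hz (omega_mem_ord D)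
  have hJ1 : J = ord D := le_antisymm hJle (ord_le_of_one_mem hJO hone)
  refine ⟨⟨a.carrier ⊔ sc p * ord D, p, by exact_mod_cast hp.pos, hPO, ?_⟩, sup_le ha hpO, rfl, rfl⟩
  rw [hmul, hJ1]; simp

lemma IsInt.eq_of_le {L M : Lat D} (h : L.carrier ≤ M.carrier) (hn : L.nrm = M.nrm) :
    L = M := by
  have h1 := le_iff.1 h
  have h2 : (L * M⁻¹).nn = 1 := by
    rw [nn, mul_nrm, inv_nrm, hn, mul_inv_cancel₀ M.nrm_pos.ne', Nat.floor_one]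
  exact mul_inv_eq_one.1 (h1.eq_one h2)

/-- Integral lattices of prime norm prime to the discriminant. -/
structure IsPr (P : Lat D) (p : ℕ) : Prop where
  prime : p.Prime
  not_dvd : ¬ p ∣ D
  isInt : P.IsInt
  nrm_eq : P.nrm = p

lemma IsPr.conj {P : Lat D} {p : ℕ} (h : P.IsPr p) : P.conj.IsPr p :=
  ⟨h.prime, h.not_dvd, h.isInt.conj, h.nrm_eq⟩

lemma IsPr.nn_eq {P : Lat D} {p : ℕ} (h : P.IsPr p) : P.nn = p := by simp [nn, h.nrm_eq]

lemma IsPr.le {P : Lat D} {p : ℕ} (h : P.IsPr p) : sc p * ord D ≤ P.carrier := by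
  have h1 : sc p * ord D = P.carrier * cj P.carrier := by rw [P.mul_cj, h.nrm_eq]; simp
  have h2 := mul_mono_right (P := P.carrier) h.isInt.conj
  rwa [P.mul_ord, conj_carrier, ← h1] at h2

lemma IsPr.natCast_mem {P : Lat D} {p : ℕ} (h : P.IsPr p) : (p : ℂ) ∈ P.carrier :=
  h.le (mem_sc_mul.2 ⟨1, one_mem_ord D, by simp⟩)

lemma IsPr.not_ord_le {P : Lat D} {p : ℕ} (h : P.IsPr p) : ¬ ord D ≤ P.carrier := by
  intro hle
  have h1 : P = 1 := ext' (le_antisymm h.isInt hle)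
  have := h.nn_eq
  rw [h1, nn_one] at this
  exact h.prime.one_lt.ne this

lemma IsPr.sup_eq {P P' : Lat D} {p : ℕ} (h : P.IsPr p) (h' : P'.IsPr p) (hne : P ≠ P') :
    P.carrier ⊔ P'.carrier = ord D := by
  haveI : NeZero p := ⟨h.prime.ne_zero⟩
  have hi : (P * P'.conj).IsInt := h.isInt.mul h'.isInt.conj
  have hpn : p ∣ (P * P'.conj).nn := by
    rw [h.isInt.nn_mul h'.isInt.conj, h.nn_eq]; exact dvd_mul_right _ _
  obtain hle | ⟨Q, -, hQn, hQ⟩ := le_or_exists_sup h.prime h.not_dvd hi hpn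
  · exfalso
    have h1 : P * P'.conj = ofNat D p := IsInt.eq_of_le hle (by
      rw [mul_nrm, conj_nrm, h.nrm_eq, h'.nrm_eq, ofNat_nrm, sq])
    rw [← mul_conj_eq h'.nrm_eq] at h1
    exact hne (mul_right_cancel h1)
  · have hsup : (P.carrier ⊔ P'.carrier) * P'.conj.carrier = Q.carrier := by
      rw [hQ, Submodule.sup_mul, mul_carrier]
      congr 1
      rw [conj_carrier, P'.mul_cj, h'.nrm_eq]; simp
    have hQ' : Q = P'.conj := IsInt.eq_of_le (by
      rw [← hsup]
      have h2 := mul_mono_left (P := P'.conj.carrier) (sup_le h.isInt h'.isInt)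
      rwa [mul_comm (ord D), P'.conj.mul_ord] at h2) (by rw [hQn, conj_nrm, h'.nrm_eq])
    rw [hQ'] at hsup
    have h3 := congrArg (· * (P'.conj⁻¹).carrier) hsup
    simp only [mul_assoc, ← mul_carrier, mul_inv_cancel, one_carrier] at h3
    rwa [Submodule.sup_mul, P.mul_ord, P'.mul_ord] at h3

lemma IsPr.eq_or_eq_conj {P P' : Lat D} {p : ℕ} (h : P.IsPr p) (h' : P'.IsPr p) :
    P' = P ∨ P' = P.conj := by
  by_contra! hcon
  have h1 := h'.sup_eq h hcon.1
  have h2 := h'.sup_eq h.conj hcon.2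
  apply h'.not_ord_le
  have h3 : ord D = (P'.carrier ⊔ P.carrier) * (P'.carrier ⊔ P.conj.carrier) := by
    rw [h1, h2, ord_mul_ord]
  rw [h3, Submodule.sup_mul]
  refine sup_le ?_ ?_
  · rw [h2, P'.mul_ord]
  · rw [Submodule.mul_sup]
    refine sup_le ?_ ?_
    · have := mul_mono_left (P := P'.carrier) h.isInt
      rwa [mul_comm (ord D), P'.mul_ord] at this
    · rw [conj_carrier, P.mul_cj, h.nrm_eq]
      simpa using h'.le

lemma IsPr.le_or_sup_eq {P : Lat D} {p : ℕ} (h : P.IsPr p) {a : Lat D} (ha : a.IsInt) :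
    a.carrier ≤ P.carrier ∨ a.carrier ⊔ P.carrier = ord D := by
  by_cases hpa : p ∣ a.nn
  · obtain hle | ⟨Q, hQi, hQn, hQ⟩ := le_or_exists_sup h.prime h.not_dvd ha hpa
    · exact Or.inl (hle.trans h.le)
    · have hQP : Q.IsPr p := ⟨h.prime, h.not_dvd, hQi, hQn⟩
      by_cases hne : Q = P
      · left; rw [← hne, hQ]; exact le_sup_left
      · right
        rw [← hQP.sup_eq h hne, hQ, sup_assoc, sup_eq_right.2 h.le]
  · right
    apply le_antisymm (sup_le ha h.isInt)
    apply ord_le_of_one_mem (by rw [Submodule.sup_mul, a.mul_ord, P.mul_ord])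
    have hcop : IsCoprime (p : ℤ) (a.nn : ℤ) :=
      Nat.isCoprime_iff_coprime.2 ((Nat.Prime.coprime_iff_not_dvd h.prime).2 hpa)
    obtain ⟨u, v, huv⟩ := hcop
    have : (1 : ℂ) = v • (a.nn : ℂ) + u • (p : ℂ) := by
      simp only [zsmul_eq_mul]; rw [add_comm]; exact_mod_cast huv.symm
    rw [this]
    exact add_mem (Submodule.smul_mem _ _ (Submodule.mem_sup_left ha.nn_mem))
      (Submodule.smul_mem _ _ (Submodule.mem_sup_right h.natCast_mem))

lemma IsPr.le_or_le {P : Lat D} {p : ℕ} (h : P.IsPr p) {a b : Lat D} (ha : a.IsInt)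
    (hb : b.IsInt) (hab : (a * b).carrier ≤ P.carrier) :
    a.carrier ≤ P.carrier ∨ b.carrier ≤ P.carrier := by
  by_contra! hcon
  have h1 := (h.le_or_sup_eq ha).resolve_left hcon.1
  have h2 := (h.le_or_sup_eq hb).resolve_left hcon.2
  apply h.not_ord_le
  have h3 : ord D = (a.carrier ⊔ P.carrier) * (b.carrier ⊔ P.carrier) := by
    rw [h1, h2, ord_mul_ord]
  rw [h3, Submodule.sup_mul, Submodule.mul_sup, h2, P.mul_ord]
  refine sup_le (sup_le hab ?_) le_rfl
  have := mul_mono_left (P := P.carrier) ha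
  rwa [mul_comm (ord D), P.mul_ord] at this

end Lat

end QuadLat

/-! ### Norms, classes representing a number, genera -/

namespace QuadLat

variable {D : ℕ} [hD : NegDisc D]

open QuadLat.Lat

variable (D) in
open Classical in
/-- A chosen atom above the prime `p`: a lattice of norm `p` if there is one, and `(p)`
otherwise. -/
noncomputable def atom (p : ℕ) : Lat D :=
  if h : ∃ P : Lat D, P.IsPr p then h.choose else if h' : p ≠ 0 then
    haveI : NeZero p := ⟨h'⟩
    ofNat D p else 1

variable (D) in
open Classical in
/-- The exponent of `p` in the norm of `atom D p`. -/
noncomputable def fdeg (p : ℕ) : ℕ := if ∃ P : Lat D, P.IsPr p then 1 else 2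

lemma fdeg_pos (p : ℕ) : 0 < fdeg D p := by
  unfold fdeg; split_ifs <;> norm_num

lemma atom_isPr {p : ℕ} (h : ∃ P : Lat D, P.IsPr p) : (atom D p).IsPr p := by
  rw [atom, dif_pos h]; exact h.choose_spec

lemma atom_eq_ofNat {p : ℕ} [NeZero p] (h : ¬ ∃ P : Lat D, P.IsPr p) : atom D p = ofNat D p := by
  rw [atom, dif_neg h, dif_pos (NeZero.ne p)]

lemma atom_isInt {p : ℕ} (hp : p.Prime) : (atom D p).IsInt := by
  haveI : NeZero p := ⟨hp.ne_zero⟩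
  by_cases h : ∃ P : Lat D, P.IsPr p
  · exact (atom_isPr h).isInt
  · rw [atom_eq_ofNat h]; exact ofNat_isInt

lemma atom_nn {p : ℕ} (hp : p.Prime) : (atom D p).nn = p ^ fdeg D p := by
  haveI : NeZero p := ⟨hp.ne_zero⟩
  by_cases h : ∃ P : Lat D, P.IsPr p
  · rw [(atom_isPr h).nn_eq, fdeg, if_pos h, pow_one]
  · rw [atom_eq_ofNat h, ofNat_nn, fdeg, if_neg h]

lemma exists_eq_mul_of_le {a Q : Lat D} (h : a.carrier ≤ Q.carrier) :
    ∃ b : Lat D, b.IsInt ∧ a = Q * b :=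
  ⟨a * Q⁻¹, le_iff.1 h, by rw [mul_comm, inv_mul_cancel_right]⟩

lemma exists_eq_atom_mul {p : ℕ} (hp : p.Prime) (hpD : ¬ p ∣ D) {a : Lat D} (ha : a.IsInt)
    (hpa : p ∣ a.nn) :
    ∃ Q b : Lat D, (Q = atom D p ∨ Q = (atom D p).conj) ∧ b.IsInt ∧ a = Q * b := by
  haveI : NeZero p := ⟨hp.ne_zero⟩
  obtain hle | ⟨P, hPi, hPn, hP⟩ := le_or_exists_sup hp hpD ha hpa
  · have h1 : a.carrier ≤ (atom D p).carrier := by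
      by_cases h : ∃ P : Lat D, P.IsPr p
      · exact hle.trans (atom_isPr h).le
      · rw [atom_eq_ofNat h]; exact hle
    obtain ⟨b, hb, hab⟩ := exists_eq_mul_of_le h1
    exact ⟨_, b, Or.inl rfl, hb, hab⟩
  · have hPp : P.IsPr p := ⟨hp, hpD, hPi, hPn⟩
    obtain ⟨b, hb, hab⟩ := exists_eq_mul_of_le (a := a) (Q := P) (by rw [hP]; exact le_sup_left)
    exact ⟨P, b, (atom_isPr ⟨P, hPp⟩).eq_or_eq_conj hPp, hb, hab⟩

lemma atom_or_conj {p : ℕ} (hp : p.Prime) {Q : Lat D}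
    (hQ : Q = atom D p ∨ Q = (atom D p).conj) : Q.IsInt ∧ Q.nn = p ^ fdeg D p := by
  obtain rfl | rfl := hQ
  · exact ⟨atom_isInt hp, atom_nn hp⟩
  · exact ⟨(atom_isInt hp).conj, atom_nn hp⟩

lemma atom_cls_div {p : ℕ} {Q Q' : Lat D} (hQ : Q = atom D p ∨ Q = (atom D p).conj)
    (hQ' : Q' = atom D p ∨ Q' = (atom D p).conj) : ∃ E : Cl D, cls Q = cls Q' * E ^ 2 := by
  obtain rfl | rfl := hQ <;> obtain rfl | rfl := hQ'
  · exact ⟨1, by simp⟩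
  · exact ⟨cls (atom D p), by rw [cls_conj, sq, inv_mul_cancel_left]⟩
  · exact ⟨(cls (atom D p))⁻¹, by rw [cls_conj, sq, mul_inv_cancel_left]⟩
  · exact ⟨1, by simp⟩

/-- Integral lattices of equal norm prime to the discriminant lie in the same genus. -/
lemma cls_div_sq {a b : Lat D} (ha : a.IsInt) (hb : b.IsInt) (hab : a.nn = b.nn)
    (hcop : a.nn.Coprime D) : ∃ E : Cl D, cls a = cls b * E ^ 2 := by
  induction hn : a.nn using Nat.strong_induction_on generalizing a b with
  | _ n ih =>
    by_cases h1 : n = 1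
    · rw [ha.eq_one (hn.trans h1), hb.eq_one (hab.symm.trans (hn.trans h1))]
      exact ⟨1, by simp⟩
    · obtain ⟨p, hp, hpn⟩ := Nat.exists_prime_and_dvd h1
      have hpD : ¬ p ∣ D := fun h => by
        have := Nat.dvd_gcd (hn ▸ hpn) h
        rw [hcop] at this
        exact hp.one_lt.ne' (Nat.dvd_one.1 this)
      obtain ⟨Q, a', hQ, ha', rfl⟩ := exists_eq_atom_mul hp hpD ha (hn ▸ hpn)
      obtain ⟨Q', b', hQ', hb', rfl⟩ := exists_eq_atom_mul hp hpD hb (hab ▸ hn ▸ hpn)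
      obtain ⟨hQi, hQn⟩ := atom_or_conj hp hQ
      obtain ⟨hQi', hQn'⟩ := atom_or_conj hp hQ'
      rw [hQi.nn_mul ha', hQn] at hab hcop hn
      rw [hQi'.nn_mul hb', hQn'] at hab
      have hpos : 0 < p ^ fdeg D p := pow_pos hp.pos _
      obtain ⟨E, hE⟩ := ih a'.nn (by
        rw [← hn]
        exact lt_mul_of_one_lt_left ha'.nn_pos (Nat.one_lt_pow (fdeg_pos p).ne' hp.one_lt)) ha' hb'
        (Nat.eq_of_mul_eq_mul_left hpos hab) (Nat.Coprime.coprime_mul_left hcop) rfl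
      obtain ⟨E', hE'⟩ := atom_cls_div hQ hQ'
      refine ⟨E * E', ?_⟩
      rw [map_mul, map_mul, hE, hE', mul_pow]
      simp only [mul_assoc, mul_left_comm, mul_comm]

/-- Classes representing `n` by an integral lattice. -/
def Rep (D : ℕ) [NegDisc D] (n : ℕ) : Set (Cl D) :=
  {C | ∃ a : Lat D, a.IsInt ∧ a.nn = n ∧ cls a = C}

lemma rep_mul {m n : ℕ} {C E : Cl D} (hC : C ∈ Rep D m) (hE : E ∈ Rep D n) :
    C * E ∈ Rep D (m * n) := by
  obtain ⟨a, ha, rfl, rfl⟩ := hC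
  obtain ⟨b, hb, rfl, rfl⟩ := hE
  exact ⟨a * b, ha.mul hb, ha.nn_mul hb, map_mul _ _ _⟩

lemma rep_inv {n : ℕ} {C : Cl D} (hC : C ∈ Rep D n) : C⁻¹ ∈ Rep D n := by
  obtain ⟨a, ha, rfl, rfl⟩ := hC
  exact ⟨a.conj, ha.conj, rfl, cls_conj _⟩

/-- Norms of integral lattices prime to the discriminant. -/
def normSet (D : ℕ) [NegDisc D] : Set ℕ := {n | n.Coprime D ∧ (Rep D n).Nonempty}

lemma normSet.pos {n : ℕ} (h : n ∈ normSet D) : 0 < n := by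
  obtain ⟨-, -, a, ha, rfl, -⟩ := h
  exact ha.nn_pos

lemma normSet.mul {m n : ℕ} (hm : m ∈ normSet D) (hn : n ∈ normSet D) : m * n ∈ normSet D := by
  obtain ⟨hm, C, hC⟩ := hm
  obtain ⟨hn, E, hE⟩ := hn
  exact ⟨hm.mul_left hn, _, rep_mul hC hE⟩

lemma not_dvd_of_coprime {p n : ℕ} (hp : p.Prime) (hpn : p ∣ n) (hn : n.Coprime D) : ¬ p ∣ D :=
  fun h => by
    have := Nat.dvd_gcd hpn h
    rw [hn] at this
    exact hp.one_lt.ne' (Nat.dvd_one.1 this)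

lemma isPr_of_mem_Rep {p : ℕ} (hp : p.Prime) (hpD : ¬ p ∣ D) {C : Cl D} (hC : C ∈ Rep D p) :
    ∃ P : Lat D, P.IsPr p ∧ cls P = C := by
  obtain ⟨P, hP, hPn, rfl⟩ := hC
  exact ⟨P, ⟨hp, hpD, hP, by rw [hP.nrm_eq, hPn]⟩, rfl⟩

lemma mem_Rep_mul_iff {p n : ℕ} (hp : p.Prime) (hpD : ¬ p ∣ D) {C : Cl D} (hC : C ∈ Rep D p)
    (x : Cl D) : x ∈ Rep D (p * n) ↔ C⁻¹ * x ∈ Rep D n ∨ C * x ∈ Rep D n := by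
  constructor
  · rintro ⟨a, ha, han, rfl⟩
    obtain ⟨P, hP, rfl⟩ := isPr_of_mem_Rep hp hpD hC
    obtain ⟨Q, b, hQ, hb, rfl⟩ := exists_eq_atom_mul hp hpD ha (han ▸ dvd_mul_right p n)
    have hQ' : Q.IsPr p := by
      have := atom_isPr ⟨P, hP⟩
      obtain rfl | rfl := hQ
      exacts [this, this.conj]
    rw [hQ'.isInt.nn_mul hb, hQ'.nn_eq] at han
    have hbn := Nat.eq_of_mul_eq_mul_left hp.pos han
    obtain rfl | rfl := hP.eq_or_eq_conj hQ'
    · left; exact ⟨b, hb, hbn, by rw [map_mul, inv_mul_cancel_left]⟩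
    · right; exact ⟨b, hb, hbn, by rw [map_mul, cls_conj, mul_inv_cancel_left]⟩
  · rintro (h | h)
    · simpa using rep_mul hC h
    · simpa using rep_mul (rep_inv hC) h

lemma normSet.of_prime_mul {p n : ℕ} (hp : p.Prime) (hpA : p ∈ normSet D) (h : p * n ∈ normSet D) :
    n ∈ normSet D := by
  obtain ⟨hc, x, hx⟩ := h
  obtain ⟨hpc, C, hC⟩ := hpA
  refine ⟨hc.coprime_mul_left, ?_⟩
  obtain h | h := (mem_Rep_mul_iff hp (not_dvd_of_coprime hp dvd_rfl hpc) hC x).1 hx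
  exacts [⟨_, h⟩, ⟨_, h⟩]

/-- The group of genera. -/
abbrev Gen (D : ℕ) [NegDisc D] : Type := Cl D ⧸ (powMonoidHom 2 : Cl D →* Cl D).range

/-- The genus of a class. -/
noncomputable def toGen : Cl D →* Gen D := QuotientGroup.mk' _

lemma toGen_eq_iff {C E : Cl D} : toGen C = toGen E ↔ ∃ X : Cl D, C = E * X ^ 2 := by
  rw [eq_comm, toGen, QuotientGroup.mk'_apply, QuotientGroup.mk'_apply, QuotientGroup.eq]
  simp only [MonoidHom.mem_range, powMonoidHom_apply]
  constructor
  · rintro ⟨X, hX⟩; exact ⟨X, by rw [hX, mul_inv_cancel_left]⟩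
  · rintro ⟨X, hX⟩; exact ⟨X, by rw [hX, inv_mul_cancel_left]⟩

open Classical in
/-- The genus of the lattices of norm `n`. -/
noncomputable def genus (D : ℕ) [NegDisc D] (n : ℕ) : Gen D :=
  if h : (Rep D n).Nonempty then toGen h.choose else 1

lemma genus_eq {n : ℕ} (hn : n.Coprime D) {C : Cl D} (hC : C ∈ Rep D n) :
    genus D n = toGen C := by
  have h : (Rep D n).Nonempty := ⟨C, hC⟩
  rw [genus, dif_pos h, toGen_eq_iff]
  obtain ⟨a, ha, han, ha'⟩ := h.choose_spec
  obtain ⟨b, hb, hbn, rfl⟩ := hC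
  rw [← ha']
  exact cls_div_sq ha hb (han.trans hbn.symm) (han ▸ hn)

lemma genus_mul {m n : ℕ} (hm : m ∈ normSet D) (hn : n ∈ normSet D) :
    genus D (m * n) = genus D m * genus D n := by
  obtain ⟨hm, C, hC⟩ := hm
  obtain ⟨hn, E, hE⟩ := hn
  rw [genus_eq hm hC, genus_eq hn hE, genus_eq (hm.mul_left hn) (rep_mul hC hE), map_mul]

/-! ### Filling up a genus -/

open Classical in
/-- Number of prime factors of `n` represented by the class `C`. -/
noncomputable def cnt (C : Cl D) (n : ℕ) : ℕ :=
  (n.primeFactorsList.filter (fun p => C ∈ Rep D p)).length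

lemma cnt_mul_of_mem {C : Cl D} {p n : ℕ} (hp : p.Prime) (hn : n ≠ 0) (h : C ∈ Rep D p) :
    cnt C (p * n) = cnt C n + 1 := by
  classical
  have := ((Nat.perm_primeFactorsList_mul hp.ne_zero hn).filter
    (fun p => decide (C ∈ Rep D p))).length_eq
  unfold cnt
  rw [this, List.filter_append, List.length_append, Nat.primeFactorsList_prime hp]
  simp [h, add_comm]

lemma cnt_fill {C : Cl D} {n : ℕ} (hn : n ∈ normSet D) :
    ∃ m ∈ normSet D, ∀ x : Cl D, x ∈ Rep D n ↔
      ∃ i ≤ cnt C n, C ^ (2 * i) * (C ^ cnt C n)⁻¹ * x ∈ Rep D m := by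
  have step : ∀ (i t : ℕ) (x : Cl D), C ^ (2 * (i + 1)) * (C ^ (t + 1))⁻¹ * x =
      C ^ (2 * i) * (C ^ t)⁻¹ * (C * x) := by
    intro i t x
    rw [← mul_assoc _ C x]
    congr 1
    group
  induction ht : cnt C n generalizing n with
  | zero => exact ⟨n, hn, fun x => ⟨fun h => ⟨0, le_rfl, by simpa using h⟩, fun ⟨i, hi, h⟩ => by
      obtain rfl : i = 0 := by omega
      simpa using h⟩⟩
  | succ t ih =>
    classical
    have hlen : 0 < (n.primeFactorsList.filter (fun p => decide (C ∈ Rep D p))).length := by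
      unfold cnt at ht; rw [ht]; omega
    obtain ⟨p, hp⟩ := List.exists_mem_of_length_pos hlen
    rw [List.mem_filter] at hp
    obtain ⟨hpm, hpC⟩ := hp
    have hC : C ∈ Rep D p := by simpa using hpC
    have hpp := Nat.prime_of_mem_primeFactorsList hpm
    obtain ⟨k, rfl⟩ := Nat.dvd_of_mem_primeFactorsList hpm
    have hpD := not_dvd_of_coprime hpp (dvd_mul_right p k) hn.1
    have hpA : p ∈ normSet D := ⟨hn.1.coprime_mul_right, C, hC⟩
    have hk := normSet.of_prime_mul hpp hpA hn
    rw [cnt_mul_of_mem hpp (normSet.pos hk).ne' hC] at ht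
    obtain ⟨m, hm, hx⟩ := ih hk (by omega)
    refine ⟨m, hm, fun x => ?_⟩
    rw [mem_Rep_mul_iff hpp hpD hC, hx, hx]
    constructor
    · rintro (⟨i, hi, h⟩ | ⟨i, hi, h⟩)
      · refine ⟨i, by omega, ?_⟩
        convert h using 1
        rw [pow_succ]; group
      · refine ⟨i + 1, by omega, ?_⟩
        convert h using 1
        exact step _ _ _
    · rintro ⟨i, hi, h⟩
      by_cases hi0 : i ≤ t
      · left
        refine ⟨i, by omega, ?_⟩
        convert h using 1
        rw [pow_succ]; group
      · right
        obtain ⟨j, rfl⟩ : ∃ j, i = j + 1 := ⟨i - 1, by omega⟩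
        refine ⟨j, by omega, ?_⟩
        convert h using 1
        exact (step _ _ _).symm

lemma Rep_stable {C : Cl D} [Finite (Cl D)] {n : ℕ} (hn : n ∈ normSet D)
    (hc : Nat.card (Cl D) ≤ cnt C n) {x : Cl D} (hx : x ∈ Rep D n) : C ^ 2 * x ∈ Rep D n := by
  obtain ⟨m, hm, h⟩ := cnt_fill (C := C) hn
  rw [h] at hx ⊢
  obtain ⟨i, hi, hx⟩ := hx
  rcases Nat.eq_zero_or_pos i with rfl | hi0
  · refine ⟨Nat.card (Cl D) - 1, by omega, ?_⟩
    convert hx using 1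
    have h1 : C ^ (2 * (Nat.card (Cl D) - 1)) * C ^ 2 = 1 := by
      rw [← pow_add, show 2 * (Nat.card (Cl D) - 1) + 2 = Nat.card (Cl D) * 2 by
        have := Nat.card_pos (α := Cl D); omega, pow_mul, pow_card_eq_one', one_pow]
    rw [mul_zero, pow_zero, one_mul, ← mul_assoc, mul_right_comm _ _ (C ^ 2), h1, one_mul]
  · refine ⟨i - 1, by omega, ?_⟩
    convert hx using 1
    rw [← mul_assoc, mul_right_comm _ _ (C ^ 2), ← pow_add]
    congr 4; omega

/-- If enough prime factors of `n` come from a generating set of classes, then `n` is represented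
by every class in its genus. -/
lemma mem_Rep_of_cnt [Finite (Cl D)] {H : Set (Cl D)} (hH : Subgroup.closure H = ⊤) {n : ℕ}
    (hn : n ∈ normSet D) (hc : ∀ C ∈ H, Nat.card (Cl D) ≤ cnt C n) {f : Cl D}
    (hf : genus D n = toGen f) : f ∈ Rep D n := by
  have key : ∀ E : Cl D, ∀ x ∈ Rep D n, E ^ 2 * x ∈ Rep D n := by
    intro E
    have hE : E ∈ Subgroup.closure H := hH ▸ Subgroup.mem_top E
    induction hE using Subgroup.closure_induction with
    | mem C hC => exact fun x hx => Rep_stable hn (hc C hC) hx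
    | one => simp
    | mul a b _ _ iha ihb =>
      intro x hx
      rw [mul_pow, mul_assoc]
      exact iha _ (ihb _ hx)
    | inv a _ ih =>
      intro x hx
      have := rep_inv (ih _ (rep_inv hx))
      rw [mul_inv, inv_inv] at this
      rwa [inv_pow]
  obtain ⟨hcop, y, hy⟩ := hn
  rw [genus_eq hcop hy, eq_comm, toGen_eq_iff] at hf
  obtain ⟨X, rfl⟩ := hf
  rw [mul_comm]
  exact key X y hy

/-! ### Decomposition of lattices prime to the discriminant -/

variable (D) in
/-- Completely multiplicative extension of `atom`. -/
noncomputable def atoms (n : ℕ) : Lat D := (n.primeFactorsList.map (atom D)).prod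

variable (D) in
/-- The norm of `atoms D n`. -/
noncomputable def atomsNorm (n : ℕ) : ℕ := (n.primeFactorsList.map (fun p => p ^ fdeg D p)).prod

lemma atoms_one : atoms D 1 = 1 := by simp [atoms]

lemma atomsNorm_one : atomsNorm D 1 = 1 := by simp [atomsNorm]

lemma atoms_mul {p n : ℕ} (hp : p.Prime) (hn : n ≠ 0) : atoms D (p * n) = atom D p * atoms D n := by
  have := ((Nat.perm_primeFactorsList_mul hp.ne_zero hn).map (atom D)).prod_eq
  rw [atoms, this, List.map_append, List.prod_append, Nat.primeFactorsList_prime hp]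
  simp [atoms]

lemma atomsNorm_mul {p n : ℕ} (hp : p.Prime) (hn : n ≠ 0) :
    atomsNorm D (p * n) = p ^ fdeg D p * atomsNorm D n := by
  have := ((Nat.perm_primeFactorsList_mul hp.ne_zero hn).map (fun p => p ^ fdeg D p)).prod_eq
  rw [atomsNorm, this, List.map_append, List.prod_append, Nat.primeFactorsList_prime hp]
  simp [atomsNorm]

lemma atomsNorm_ne_zero (n : ℕ) : atomsNorm D n ≠ 0 := by
  rw [atomsNorm]
  intro h
  rw [List.prod_eq_zero_iff, List.mem_map] at h
  obtain ⟨p, hp, h⟩ := h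
  exact (Nat.prime_of_mem_primeFactorsList hp).ne_zero (pow_eq_zero_iff (fdeg_pos p).ne' |>.1 h)

lemma atoms_isInt_and_nn (n : ℕ) (hn : n ≠ 0) :
    (atoms D n).IsInt ∧ (atoms D n).nn = atomsNorm D n := by
  induction n using induction_on_primes with
  | zero => exact absurd rfl hn
  | one => rw [atoms_one, atomsNorm_one]; exact ⟨isInt_one, nn_one⟩
  | prime_mul p a hp ih =>
    have ha : a ≠ 0 := by rintro rfl; simp at hn
    obtain ⟨h1, h2⟩ := ih ha
    rw [atoms_mul hp ha, atomsNorm_mul hp ha]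
    exact ⟨(atom_isInt hp).mul h1, by rw [(atom_isInt hp).nn_mul h1, h2, atom_nn hp]⟩

lemma atomsNorm_factorization (n : ℕ) (hn : n ≠ 0) (q : ℕ) :
    (atomsNorm D n).factorization q = fdeg D q * n.factorization q := by
  induction n using induction_on_primes with
  | zero => exact absurd rfl hn
  | one => simp [atomsNorm_one]
  | prime_mul p a hp ih =>
    have ha : a ≠ 0 := by rintro rfl; simp at hn
    rw [atomsNorm_mul hp ha, Nat.factorization_mul (pow_ne_zero _ hp.ne_zero) (atomsNorm_ne_zero a),
      Nat.factorization_mul hp.ne_zero ha, Nat.factorization_pow, Finsupp.add_apply,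
      Finsupp.add_apply, ih ha, hp.factorization, mul_add]
    congr 1
    rw [Finsupp.smul_apply, Finsupp.single_apply]
    split_ifs with h
    · rw [h]; simp
    · simp

lemma atomsNorm_injOn : Set.InjOn (atomsNorm D) {n | n ≠ 0} := by
  intro m hm n hn h
  refine Nat.eq_of_factorization_eq hm hn fun q => ?_
  have h1 := atomsNorm_factorization (D := D) m hm q
  rw [h, atomsNorm_factorization n hn q] at h1
  exact (Nat.eq_of_mul_eq_mul_left (fdeg_pos q) h1).symm

lemma exists_eq_atoms_mul {a : Lat D} (ha : a.IsInt) (hcop : a.nn.Coprime D) :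
    ∃ m n : ℕ, m ≠ 0 ∧ n ≠ 0 ∧ a = atoms D m * (atoms D n).conj := by
  induction hn : a.nn using Nat.strong_induction_on generalizing a with
  | _ k ih =>
    by_cases h1 : k = 1
    · refine ⟨1, 1, one_ne_zero, one_ne_zero, ?_⟩
      rw [ha.eq_one (hn.trans h1), atoms_one]
      apply ext'
      rw [mul_carrier, conj_carrier, one_carrier, cj_ord, ord_mul_ord]
    · obtain ⟨p, hp, hpn⟩ := Nat.exists_prime_and_dvd h1
      have hpD : ¬ p ∣ D := not_dvd_of_coprime hp (hn ▸ hpn) hcop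
      obtain ⟨Q, b, hQ, hb, rfl⟩ := exists_eq_atom_mul hp hpD ha (hn ▸ hpn)
      obtain ⟨hQi, hQn⟩ := atom_or_conj hp hQ
      rw [hQi.nn_mul hb, hQn] at hcop hn
      obtain ⟨m, n, hm, hn', rfl⟩ := ih b.nn (by
        rw [← hn]
        exact lt_mul_of_one_lt_left hb.nn_pos (Nat.one_lt_pow (fdeg_pos p).ne' hp.one_lt)) hb
        hcop.coprime_mul_left rfl
      obtain rfl | rfl := hQ
      · refine ⟨p * m, n, mul_ne_zero hp.ne_zero hm, hn', ?_⟩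
        rw [atoms_mul hp hm, mul_assoc]
      · refine ⟨m, p * n, hm, mul_ne_zero hp.ne_zero hn', ?_⟩
        rw [atoms_mul hp hn', Lat.conj_mul, mul_left_comm]

end QuadLat

/-! ### Binary quadratic forms and reduction -/

namespace QuadLat

variable {D : ℕ} [hD : NegDisc D]

open QuadLat.Lat

/-- `(a, b, c)` are the coefficients of a primitive positive form of discriminant `-D`. -/
structure IsForm (D : ℕ) (a b c : ℤ) : Prop where
  pos : 0 < a
  disc : b ^ 2 + D = 4 * a * c
  prim : ∃ u v w : ℤ, u * a + v * b + w * c = 1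

/-- The root `(b + i √D) / (2 a)`. -/
noncomputable def tau (D : ℕ) (a b : ℤ) : ℂ := ⟨b / (2 * a), √D / (2 * a)⟩

/-- The lattice spanned by `1` and `tau D a b`. -/
noncomputable def tauSpan (D : ℕ) (a b : ℤ) : Submodule ℤ ℂ := Submodule.span ℤ {1, tau D a b}

lemma mem_tauSpan {a b : ℤ} {z : ℂ} :
    z ∈ tauSpan D a b ↔ ∃ x y : ℤ, (x : ℂ) + y * tau D a b = z := by
  simp [tauSpan, Submodule.mem_span_pair]

lemma one_mem_tauSpan {a b : ℤ} : (1 : ℂ) ∈ tauSpan D a b := mem_tauSpan.2 ⟨1, 0, by simp⟩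

lemma tau_mem_tauSpan {a b : ℤ} : tau D a b ∈ tauSpan D a b := mem_tauSpan.2 ⟨0, 1, by simp⟩

lemma IsForm.even {a b c : ℤ} (h : IsForm D a b c) : ∃ k : ℤ, (D : ℤ) = b + 2 * k := by
  have h1 := h.disc
  have h2 : ((D : ℤ) - b) % 2 = 0 := by
    have h3 : (b ^ 2 + D) % 2 = 0 := by rw [h1, mul_assoc]; omega
    have h4 : (b ^ 2 - b) % 2 = 0 := by
      have := Int.even_mul_pred_self b
      rw [← Int.even_iff]; convert this using 1; ring
    omega
  exact ⟨(D - b) / 2, by omega⟩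

lemma IsForm.cR {a b c : ℤ} (h : IsForm D a b c) : (b : ℝ) ^ 2 + D = 4 * a * c := by
  exact_mod_cast h.disc

lemma IsForm.aR {a b c : ℤ} (h : IsForm D a b c) : (0 : ℝ) < a := by exact_mod_cast h.pos

lemma IsForm.aC {a b c : ℤ} (h : IsForm D a b c) : (a : ℂ) ≠ 0 := by exact_mod_cast h.pos.ne'

lemma sqrt_sq_D (D : ℕ) : √(D : ℝ) * √D = D := Real.mul_self_sqrt (Nat.cast_nonneg D)

lemma IsForm.omega_eq {a b c : ℤ} (h : IsForm D a b c) {k : ℤ} (hk : (D : ℤ) = b + 2 * k) :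
    omega D = k + a * tau D a b := by
  have ha := h.aR
  have hk' : (D : ℝ) = b + 2 * k := by exact_mod_cast hk
  apply Complex.ext
  · simp [omega, tau]; rw [hk']; field_simp; ring
  · simp [omega, tau]; field_simp

lemma IsForm.tau_sq {a b c : ℤ} (h : IsForm D a b c) :
    a * (tau D a b * tau D a b) = b * tau D a b - c := by
  have ha := h.aR
  have h1 := h.cR
  have h2 := sqrt_sq_D D
  apply Complex.ext
  · simp [tau]; field_simp; nlinarith
  · simp [tau]; field_simp; ring

lemma IsForm.tau_add_conj {a b c : ℤ} (h : IsForm D a b c) :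
    a * (tau D a b + (starRingEnd ℂ) (tau D a b)) = b := by
  have ha := h.aR
  apply Complex.ext
  · simp [tau]; field_simp; ring
  · simp [tau]

lemma IsForm.tau_mul_conj {a b c : ℤ} (h : IsForm D a b c) :
    a * (tau D a b * (starRingEnd ℂ) (tau D a b)) = c := by
  have h1 := h.tau_add_conj
  have h2 := h.tau_sq
  linear_combination tau D a b * h1 - h2

/-- The lattice attached to a form. -/
noncomputable def formLat {a b c : ℤ} (h : IsForm D a b c) : Lat D where
  carrier := tauSpan D a b
  nrm := (a : ℝ)⁻¹
  nrm_pos := inv_pos.2 h.aR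
  mul_ord := by
    obtain ⟨k, hk⟩ := h.even
    apply le_antisymm
    · rw [ord, tauSpan, Submodule.span_mul_span, Submodule.span_le]
      rintro _ ⟨x, hx, y, hy, rfl⟩
      change x * y ∈ tauSpan D a b
      simp only [Set.mem_insert_iff, Set.mem_singleton_iff] at hx hy
      obtain rfl | rfl := hx <;> obtain rfl | rfl := hy
      · simpa using one_mem_tauSpan
      · rw [one_mul, h.omega_eq hk]; exact mem_tauSpan.2 ⟨k, a, rfl⟩
      · rw [mul_one]; exact tau_mem_tauSpan
      · rw [h.omega_eq hk]
        refine mem_tauSpan.2 ⟨-c, b + k, ?_⟩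
        push_cast
        linear_combination (-1 : ℂ) * h.tau_sq
    · intro z hz
      simpa using Submodule.mul_mem_mul hz (one_mem_ord D)
  mul_cj := by
    obtain ⟨k, hk⟩ := h.even
    obtain ⟨u, v, w, huvw⟩ := h.prim
    have huvw' : (u : ℂ) * a + v * b + w * c = 1 := by exact_mod_cast huvw
    have ha := h.aC
    have hom := h.omega_eq hk
    have hs := h.tau_add_conj
    have hm := h.tau_mul_conj
    have hcj : cj (tauSpan D a b) = Submodule.span ℤ {1, (starRingEnd ℂ) (tau D a b)} := by
      simp [cj, tauSpan, Submodule.map_span, Set.image_pair]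
    have hmem1 : (1 : ℂ) ∈ cj (tauSpan D a b) := mem_cj.2 (by simpa using one_mem_tauSpan)
    have hmemt : (starRingEnd ℂ) (tau D a b) ∈ cj (tauSpan D a b) :=
      mem_cj.2 (by simpa using tau_mem_tauSpan)
    apply le_antisymm
    · rw [hcj, tauSpan, Submodule.span_mul_span, Submodule.span_le]
      rintro _ ⟨x, hx, y, hy, rfl⟩
      change x * y ∈ sc _ * ord D
      rw [mem_sc_mul]
      simp only [Set.mem_insert_iff, Set.mem_singleton_iff] at hx hy
      push_cast
      obtain rfl | rfl := hx <;> obtain rfl | rfl := hy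
      · exact ⟨a, int_mem_ord D a, by field_simp⟩
      · refine ⟨((b + k : ℤ) : ℂ) + ((-1 : ℤ) : ℂ) * omega D, mem_ord.2 ⟨b + k, -1, rfl⟩, ?_⟩
        rw [hom, inv_mul_eq_iff_eq_mul₀ ha]
        push_cast
        linear_combination -hs
      · refine ⟨((-k : ℤ) : ℂ) + ((1 : ℤ) : ℂ) * omega D, mem_ord.2 ⟨-k, 1, rfl⟩, ?_⟩
        rw [hom, inv_mul_eq_iff_eq_mul₀ ha]
        push_cast; ring
      · exact ⟨c, int_mem_ord D c, by rw [inv_mul_eq_iff_eq_mul₀ ha, hm]⟩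
    · intro z hz
      obtain ⟨w', hw', rfl⟩ := mem_sc_mul.1 hz
      obtain ⟨x, y, rfl⟩ := mem_ord.1 hw'
      set M := tauSpan D a b * cj (tauSpan D a b) with hM
      have m1 : (1 : ℂ) ∈ M := by
        simpa using Submodule.mul_mem_mul (one_mem_tauSpan (D := D) (a := a) (b := b)) hmem1
      have m2 : tau D a b ∈ M := by
        simpa using Submodule.mul_mem_mul (tau_mem_tauSpan (D := D) (a := a) (b := b)) hmem1
      have m3 : (starRingEnd ℂ) (tau D a b) ∈ M := by
        simpa using Submodule.mul_mem_mul (one_mem_tauSpan (D := D) (a := a) (b := b)) hmemt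
      have m4 : tau D a b * (starRingEnd ℂ) (tau D a b) ∈ M :=
        Submodule.mul_mem_mul (tau_mem_tauSpan (D := D) (a := a) (b := b)) hmemt
      have m5 : (a : ℂ)⁻¹ ∈ M := by
        have : (a : ℂ)⁻¹ = u • (1 : ℂ) + v • (tau D a b + (starRingEnd ℂ) (tau D a b)) +
            w • (tau D a b * (starRingEnd ℂ) (tau D a b)) := by
          simp only [zsmul_eq_mul]
          refine inv_eq_of_mul_eq_one_right ?_
          linear_combination v * hs + w * hm + huvw'
        rw [this]
        exact add_mem (add_mem (Submodule.smul_mem _ _ m1)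
          (Submodule.smul_mem _ _ (add_mem m2 m3))) (Submodule.smul_mem _ _ m4)
      have m6 : (a : ℂ)⁻¹ * omega D ∈ M := by
        have : (a : ℂ)⁻¹ * omega D = tau D a b + k • (a : ℂ)⁻¹ := by
          rw [hom, zsmul_eq_mul]; field_simp; ring
        rw [this]
        exact add_mem m2 (Submodule.smul_mem _ _ m5)
      have : (((a : ℝ)⁻¹ : ℝ) : ℂ) * (x + y * omega D) =
        x • (a : ℂ)⁻¹ + y • ((a : ℂ)⁻¹ * omega D) := by
        simp only [zsmul_eq_mul]; push_cast; ring
      rw [this]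
      exact add_mem (Submodule.smul_mem _ _ m5) (Submodule.smul_mem _ _ m6)

lemma formLat_carrier {a b c : ℤ} (h : IsForm D a b c) : (formLat h).carrier = tauSpan D a b := rfl

lemma formLat_nrm {a b c : ℤ} (h : IsForm D a b c) : (formLat h).nrm = (a : ℝ)⁻¹ := rfl

lemma IsForm.neg {a b c : ℤ} (h : IsForm D a b c) : IsForm D a (-b) c := by
  obtain ⟨h1, h2, u, v, w, h3⟩ := h
  exact ⟨h1, by rw [neg_sq, h2], u, -v, w, by rw [neg_mul_neg, h3]⟩

lemma tau_neg (a b : ℤ) : tau D a (-b) = -(starRingEnd ℂ) (tau D a b) := by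
  apply Complex.ext
  · simp [tau]; ring
  · simp [tau]

lemma formLat_neg {a b c : ℤ} (h : IsForm D a b c) : formLat h.neg = (formLat h).conj := by
  apply ext'
  rw [conj_carrier, formLat_carrier, formLat_carrier]
  ext z
  rw [mem_cj, mem_tauSpan, mem_tauSpan]
  constructor
  · rintro ⟨x, y, rfl⟩
    exact ⟨x, -y, by simp [tau_neg]⟩
  · rintro ⟨x, y, hz⟩
    refine ⟨x, -y, ?_⟩
    have := congrArg (starRingEnd ℂ) hz
    rw [Complex.conj_conj] at this
    rw [← this]; simp [tau_neg]

lemma IsForm.normSq_eq {a b c : ℤ} (h : IsForm D a b c) (x y : ℤ) :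
    a * Complex.normSq (x + y * tau D a b) = a * x ^ 2 + b * x * y + c * y ^ 2 := by
  have ha := h.aR
  have h1 := h.cR
  have h2 := sqrt_sq_D D
  rw [Complex.normSq_apply]
  simp [tau]
  field_simp
  linear_combination (y : ℝ) ^ 2 * h1 + (y : ℝ) ^ 2 * h2

lemma cls_formLat_mem_Rep {a : ℕ} {b c : ℤ} (h : IsForm D a b c) : cls (formLat h) ∈ Rep D a := by
  have ha : 0 < a := by exact_mod_cast h.pos
  haveI : NeZero a := ⟨ha.ne'⟩
  have haC := h.aC
  refine ⟨ofNat D a * formLat h, ?_, ?_, by rw [map_mul, cls_ofNat, one_mul]⟩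
  · obtain ⟨k, hk⟩ := h.even
    intro z hz
    rw [mul_carrier, ofNat_carrier, mul_assoc, mul_comm (ord D), (formLat h).mul_ord] at hz
    obtain ⟨w, hw, rfl⟩ := mem_sc_mul.1 hz
    rw [formLat_carrier] at hw
    obtain ⟨x, y, rfl⟩ := mem_tauSpan.1 hw
    refine mem_ord.2 ⟨a * x - k * y, y, ?_⟩
    rw [h.omega_eq hk]; push_cast; ring
  · rw [nn, mul_nrm, ofNat_nrm, formLat_nrm]
    have : (a : ℝ) ^ 2 * ((a : ℤ) : ℝ)⁻¹ = a := by
      push_cast; field_simp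
    rw [this, Nat.floor_natCast]

namespace Lat

lemma exists_q {L : Lat D} {v : ℂ} (hv : v ∈ L.carrier) :
    ∃ n : ℕ, Complex.normSq v = L.nrm * n := by
  have h1 : v * (starRingEnd ℂ) v ∈ L.carrier * cj L.carrier :=
    Submodule.mul_mem_mul hv (mem_cj.2 (by simpa using hv))
  rw [L.mul_cj] at h1
  obtain ⟨w, hw, hwv⟩ := mem_sc_mul.1 h1
  rw [Complex.mul_conj] at hwv
  have h0 : (L.nrm : ℂ) ≠ 0 := by exact_mod_cast L.nrm_pos.ne'
  have hw' : w = ((Complex.normSq v / L.nrm : ℝ) : ℂ) := by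
    push_cast; rw [← hwv]; field_simp
  obtain ⟨n, hn⟩ := real_mem_ord (hw' ▸ hw)
  have hn0 : 0 ≤ n := by
    have : (0 : ℝ) ≤ n := hn ▸ div_nonneg (Complex.normSq_nonneg _) L.nrm_pos.le
    exact_mod_cast this
  lift n to ℕ using hn0
  refine ⟨n, ?_⟩
  rw [div_eq_iff L.nrm_pos.ne'] at hn
  rw [hn]; push_cast; ring

lemma exists_ne_zero (L : Lat D) : ∃ v ∈ L.carrier, v ≠ 0 := by
  by_contra! hcon
  have h0 : L.carrier = ⊥ := (Submodule.eq_bot_iff _).2 hcon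
  have h1 := L.mul_cj
  rw [h0, Submodule.bot_mul] at h1
  have h2 : (L.nrm : ℂ) ∈ sc L.nrm * ord D := mem_sc_mul.2 ⟨1, one_mem_ord D, by simp⟩
  rw [← h1, Submodule.mem_bot] at h2
  exact L.nrm_pos.ne' (by exact_mod_cast h2)

lemma exists_min (L : Lat D) : ∃ v ∈ L.carrier, v ≠ 0 ∧
    ∀ w ∈ L.carrier, w ≠ 0 → Complex.normSq v ≤ Complex.normSq w := by
  classical
  have hex : ∃ n : ℕ, ∃ v ∈ L.carrier, v ≠ 0 ∧ Complex.normSq v = L.nrm * n := by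
    obtain ⟨v, hv, hv0⟩ := L.exists_ne_zero
    obtain ⟨n, hn⟩ := exists_q hv
    exact ⟨n, v, hv, hv0, hn⟩
  obtain ⟨v, hv, hv0, hvn⟩ := Nat.find_spec hex
  refine ⟨v, hv, hv0, fun w hw hw0 => ?_⟩
  obtain ⟨m, hm⟩ := exists_q hw
  rw [hvn, hm]
  have : Nat.find hex ≤ m := Nat.find_min' hex ⟨w, hw, hw0, hm⟩
  exact mul_le_mul_of_nonneg_left (by exact_mod_cast this) L.nrm_pos.le

end Lat

/-- Every class contains the lattice of a reduced form. -/
lemma exists_reduced (C : Cl D) :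
    ∃ (a b c : ℤ) (h : IsForm D a b c), |b| ≤ a ∧ a ≤ c ∧ cls (formLat h) = C := by
  obtain ⟨L₀, rfl⟩ := cls_surjective C
  obtain ⟨v, hv, hv0, hmin⟩ := L₀.exists_min
  obtain ⟨L, hL⟩ : ∃ L, L = princHom D (Units.mk0 v hv0)⁻¹ * L₀ := ⟨_, rfl⟩
  have hcls : cls L = cls L₀ := by rw [hL, map_mul, cls_princ, one_mul]
  rw [← hcls]
  have hLmem : ∀ z, z ∈ L.carrier ↔ v * z ∈ L₀.carrier := by
    intro z
    rw [hL, mul_carrier, princHom_carrier, mul_assoc, mul_comm (ord D), L₀.mul_ord, mem_sc_mul]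
    simp only [Units.val_inv_eq_inv_val, Units.val_mk0]
    constructor
    · rintro ⟨w, hw, rfl⟩; rwa [mul_inv_cancel_left₀ hv0]
    · intro h; exact ⟨_, h, inv_mul_cancel_left₀ hv0 z⟩
  have hone : (1 : ℂ) ∈ L.carrier := (hLmem 1).2 (by simpa using hv)
  have hLmin : ∀ z ∈ L.carrier, z ≠ 0 → 1 ≤ Complex.normSq z := by
    intro z hz hz0
    have := hmin _ ((hLmem z).1 hz) (mul_ne_zero hv0 hz0)
    rw [map_mul] at this
    exact (le_mul_iff_one_le_right (Complex.normSq_pos.2 hv0)).1 this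
  clear hL hLmem hmin hv hcls
  -- the real elements are the integers
  have hreal : ∀ r : ℝ, (r : ℂ) ∈ L.carrier → ∃ n : ℤ, r = n := by
    intro r hr
    refine ⟨⌊r⌋, ?_⟩
    by_contra hne
    have h1 : ((Int.fract r : ℝ) : ℂ) ∈ L.carrier := by
      have : ((Int.fract r : ℝ) : ℂ) = (r : ℂ) - ⌊r⌋ • (1 : ℂ) := by
        rw [Int.fract]; push_cast; simp
      rw [this]
      exact sub_mem hr (Submodule.smul_mem _ _ hone)
    have h2 : Int.fract r ≠ 0 := fun h => hne (by rw [Int.fract] at h; linarith)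
    have h3 := hLmin _ h1 (by exact_mod_cast h2)
    rw [Complex.normSq_ofReal] at h3
    nlinarith [Int.fract_lt_one r, Int.fract_nonneg r]
  have hconj : ∀ z ∈ L.carrier, (starRingEnd ℂ) z ∈ cj L.carrier :=
    fun z hz => mem_cj.2 (by simpa using hz)
  obtain ⟨a, ha⟩ := exists_q hone
  have hν := L.nrm_pos
  simp only [map_one] at ha
  have ha0 : (a : ℝ) ≠ 0 := by rintro h; rw [h] at ha; simp at ha
  have hapos : (0 : ℝ) < a := lt_of_le_of_ne (Nat.cast_nonneg a) ha0.symm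
  have hnrm : L.nrm = (a : ℝ)⁻¹ := by field_simp; linarith
  have haC : (a : ℂ) ≠ 0 := by exact_mod_cast ha0
  have hLL : ∀ z, z ∈ L.carrier * cj L.carrier ↔ a * z ∈ ord D := by
    intro z
    rw [L.mul_cj, hnrm, mem_sc_mul]
    push_cast
    constructor
    · rintro ⟨w, hw, rfl⟩; rwa [mul_inv_cancel_left₀ haC]
    · intro h; exact ⟨_, h, inv_mul_cancel_left₀ haC z⟩
  have h_int : ∀ z ∈ L.carrier, (a : ℂ) * z ∈ ord D := by
    intro z hz
    rw [← hLL]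
    simpa using Submodule.mul_mem_mul hz (hconj _ hone)
  have hordL : ord D ≤ L.carrier := ord_le_of_one_mem L.mul_ord hone
  have hsD : (0 : ℝ) < √D := Real.sqrt_pos.2 (by exact_mod_cast hD.pos)
  have hordim : ∀ w ∈ ord D, ∃ n : ℤ, w.im = n * (√D / 2) := by
    intro w hw
    obtain ⟨x, y, rfl⟩ := mem_ord.1 hw
    exact ⟨y, by simp [omega]⟩
  -- a generator with minimal imaginary part
  let Y : AddSubgroup ℤ :=
    { carrier := {n | ∃ z ∈ L.carrier, a * z.im = n * (√D / 2)}
      zero_mem' := ⟨0, L.carrier.zero_mem, by simp⟩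
      add_mem' := by
        rintro m n ⟨z, hz, h1⟩ ⟨w, hw, h2⟩
        exact ⟨z + w, add_mem hz hw, by rw [Complex.add_im, mul_add, h1, h2]; push_cast; ring⟩
      neg_mem' := by
        rintro m ⟨z, hz, h1⟩
        exact ⟨-z, neg_mem hz, by rw [Complex.neg_im, mul_neg, h1]; push_cast; ring⟩ }
  obtain ⟨d, hd⟩ := Int.subgroup_cyclic Y
  have hdmem : d ∈ Y := by rw [hd]; exact AddSubgroup.mem_closure_singleton_self d
  obtain ⟨t, ht, htd⟩ : ∃ z ∈ L.carrier, a * z.im = d * (√D / 2) := hdmem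
  have hspan : ∀ z ∈ L.carrier, ∃ x y : ℤ, (x : ℂ) + y * t = z := by
    intro z hz
    obtain ⟨n, hn⟩ := hordim _ (h_int z hz)
    have hn' : (a : ℝ) * z.im = n * (√D / 2) := by rw [← hn]; simp
    have hnY : n ∈ Y := ⟨z, hz, hn'⟩
    rw [hd, AddSubgroup.mem_closure_singleton] at hnY
    obtain ⟨m, hm⟩ := hnY
    have him : (z - m • t).im = 0 := by
      have : (a : ℝ) * (z - m • t).im = 0 := by
        rw [← hm] at hn'
        simp only [zsmul_eq_mul, Complex.sub_im, Complex.mul_im, Complex.intCast_re,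
          Complex.intCast_im]
        simp only [smul_eq_mul, Int.cast_mul] at hn'
        linear_combination hn' - m * htd
      exact (mul_eq_zero.1 this).resolve_left ha0
    have hre : (((z - m • t).re : ℝ) : ℂ) = z - m • t := by
      apply Complex.ext
      · simp
      · rw [him]; simp
    obtain ⟨x, hx⟩ := hreal _ (hre ▸ sub_mem hz (Submodule.smul_mem _ m ht))
    refine ⟨x, m, ?_⟩
    have : (x : ℂ) = z - m • t := by rw [← hre, hx]; simp
    rw [this, zsmul_eq_mul]; ring
  have hLLspan : ∀ t : ℂ, (∀ z ∈ L.carrier, ∃ x y : ℤ, (x : ℂ) + y * t = z) →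
      ∀ z ∈ L.carrier * cj L.carrier, ∃ x y u w : ℤ,
      z = x + y * t + u * (starRingEnd ℂ) t + w * (t * (starRingEnd ℂ) t) := by
    intro t hspan z hz
    refine Submodule.mul_induction_on hz ?_ ?_
    · intro m hm n hn
      obtain ⟨x, y, rfl⟩ := hspan m hm
      obtain ⟨u, w, h⟩ := hspan _ (mem_cj.1 hn)
      have hn' : n = u + w * (starRingEnd ℂ) t := by
        have := congrArg (starRingEnd ℂ) h
        rw [Complex.conj_conj] at this
        rw [← this]; simp
      exact ⟨x * u, y * u, x * w, y * w, by rw [hn']; push_cast; ring⟩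
    · rintro z₁ z₂ ⟨x, y, u, w, rfl⟩ ⟨x', y', u', w', rfl⟩
      exact ⟨x + x', y + y', u + u', w + w', by push_cast; ring⟩
  have htt : t * (starRingEnd ℂ) t = ((Complex.normSq t : ℝ) : ℂ) := Complex.mul_conj t
  -- `d` is a unit
  have hd1 : d = 1 ∨ d = -1 := by
    have h1 : (a : ℂ)⁻¹ * omega D ∈ L.carrier * cj L.carrier :=
      (hLL _).2 (by rw [mul_inv_cancel_left₀ haC]; exact omega_mem_ord D)
    obtain ⟨x, y, u, w, h⟩ := hLLspan t hspan _ h1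
    have h2 : omega D = a * (x + y * t + u * (starRingEnd ℂ) t + w * (t * (starRingEnd ℂ) t)) := by
      rw [← h, mul_inv_cancel_left₀ haC]
    have h3 := congrArg Complex.im h2
    rw [htt] at h3
    simp [omega] at h3
    have h4 : √(D : ℝ) / 2 * 1 = √D / 2 * (d * (y - u)) := by
      linear_combination h3 + (y - u : ℝ) * htd
    have h5 : (1 : ℝ) = d * (y - u) := mul_left_cancel₀ (by positivity) h4
    have h6 : d * (y - u) = 1 := by exact_mod_cast h5.symm
    exact Int.isUnit_iff.1 (IsUnit.of_mul_eq_one _ h6)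
  have hdd : d * d = 1 := by rcases hd1 with rfl | rfl <;> norm_num
  have hddR : (d : ℝ) * d = 1 := by exact_mod_cast hdd
  have hddC : (d : ℂ) * d = 1 := by exact_mod_cast hdd
  -- shift into the strip of width one
  set m : ℤ := round (d * t.re) with hm
  obtain ⟨s, hs⟩ : ∃ s : ℂ, s = d • t - m • (1 : ℂ) := ⟨_, rfl⟩
  have hsL : s ∈ L.carrier :=
    hs ▸ sub_mem (Submodule.smul_mem _ _ ht) (Submodule.smul_mem _ _ hone)
  have hsspan : ∀ z ∈ L.carrier, ∃ x y : ℤ, (x : ℂ) + y * s = z := by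
    intro z hz
    obtain ⟨x, y, rfl⟩ := hspan z hz
    refine ⟨x + y * d * m, y * d, ?_⟩
    rw [hs]; simp only [zsmul_eq_mul]; push_cast
    linear_combination (y * t) * hddC
  have hsim : a * s.im = √D / 2 := by
    rw [hs]; simp only [zsmul_eq_mul]; simp
    linear_combination d * htd + √D / 2 * hddR
  have hsre : |s.re| ≤ 1 / 2 := by
    rw [hs]; simp only [zsmul_eq_mul]; simp
    have := abs_sub_round ((d : ℝ) * t.re)
    rw [← hm] at this
    rw [inv_eq_one_div]; exact this
  have hsn : s * (starRingEnd ℂ) s = ((Complex.normSq s : ℝ) : ℂ) := Complex.mul_conj s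
  obtain ⟨x, y, hxy⟩ := mem_ord.1 (h_int s hsL)
  have hy1 : (y : ℝ) = 1 := by
    have := congrArg Complex.im hxy
    simp [omega] at this
    rw [hsim] at this
    have h2 : (y : ℝ) * (√D / 2) = 1 * (√D / 2) := by rw [this, one_mul]
    exact mul_right_cancel₀ (by positivity) h2
  obtain ⟨b, hb⟩ : ∃ b : ℤ, b = 2 * x + D := ⟨_, rfl⟩
  have hbR : 2 * (a * s.re) = (b : ℝ) := by
    have := congrArg Complex.re hxy
    simp [omega, hy1] at this
    rw [← this, hb]; push_cast; ring
  obtain ⟨c, hc⟩ := real_mem_ord (D := D) (r := a * Complex.normSq s) (by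
    have := (hLL _).1 (Submodule.mul_mem_mul hsL (hconj _ hsL))
    rw [hsn] at this
    exact_mod_cast this)
  have hs0 : s ≠ 0 := by
    rintro rfl
    simp at hsim
    exact hsD.ne' (by simpa using hsim.symm)
  have hdisc : (b : ℝ) ^ 2 + D = 4 * a * c := by
    rw [← hc, ← hbR, ← sqrt_sq_D D, Complex.normSq_apply]
    have : √(D : ℝ) = 2 * (a * s.im) := by rw [hsim]; ring
    rw [this]; ring
  have hF : IsForm D (a : ℤ) b c := by
    refine ⟨by exact_mod_cast hapos, by exact_mod_cast hdisc, ?_⟩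
    have h1 : (a : ℂ)⁻¹ * 1 ∈ L.carrier * cj L.carrier :=
      (hLL _).2 (by rw [mul_inv_cancel_left₀ haC]; exact one_mem_ord D)
    obtain ⟨x', y', u, w, h⟩ := hLLspan s hsspan _ h1
    have h2 : (1 : ℂ) =
      a * (x' + y' * s + u * (starRingEnd ℂ) s + w * (s * (starRingEnd ℂ) s)) := by
      rw [← h, mul_inv_cancel_left₀ haC]
    rw [hsn] at h2
    have h3 := congrArg Complex.im h2
    have h4 := congrArg Complex.re h2
    simp at h3 h4
    have h5 : (y' - u : ℝ) * (a * s.im) = 0 := by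
      rcases h3 with h3 | h3
      · exact absurd h3 (by exact_mod_cast ha0)
      · linear_combination a * h3
    rw [hsim] at h5
    have h6 : (y' - u : ℝ) = 0 := (mul_eq_zero.1 h5).resolve_right (by positivity)
    refine ⟨x', u, w, ?_⟩
    have h7 : (x' : ℝ) * a + u * b + w * c = 1 := by
      rw [← hc, ← hbR]; linear_combination -h4 - a * s.re * h6
    exact_mod_cast h7
  have hstau : s = tau D a b := by
    apply Complex.ext
    · simp [tau]; rw [← hbR]; field_simp
    · simp [tau]; field_simp; linarith
  refine ⟨a, b, c, hF, ?_, ?_, ?_⟩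
  · have h1 : |(b : ℝ)| ≤ a := by
      rw [← hbR, abs_mul, abs_mul, abs_of_pos hapos, abs_two]
      nlinarith
    exact_mod_cast h1
  · have h1 : (a : ℝ) ≤ c := by
      rw [← hc]
      exact le_mul_of_one_le_right hapos.le (hLmin s hsL hs0)
    exact_mod_cast h1
  · congr 1
    apply ext'
    rw [formLat_carrier]
    apply le_antisymm
    · intro z hz
      obtain ⟨x, y, rfl⟩ := mem_tauSpan.1 hz
      rw [← hstau, ← zsmul_eq_mul, ← mul_one (x : ℂ), ← zsmul_eq_mul]
      exact add_mem (Submodule.smul_mem _ _ hone) (Submodule.smul_mem _ _ hsL)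
    · intro z hz
      obtain ⟨x, y, rfl⟩ := hsspan z hz
      exact mem_tauSpan.2 ⟨x, y, by rw [hstau]⟩

open Classical in
/-- The class of a form given by its coefficients (trivial if these do not define a form). -/
noncomputable def formCls (D : ℕ) [NegDisc D] (a b c : ℤ) : Cl D :=
  if h : IsForm D a b c then cls (formLat h) else 1

lemma formCls_eq {a b c : ℤ} (h : IsForm D a b c) : formCls D a b c = cls (formLat h) := dif_pos h

instance : Finite (Cl D) := by
  let f : (Finset.Icc (0 : ℤ) D ×ˢ Finset.Icc (-D : ℤ) D ×ˢ Finset.Icc (0 : ℤ) D : Finset _) →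
    Cl D :=
    fun x => formCls D x.1.1 x.1.2.1 x.1.2.2
  refine Finite.of_surjective f fun C => ?_
  obtain ⟨a, b, c, h, h1, h2, rfl⟩ := exists_reduced C
  have ha := h.pos
  have hd := h.disc
  have hba := abs_le.1 h1
  have hb2 : b ^ 2 ≤ a * c := by nlinarith [sq_abs b]
  have hc : c ≤ D := by nlinarith
  refine ⟨⟨(a, b, c), ?_⟩, formCls_eq h⟩
  simp only [Finset.mem_product, Finset.mem_Icc]
  omega

/-- Ambiguous reduced forms. -/
lemma reduced_of_sq_eq_one {C : Cl D} (hC : C ^ 2 = 1) :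
    ∃ (a b c : ℤ) (h : IsForm D a b c), 0 ≤ b ∧ b ≤ a ∧ a ≤ c ∧ cls (formLat h) = C ∧
      (b = 0 ∨ b = a ∨ a = c) := by
  have hCi : C⁻¹ = C := by rw [inv_eq_iff_mul_eq_one, ← sq, hC]
  obtain ⟨a, b, c, h, hb0, h1, h2, h3⟩ : ∃ (a b c : ℤ) (h : IsForm D a b c), 0 ≤ b ∧ b ≤ a ∧ a ≤ c ∧
      cls (formLat h) = C := by
    obtain ⟨a, b, c, h, h1, h2, h3⟩ := exists_reduced C
    obtain ⟨h4, h5⟩ := abs_le.1 h1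
    rcases le_total 0 b with hb | hb
    · exact ⟨a, b, c, h, hb, h5, h2, h3⟩
    · exact ⟨a, -b, c, h.neg, by omega, by omega, h2, by rw [formLat_neg h, cls_conj, h3, hCi]⟩
  refine ⟨a, b, c, h, hb0, h1, h2, h3, ?_⟩
  by_contra! hcon
  obtain ⟨hb, hba, hac⟩ := hcon
  have heq : cls (formLat h * (formLat h.neg)⁻¹) = 1 := by
    rw [map_mul, map_inv, formLat_neg h, cls_conj, inv_inv, ← sq, h3, hC]
  obtain ⟨γ, hγ⟩ := cls_eq_one_iff.1 heq
  have hγ' : formLat h = princHom D γ * formLat h.neg := by rw [hγ, inv_mul_cancel_right]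
  have hnrm : Complex.normSq γ = 1 := by
    have := congrArg Lat.nrm hγ
    rw [princHom_nrm, mul_nrm, inv_nrm, formLat_nrm, formLat_nrm, inv_inv,
      inv_mul_cancel₀ h.aR.ne'] at this
    exact this
  have hmem : ∀ z ∈ tauSpan D a (-b), γ * z ∈ tauSpan D a b := by
    intro z hz
    have h4 : γ * z ∈ (formLat h).carrier := by
      rw [hγ', mul_carrier, princHom_carrier, mul_assoc, mul_comm (ord D), (formLat h.neg).mul_ord]
      exact mem_sc_mul.2 ⟨z, hz, rfl⟩
    exact h4
  obtain ⟨x, y, hxy⟩ := mem_tauSpan.1 (hmem 1 one_mem_tauSpan)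
  rw [mul_one] at hxy
  have hq := h.normSq_eq x y
  rw [hxy, hnrm, mul_one] at hq
  have hq' : a = a * x ^ 2 + b * x * y + c * y ^ 2 := by exact_mod_cast hq
  have hapos := h.pos
  have hy : y = 0 := by
    by_contra hy
    have hy1 : 1 ≤ y ^ 2 := by
      have : 0 < y ^ 2 := by positivity
      omega
    have hxy2 : 1 ≤ x ^ 2 - |x * y| + y ^ 2 := by
      rw [abs_mul]
      have e1 := sq_abs x
      have e2 := sq_abs y
      have : 0 < x ^ 2 - |x| * |y| + y ^ 2 := by
        rw [← e1, ← e2]; rw [← e2] at hy1; nlinarith [sq_nonneg (2 * |x| - |y|)]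
      omega
    have h5 : -(a * |x * y|) ≤ b * (x * y) := by
      have h6 : |b * (x * y)| ≤ a * |x * y| := by
        rw [abs_mul, abs_of_nonneg hb0]; exact mul_le_mul_of_nonneg_right h1 (abs_nonneg _)
      have := neg_abs_le (b * (x * y))
      linarith
    have h6 : a * 1 ≤ a * (x ^ 2 - |x * y| + y ^ 2) := mul_le_mul_of_nonneg_left hxy2 hapos.le
    have h7 : (c - a) * 1 ≤ (c - a) * y ^ 2 := mul_le_mul_of_nonneg_left hy1 (by omega)
    have h8 : a < c := lt_of_le_of_ne h2 hac
    nlinarith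
  subst hy
  have hx : x ^ 2 = 1 := by
    have : a * x ^ 2 = a * 1 := by linarith
    exact mul_left_cancel₀ hapos.ne' this
  obtain ⟨u, w, huw⟩ := mem_tauSpan.1 (hmem _ tau_mem_tauSpan)
  rw [← hxy] at huw
  have hsD : (0 : ℝ) < √D := Real.sqrt_pos.2 (by exact_mod_cast hD.pos)
  have haR := h.aR
  have e1 := congrArg Complex.im huw
  have e2 := congrArg Complex.re huw
  simp [tau] at e1 e2
  have hD0 := hD.pos
  have e3 : w = x := by
    rcases e1 with e1 | e1 | e1
    · exact e1
    · omega
    · omega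
  rw [e3] at e2
  have e4 : (u : ℝ) * a = -(x * b) := by
    field_simp at e2; linarith
  have e5 : u * a = -(x * b) := by exact_mod_cast e4
  have hdvd : a ∣ b := by
    refine ⟨-(x * u), ?_⟩
    have : x * (u * a) = x * (-(x * b)) := by rw [e5]
    linear_combination this - b * hx
  have := Int.le_of_dvd (by omega) hdvd
  omega

end QuadLat

/-! ### Bounding the number of genera -/

namespace QuadLat

variable {D : ℕ} [hD : NegDisc D]
open QuadLat.Lat

/-- Unordered factorizations of `m` into two coprime factors. -/
def copFac (m : ℕ) : Finset (ℕ × ℕ) :=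
  m.divisorsAntidiagonal.filter fun x => x.1 ≤ x.2 ∧ x.1.Coprime x.2

lemma mem_copFac {m : ℕ} {x : ℕ × ℕ} :
    x ∈ copFac m ↔ (x.1 * x.2 = m ∧ m ≠ 0) ∧ x.1 ≤ x.2 ∧ x.1.Coprime x.2 := by
  simp [copFac]

lemma eq_one_of_coprime {u k d : ℕ} (h : u.Coprime k) (h1 : d ∣ u) (h2 : d ∣ k) : d = 1 :=
  Nat.dvd_one.1 (h ▸ Nat.dvd_gcd h1 h2)

lemma eq_of_primeFactors_eq {m a b c d : ℕ} (hm : m ≠ 0) (hab : a * b = m) (hcd : c * d = m)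
    (h1 : a.Coprime b) (h2 : c.Coprime d) (h : a.primeFactors = c.primeFactors) : a = c := by
  have key : ∀ {a b c d : ℕ}, a * b = m → c * d = m → a.Coprime b →
      a.primeFactors = c.primeFactors → c ∣ a := by
    intro a b c d hab hcd h1 h
    have : c.Coprime b := by
      refine Nat.Coprime.symm (Nat.coprime_of_dvd ?_)
      intro p hp hpb hpc
      have hc : c ≠ 0 := by rintro rfl; simp at hcd; exact hm hcd.symm
      have : p ∈ a.primeFactors := h ▸ Nat.mem_primeFactors.2 ⟨hp, hpc, hc⟩
      exact hp.one_lt.ne' (Nat.Coprime.eq_one_of_dvd (h1.coprime_dvd_left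
        (Nat.dvd_of_mem_primeFactors this)) hpb)
    exact this.dvd_of_dvd_mul_right (hab ▸ hcd ▸ dvd_mul_right c d)
  exact Nat.dvd_antisymm (key hcd hab h2 h.symm) (key hab hcd h1 h)

lemma two_mul_card_copFac {m : ℕ} (hm : 1 < m) : 2 * (copFac m).card ≤ 2 ^ m.primeFactors.card := by
  rw [← Finset.card_powerset, ← Fintype.card_bool, ← Finset.card_univ, ← Finset.card_product]
  let f : Bool × (ℕ × ℕ) → Finset ℕ := fun x => (bif x.1 then x.2.1 else x.2.2).primeFactors
  have hne : ∀ x ∈ copFac m, x.1 ≠ x.2 := by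
    intro x hx h
    obtain ⟨⟨h1, h2⟩, h3, h4⟩ := mem_copFac.1 hx
    rw [← h, Nat.coprime_self] at h4
    rw [← h, h4] at h1
    omega
  refine Finset.card_le_card_of_injOn f ?_ ?_
  · rintro ⟨e, x⟩ hx
    obtain ⟨⟨h1, h2⟩, h3, h4⟩ := mem_copFac.1 (Finset.mem_product.1 hx).2
    simp only [Finset.coe_powerset, Set.mem_preimage, Set.mem_powerset_iff, Finset.coe_subset, f]
    cases e
    · exact Nat.primeFactors_mono ⟨x.1, by rw [← h1]; exact mul_comm _ _⟩ h2
    · exact Nat.primeFactors_mono ⟨x.2, h1.symm⟩ h2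
  · rintro ⟨e, x⟩ hx ⟨e', x'⟩ hx' hf
    have hx := (Finset.mem_product.1 hx).2
    have hx' := (Finset.mem_product.1 hx').2
    have hxne := hne _ hx
    have hxne' := hne _ hx'
    obtain ⟨⟨h1, h2⟩, h3, h4⟩ := mem_copFac.1 hx
    obtain ⟨⟨k1, k2⟩, k3, k4⟩ := mem_copFac.1 hx'
    obtain ⟨a, c⟩ := x
    obtain ⟨a', c'⟩ := x'
    simp only at h1 h3 h4 k1 k3 k4 hxne hxne'
    have h5 : c * a = m := by rw [mul_comm, h1]
    have k5 : c' * a' = m := by rw [mul_comm, k1]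
    have hpos : 0 < a ∧ 0 < c ∧ 0 < a' ∧ 0 < c' := by
      refine ⟨Nat.pos_of_ne_zero ?_, Nat.pos_of_ne_zero ?_, Nat.pos_of_ne_zero ?_,
        Nat.pos_of_ne_zero ?_⟩ <;> rintro rfl <;> simp at h1 k1 <;> omega
    cases e <;> cases e' <;> simp only [f, cond_true, cond_false] at hf
    · have := eq_of_primeFactors_eq h2 h5 k5 h4.symm k4.symm hf
      subst this
      have : a = a' := Nat.eq_of_mul_eq_mul_left hpos.2.1 (h5.trans k5.symm)
      subst this; rfl
    · have := eq_of_primeFactors_eq h2 h5 k1 h4.symm k4 hf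
      subst this
      have : a = c' := Nat.eq_of_mul_eq_mul_left hpos.2.1 (h5.trans k1.symm)
      omega
    · have := eq_of_primeFactors_eq h2 h1 k5 h4 k4.symm hf
      subst this
      have : c = a' := Nat.eq_of_mul_eq_mul_left hpos.1 (h1.trans k5.symm)
      omega
    · have := eq_of_primeFactors_eq h2 h1 k1 h4 k4 hf
      subst this
      have : c = c' := Nat.eq_of_mul_eq_mul_left hpos.1 (h1.trans k1.symm)
      subst this; rfl

/-- The ambiguous class attached to a factorization `u * v` of the discriminant. -/
noncomputable def ambCls (D : ℕ) [NegDisc D] (u v : ℤ) : Cl D :=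
  if 3 * u ≤ v then formCls D u u ((u + v) / 4)
  else formCls D ((u + v) / 4) ((v - u) / 2) ((u + v) / 4)

lemma ambiguous_of_sq_eq_one {C : Cl D} (hC : C ^ 2 = 1) :
    (∃ a c : ℕ, a ≤ c ∧ 4 * (a * c) = D ∧ a.Coprime c ∧ C = formCls D a 0 c) ∨
    (∃ u v : ℕ, u ≤ v ∧ u * v = D ∧ 4 ∣ u + v ∧ u.Coprime ((u + v) / 4) ∧ C = ambCls D u v) := by
  obtain ⟨a, b, c, h, hb0, h1, h2, h3, h4⟩ := reduced_of_sq_eq_one hC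
  have hap := h.pos
  have hdisc := h.disc
  have hprim : ∀ e : ℤ, e ∣ a → e ∣ b → e ∣ c → IsUnit e := by
    intro e he hf hg
    obtain ⟨u, v, w, huvw⟩ := h.prim
    rw [isUnit_iff_dvd_one, ← huvw]
    exact dvd_add (dvd_add (dvd_mul_of_dvd_right he _) (dvd_mul_of_dvd_right hf _))
      (dvd_mul_of_dvd_right hg _)
  have hcop : ∀ {x y : ℕ}, (∀ e : ℤ, e ∣ x → e ∣ y → IsUnit e) → x.Coprime y := by
    intro x y hxy
    refine Nat.coprime_of_dvd ?_
    intro p hp h5 h6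
    have := hxy p (by exact_mod_cast h5) (by exact_mod_cast h6)
    rw [Int.ofNat_isUnit, Nat.isUnit_iff] at this
    exact hp.one_lt.ne' this
  rw [← h3, ← formCls_eq h]
  by_cases hb : b = 0
  · left
    subst hb
    obtain ⟨x, rfl⟩ := Int.eq_ofNat_of_zero_le hap.le
    obtain ⟨y, rfl⟩ := Int.eq_ofNat_of_zero_le (hap.le.trans h2)
    refine ⟨x, y, by omega, ?_, ?_, rfl⟩
    · zify; linarith
    · exact hcop fun e he hf => hprim e he (dvd_zero _) hf
  right
  rcases h4.resolve_left hb with hba | hac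
  · subst hba
    obtain ⟨u, rfl⟩ := Int.eq_ofNat_of_zero_le hb0
    obtain ⟨v, hv⟩ : ∃ v : ℕ, (v : ℤ) = 4 * c - u := ⟨(4 * c - u).toNat, by omega⟩
    have e1 : ((u : ℤ) + v) / 4 = c := by omega
    have e1' : ((u + v) / 4 : ℕ) = c := by omega
    refine ⟨u, v, by omega, ?_, by omega, ?_, ?_⟩
    · zify; rw [hv]; linarith
    · refine hcop fun e he hf => ?_
      rw [e1'] at hf
      exact hprim e he he hf
    · rw [ambCls, if_pos (by omega), e1]
  · subst hac
    obtain ⟨u, hu⟩ : ∃ u : ℕ, (u : ℤ) = 2 * a - b := ⟨(2 * a - b).toNat, by omega⟩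
    obtain ⟨v, hv⟩ : ∃ v : ℕ, (v : ℤ) = 2 * a + b := ⟨(2 * a + b).toNat, by omega⟩
    have e1 : ((u : ℤ) + v) / 4 = a := by omega
    have e1' : ((u + v) / 4 : ℕ) = a := by omega
    have e2 : ((v : ℤ) - u) / 2 = b := by omega
    refine ⟨u, v, by omega, ?_, by omega, ?_, ?_⟩
    · zify; rw [hu, hv]; linarith
    · refine hcop fun e he hf => ?_
      rw [e1'] at hf
      refine hprim e hf ?_ hf
      have : b = 2 * a - u := by omega
      rw [this]
      exact dvd_sub (dvd_mul_of_dvd_right hf _) he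
    · rw [ambCls, e1, e2]
      split_ifs with h5
      · have e3 : (u : ℤ) = a := by omega
        have e4 : b = a := by omega
        rw [e3, e4]
      · rfl

lemma card_Gen_le {s : Finset (Cl D)} (hs : ∀ C : Cl D, C ^ 2 = 1 → C ∈ s) :
    Nat.card (Gen D) ≤ s.card := by
  have h1 := Subgroup.card_mul_index (powMonoidHom 2 : Cl D →* Cl D).range
  have h2 := Subgroup.card_mul_index (powMonoidHom 2 : Cl D →* Cl D).ker
  rw [Subgroup.index_ker, mul_comm] at h2
  have h3 : Nat.card (Gen D) = (powMonoidHom 2 : Cl D →* Cl D).range.index := rfl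
  have h4 : 0 < Nat.card (powMonoidHom 2 : Cl D →* Cl D).range := Nat.card_pos
  rw [h3, Nat.eq_of_mul_eq_mul_left h4 (h1.trans h2.symm)]
  rw [← Nat.card_eq_finsetCard s]
  refine Nat.card_le_card_of_injective (fun C => ⟨C.1, hs C.1 ?_⟩) ?_
  · have := C.2
    rwa [MonoidHom.mem_ker, powMonoidHom_apply] at this
  · intro C E h
    exact Subtype.ext (congrArg (fun x : s => (x : Cl D)) h)

lemma card_erase_two {m i : ℕ} (h : D = 2 ^ i * m) :
    m.primeFactors.erase 2 = D.primeFactors.erase 2 := by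
  have hD0 := hD.pos
  have hm : m ≠ 0 := by rintro rfl; omega
  ext p
  simp only [Finset.mem_erase, Nat.mem_primeFactors]
  refine and_congr_right fun hp => ?_
  constructor
  · rintro ⟨h1, h2, -⟩
    exact ⟨h1, h ▸ dvd_mul_of_dvd_right h2 _, hD0.ne'⟩
  · rintro ⟨h1, h2, -⟩
    refine ⟨h1, ?_, hm⟩
    rw [h] at h2
    refine (h1.dvd_mul.1 h2).resolve_left fun h3 => hp ?_
    exact (Nat.prime_dvd_prime_iff_eq h1 Nat.prime_two).1 (h1.dvd_of_dvd_pow h3)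

lemma card_copFac_odd {m i : ℕ} (h : D = 2 ^ i * m) (hm : 1 < m) (ho : m % 2 = 1) :
    2 * (copFac m).card ≤ 2 ^ (D.primeFactors.erase 2).card := by
  rw [← card_erase_two h, Finset.erase_eq_of_notMem]
  · exact two_mul_card_copFac hm
  · intro h2
    have := Nat.dvd_of_mem_primeFactors h2
    omega

lemma card_copFac_le {m i : ℕ} (h : D = 2 ^ i * m) (hm : 1 < m) :
    (copFac m).card ≤ 2 ^ (D.primeFactors.erase 2).card := by
  have h1 := two_mul_card_copFac hm
  have h2 : m.primeFactors.card ≤ (m.primeFactors.erase 2).card + 1 := by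
    have := Finset.pred_card_le_card_erase (s := m.primeFactors) (a := 2)
    omega
  have h3 := Nat.pow_le_pow_right (n := 2) (by norm_num) h2
  rw [← card_erase_two h]
  rw [pow_succ] at h3
  omega

lemma mem_copFac_of_amb_odd {u v : ℕ} (ho : D % 2 = 1) (huv : u ≤ v) (h1 : u * v = D)
    (h2 : 4 ∣ u + v) (h3 : u.Coprime ((u + v) / 4)) : (u, v) ∈ copFac D := by
  refine mem_copFac.2 ⟨⟨h1, hD.pos.ne'⟩, huv, Nat.coprime_of_dvd ?_⟩
  intro p hp h4 h5
  obtain ⟨k, hk⟩ := h2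
  rw [hk, Nat.mul_div_cancel_left _ (by norm_num)] at h3
  have h6 : p ∣ 4 * k := hk ▸ dvd_add h4 h5
  rcases hp.dvd_mul.1 h6 with h7 | h7
  · have := (Nat.prime_dvd_prime_iff_eq hp Nat.prime_two).1 (hp.dvd_of_dvd_pow (n := 2) h7)
    subst this
    have : 2 ∣ D := h1 ▸ dvd_mul_of_dvd_left h4 v
    omega
  · exact hp.one_lt.ne' (eq_one_of_coprime h3 h4 h7)

lemma amb_even {n u v : ℕ} (hn : D = 4 * n) (huv : u ≤ v) (h1 : u * v = D)
    (h2 : 4 ∣ u + v) (h3 : u.Coprime ((u + v) / 4)) :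
    (n % 4 = 1 ∧ ∃ x ∈ copFac n, u = 2 * x.1 ∧ v = 2 * x.2) ∨
    (n % 8 = 0 ∧ ∃ x ∈ copFac (n / 4), u = 4 * x.1 ∧ v = 4 * x.2) := by
  have hn0 : n ≠ 0 := by have := hD.pos; omega
  have hu : u % 2 = 0 := by
    by_contra hu
    have hu : u % 2 = 1 := by omega
    have hv : v % 2 = 1 := by omega
    have : u * v % 2 = 1 := by rw [Nat.mul_mod, hu, hv]
    omega
  obtain ⟨x, rfl⟩ : ∃ x, u = 2 * x := ⟨u / 2, by omega⟩
  obtain ⟨y, rfl⟩ : ∃ y, v = 2 * y := ⟨v / 2, by omega⟩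
  have hxy : x * y = n := by nlinarith
  obtain ⟨k, hk⟩ := h2
  rw [hk, Nat.mul_div_cancel_left _ (by norm_num)] at h3
  have hk' : x + y = 2 * k := by omega
  have hk2 : k % 2 = 1 := by
    by_contra h
    exact absurd (eq_one_of_coprime (d := 2) h3 (dvd_mul_right _ _) (by omega)) (by norm_num)
  have h4 : x.Coprime k := h3.coprime_dvd_left (dvd_mul_left _ _)
  by_cases hx : x % 2 = 1
  · left
    have h5 : x % 4 = y % 4 := by omega
    have h6 : x * y % 4 = 1 := by
      rw [Nat.mul_mod, ← h5]
      have : x % 4 = 1 ∨ x % 4 = 3 := by omega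
      rcases this with h | h <;> simp [h]
    refine ⟨by omega, (x, y), mem_copFac.2 ⟨⟨hxy, hn0⟩, by simp only; omega, ?_⟩, rfl, rfl⟩
    refine Nat.coprime_of_dvd fun p hp h7 h8 => ?_
    have h9 : p ∣ 2 * k := hk' ▸ dvd_add h7 h8
    rcases hp.dvd_mul.1 h9 with h10 | h10
    · have := (Nat.prime_dvd_prime_iff_eq hp Nat.prime_two).1 h10
      subst this
      simp only at h7
      omega
    · exact hp.one_lt.ne' (eq_one_of_coprime h4 h7 h10)
  · right
    obtain ⟨a, rfl⟩ : ∃ a, x = 2 * a := ⟨x / 2, by omega⟩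
    obtain ⟨b, rfl⟩ : ∃ b, y = 2 * b := ⟨y / 2, by omega⟩
    have hab : n = 4 * (a * b) := by rw [← hxy]; ring
    have h5 : a * b % 2 = 0 := by
      have : a % 2 = 0 ∨ b % 2 = 0 := by omega
      rcases this with h | h <;> simp [Nat.mul_mod, h]
    refine ⟨by omega, (a, b), mem_copFac.2 ⟨⟨by simp only; omega, by omega⟩,
      by simp only; omega, ?_⟩,
      by simp only; ring, by simp only; ring⟩
    refine Nat.coprime_of_dvd fun p hp h7 h8 => ?_
    have h9 : p ∣ k := by
      have : k = a + b := by omega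
      rw [this]; exact dvd_add h7 h8
    exact hp.one_lt.ne' (eq_one_of_coprime h4 (dvd_mul_of_dvd_right h7 2) h9)

open Classical in
lemma card_Gen_odd (ho : D % 2 = 1) (h3 : D ≠ 1) :
    2 * Nat.card (Gen D) ≤ 2 ^ (D.primeFactors.erase 2).card := by
  have hD0 := hD.pos
  have h1 : Nat.card (Gen D) ≤ _ := card_Gen_le (D := D)
    (s := (copFac D).image fun x => ambCls D x.1 x.2) ?_
  · have h2 := card_copFac_odd (D := D) (m := D) (i := 0) (by simp) (by omega) ho
    have := Finset.card_image_le (s := copFac D) (f := fun x => ambCls D x.1 x.2)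
    omega
  · intro C hC
    rcases ambiguous_of_sq_eq_one hC with ⟨a, c, -, h, -⟩ | ⟨u, v, h1, h2, h3, h4, rfl⟩
    · omega
    · exact Finset.mem_image.2 ⟨(u, v), mem_copFac_of_amb_odd ho h1 h2 h3 h4, rfl⟩

open Classical in
lemma card_Gen_even {n : ℕ} (hn : D = 4 * n) :
    Nat.card (Gen D) ≤ (copFac n).card + (if n % 4 = 1 then (copFac n).card else 0) +
      (if n % 8 = 0 then (copFac (n / 4)).card else 0) := by
  have h1 : Nat.card (Gen D) ≤ _ := card_Gen_le (D := D)
    (s := (copFac n).image (fun x => formCls D x.1 0 x.2) ∪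
      (if n % 4 = 1 then (copFac n).image (fun x => ambCls D (2 * x.1) (2 * x.2)) else ∅) ∪
      (if n % 8 = 0 then (copFac (n / 4)).image (fun x => ambCls D (4 * x.1) (4 * x.2)) else ∅)) ?_
  · refine h1.trans ((Finset.card_union_le _ _).trans (add_le_add
      ((Finset.card_union_le _ _).trans (add_le_add Finset.card_image_le ?_)) ?_))
    · split_ifs
      · exact Finset.card_image_le
      · simp
    · split_ifs
      · exact Finset.card_image_le
      · simp
  · intro C hC
    rw [Finset.mem_union, Finset.mem_union]
    rcases ambiguous_of_sq_eq_one hC with ⟨a, c, h1, h2, h3, rfl⟩ | ⟨u, v, h1, h2, h3, h4, rfl⟩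
    · left; left
      refine Finset.mem_image.2 ⟨(a, c), mem_copFac.2 ⟨⟨?_, ?_⟩, h1, h3⟩, rfl⟩
      · simp only; omega
      · have := hD.pos; omega
    · rcases amb_even hn h1 h2 h3 h4 with ⟨h5, x, hx, rfl, rfl⟩ | ⟨h5, x, hx, rfl, rfl⟩
      · left; right
        rw [if_pos h5]
        exact Finset.mem_image.2 ⟨x, hx, by push_cast; rfl⟩
      · right
        rw [if_pos h5]
        exact Finset.mem_image.2 ⟨x, hx, by push_cast; rfl⟩

/-- The primes `p` dividing `D` for which there is an invertible lattice of norm `p`. -/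
def boost (D : ℕ) : Finset ℕ :=
  D.primeFactors.filter fun p => (p ≠ 2 ∧ ¬ p ^ 2 ∣ D) ∨ (p = 2 ∧ D % 16 = 4)

lemma mem_boost {p : ℕ} :
    p ∈ boost D ↔ (p.Prime ∧ p ∣ D) ∧ ((p ≠ 2 ∧ ¬ p ^ 2 ∣ D) ∨ (p = 2 ∧ D % 16 = 4)) := by
  have := hD.pos.ne'
  simp [boost, this]

/-- The local factor at `p`. -/
noncomputable def locFac (D p : ℕ) : ℝ :=
  √(p ^ D.factorization p) * (1 - (p : ℝ)⁻¹) * (if p ∈ boost D then ((1 - (p : ℝ)⁻¹)⁻¹) ^ 2 else 1)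

lemma prod_locFac : ∏ p ∈ D.primeFactors, locFac D p =
    √D * (D.totient / D) * (∏ p ∈ boost D, (1 - (p : ℝ)⁻¹)⁻¹) ^ 2 := by
  have hD0 := hD.pos.ne'
  have hD1 : (D : ℝ) ≠ 0 := by exact_mod_cast hD0
  simp only [locFac]
  rw [Finset.prod_mul_distrib, Finset.prod_mul_distrib]
  congr 1
  · congr 1
    · rw [← Real.sqrt_prod _ (fun i _ => by positivity)]
      congr 1
      have := congrArg (Nat.cast (R := ℝ)) (Nat.prod_factorization_pow_eq_self hD0)
      rw [Finsupp.prod, Nat.support_factorization] at this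
      push_cast at this
      exact this
    · have h := Nat.totient_eq_mul_prod_factors D
      have h' : (D.totient : ℝ) = D * ∏ p ∈ D.primeFactors, (1 - (p : ℝ)⁻¹) := by
        have := congrArg (fun q : ℚ => (q : ℝ)) h
        push_cast at this
        exact this
      rw [h', mul_div_cancel_left₀ _ hD1]
  · rw [← Finset.prod_pow, Finset.prod_ite, Finset.prod_const_one, mul_one]
    refine Finset.prod_congr ?_ fun _ _ => rfl
    ext p
    simp only [Finset.mem_filter, Nat.mem_primeFactors, mem_boost]
    tauto

lemma two_le_locFac {p : ℕ} (hp : p.Prime) (hpD : p ∣ D) (h2 : p ≠ 2) : 2 ≤ locFac D p := by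
  have hp3 : (3 : ℝ) ≤ p := by
    have := hp.two_le
    exact_mod_cast (by omega : 3 ≤ p)
  have hi : (p : ℝ)⁻¹ ≤ 1 / 3 := by rw [inv_eq_one_div]; gcongr
  have hi0 : 0 < (p : ℝ)⁻¹ := by positivity
  have hf := hp.factorization_pos_of_dvd hD.pos.ne' hpD
  rw [locFac]
  by_cases h : p ∈ boost D
  · rw [if_pos h]
    have h1 : √3 ≤ √((p : ℝ) ^ D.factorization p) := by
      refine Real.sqrt_le_sqrt (hp3.trans ?_)
      exact le_self_pow₀ (by linarith) hf.ne'
    have h3 : (1.5 : ℝ) ≤ √3 := Real.le_sqrt_of_sq_le (by norm_num)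
    have h4 : (1 - (p : ℝ)⁻¹) * (1 - (p : ℝ)⁻¹)⁻¹ ^ 2 = (1 - (p : ℝ)⁻¹)⁻¹ := by
      have : (1 - (p : ℝ)⁻¹) ≠ 0 := by linarith
      field_simp
    rw [mul_assoc, h4]
    have h6 : 1 - (p : ℝ)⁻¹ > 0 := by linarith
    rw [← div_eq_mul_inv, le_div_iff₀ h6]
    by_cases hp4 : p = 3
    · subst hp4
      push_cast
      push_cast at h1
      linarith
    · have h7 : (4 : ℝ) ≤ p := by
        have := hp.two_le
        exact_mod_cast (by omega : 4 ≤ p)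
      have h8 : 2 ≤ √((p : ℝ) ^ D.factorization p) := by
        refine Real.le_sqrt_of_sq_le ?_
        refine le_trans ?_ (le_self_pow₀ (by linarith) hf.ne')
        linarith
      linarith
  · rw [if_neg h, mul_one]
    have h5 : 2 ≤ D.factorization p := by
      rw [mem_boost] at h
      have : p ^ 2 ∣ D := by
        by_contra h6; exact h ⟨⟨hp, hpD⟩, Or.inl ⟨h2, h6⟩⟩
      exact (hp.pow_dvd_iff_le_factorization hD.pos.ne').1 this
    have h1 : (3 : ℝ) ≤ √((p : ℝ) ^ D.factorization p) := by
      refine Real.le_sqrt_of_sq_le ?_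
      calc (3 : ℝ) ^ 2 ≤ (p : ℝ) ^ 2 := by gcongr
        _ ≤ _ := pow_le_pow_right₀ (by linarith) h5
    nlinarith

lemma prod_locFac_erase : (2 : ℝ) ^ (D.primeFactors.erase 2).card ≤
    ∏ p ∈ D.primeFactors.erase 2, locFac D p := by
  rw [← Finset.prod_const]
  refine Finset.prod_le_prod (fun _ _ => by norm_num) fun p hp => ?_
  rw [Finset.mem_erase, Nat.mem_primeFactors] at hp
  exact two_le_locFac hp.2.1 hp.2.2.1 hp.1

lemma sqrt_two_mul_card_Gen_le (h4 : D ≠ 4) : √2 * Nat.card (Gen D) ≤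
    √D * (D.totient / D) * (∏ p ∈ boost D, (1 - (p : ℝ)⁻¹)⁻¹) ^ 2 := by
  rw [← prod_locFac]
  have hD0 := hD.pos
  have hm4 := hD.mod_four
  have hs2 : √2 ≤ 1.5 := Real.sqrt_le_iff.2 (by norm_num)
  have hs2' : √2 * √2 = 2 := Real.mul_self_sqrt (by norm_num)
  have hE := prod_locFac_erase (D := D)
  set w := (D.primeFactors.erase 2).card with hw
  by_cases ho : D % 2 = 1
  · have h1 := card_Gen_odd ho (by omega)
    have h2 : (2 : ℝ) * Nat.card (Gen D) ≤ 2 ^ w := by exact_mod_cast h1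
    rw [Finset.erase_eq_of_notMem] at hE
    · nlinarith [Nat.cast_nonneg (α := ℝ) (Nat.card (Gen D))]
    · intro h
      have := Nat.dvd_of_mem_primeFactors h
      omega
  obtain ⟨n, hn⟩ : ∃ n, D = 4 * n := ⟨D / 4, by omega⟩
  have hmem : 2 ∈ D.primeFactors := Nat.mem_primeFactors.2 ⟨Nat.prime_two, by omega, by omega⟩
  rw [← Finset.mul_prod_erase _ _ hmem]
  have hG := card_Gen_even hn
  have hfac : ∀ k : ℕ, 2 ^ k ∣ D →
    √((2 : ℝ) ^ k) / 2 * (if D % 16 = 4 then 4 else 1) ≤ locFac D 2 := by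
    intro k hk
    rw [locFac]
    have h1 : k ≤ D.factorization 2 :=
      (Nat.prime_two.pow_dvd_iff_le_factorization hD.pos.ne').1 hk
    have h2 : √((2 : ℝ) ^ k) ≤ √((2 : ℝ) ^ D.factorization 2) :=
      Real.sqrt_le_sqrt (pow_le_pow_right₀ (by norm_num) h1)
    have h3 : (2 ∈ boost D) = (D % 16 = 4) := by
      rw [mem_boost]
      have : 2 ∣ D := by omega
      simp [Nat.prime_two, this]
    simp only [h3]
    split_ifs
    · push_cast; linarith
    · push_cast; linarith
  have hn1 : 1 < n := by omega
  have hfin : ∀ (g : ℕ) (x : ℝ), Nat.card (Gen D) ≤ g * 2 ^ w → √2 * g ≤ x → x ≤ locFac D 2 →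
      √2 * Nat.card (Gen D) ≤ locFac D 2 * ∏ p ∈ D.primeFactors.erase 2, locFac D p := by
    intro g x h1 h2 h3
    have h5 : (Nat.card (Gen D) : ℝ) ≤ g * 2 ^ w := by exact_mod_cast h1
    calc √2 * (Nat.card (Gen D) : ℝ) ≤ √2 * (g * 2 ^ w) := by gcongr
      _ = (√2 * g) * 2 ^ w := by ring
      _ ≤ _ := by
        have : 0 ≤ √2 * g := by positivity
        have h6 := h2.trans h3
        exact mul_le_mul h6 hE (by positivity) (this.trans h6)
  have hcop := card_copFac_le (D := D) (m := n) (i := 2) (by omega) hn1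
  rw [← hw] at hcop
  have hpw : 0 < 2 ^ w := by positivity
  have hs4 : √((2 : ℝ) ^ 2) = 2 := Real.sqrt_sq (by norm_num)
  have hs8 : √((2 : ℝ) ^ 3) = 2 * √2 := by
    rw [show (2 : ℝ) ^ 3 = 2 ^ 2 * 2 by norm_num, Real.sqrt_mul (by norm_num), hs4]
  have hs32 : √((2 : ℝ) ^ 5) = 4 * √2 := by
    rw [show (2 : ℝ) ^ 5 = 4 ^ 2 * 2 by norm_num, Real.sqrt_mul (by norm_num),
      Real.sqrt_sq (by norm_num)]
  by_cases c1 : n % 4 = 1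
  · rw [if_pos c1, if_neg (by omega)] at hG
    have hodd := card_copFac_odd (D := D) (m := n) (i := 2) (by omega) hn1 (by omega)
    rw [← hw] at hodd
    refine hfin 1 4 (by omega) ?_ ?_
    · push_cast; linarith
    · have := hfac 2 (by omega)
      rw [if_pos (by omega), hs4] at this
      linarith
  rw [if_neg c1] at hG
  by_cases c2 : n % 8 = 0
  · rw [if_pos c2] at hG
    have hq := card_copFac_le (D := D) (m := n / 4) (i := 4) (by omega) (by omega)
    rw [← hw] at hq
    refine hfin 2 (2 * √2) (by omega) ?_ ?_
    · push_cast; linarith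
    · have := hfac 5 (by omega)
      rw [if_neg (by omega), hs32] at this
      linarith
  rw [if_neg c2] at hG
  by_cases c3 : n % 2 = 0
  · refine hfin 1 √2 (by omega) (by push_cast; linarith) ?_
    have := hfac 3 (by omega)
    rw [if_neg (by omega), hs8] at this
    linarith
  · have hodd := card_copFac_odd (D := D) (m := n) (i := 2) (by omega) hn1 (by omega)
    rw [← hw] at hodd
    have h5 : (2 : ℝ) * Nat.card (Gen D) ≤ 2 ^ w := by
      exact_mod_cast (by omega : 2 * Nat.card (Gen D) ≤ 2 ^ w)
    have := hfac 2 (by omega)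
    rw [if_neg (by omega), hs4] at this
    have h6 : 0 ≤ ∏ p ∈ D.primeFactors.erase 2, locFac D p := le_trans (by positivity) hE
    nlinarith [Nat.cast_nonneg (α := ℝ) (Nat.card (Gen D))]

lemma subsingleton_Cl_four (h4 : D = 4) : Subsingleton (Cl D) := by
  have key : ∀ C : Cl D, C = formCls D 1 0 1 := by
    intro C
    obtain ⟨a, b, c, h, h1, h2, rfl⟩ := exists_reduced C
    have hd := h.disc
    have hp := h.pos
    rw [h4] at hd
    push_cast at hd
    have hb := abs_le.1 h1
    have hbb : b ^ 2 ≤ a * c := by nlinarith [sq_abs b]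
    have hac : a * c ≤ 1 := by linarith
    have ha : a = 1 := by nlinarith
    subst ha
    have hc : c = 1 := by linarith
    subst hc
    have hb0 : b = 0 := by
      have : b ^ 2 = 0 := by linarith
      exact pow_eq_zero_iff (two_ne_zero) |>.1 this
    subst hb0
    exact (formCls_eq h).symm
  exact ⟨fun C E => (key C).trans (key E).symm⟩

lemma exists_mem_Rep_of_mem_boost {p : ℕ} (hp : p ∈ boost D) : ∃ C, C ∈ Rep D p := by
  suffices h : ∃ b c : ℤ, IsForm D p b c by
    obtain ⟨b, c, h⟩ := h
    exact ⟨_, cls_formLat_mem_Rep h⟩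
  have hprim : ∀ {p : ℕ} {b c : ℤ}, p.Prime → ¬ (p : ℤ) ∣ c →
    ∃ u v w : ℤ, u * p + v * b + w * c = 1 := by
    intro p b c hp hc
    obtain ⟨u, w, h⟩ := (Prime.coprime_iff_not_dvd (Nat.prime_iff_prime_int.1 hp)).2 hc
    exact ⟨u, 0, w, by linarith⟩
  obtain ⟨⟨hpr, m, rfl⟩, h⟩ := mem_boost.1 hp
  have hm4 := hD.mod_four
  rcases h with ⟨h2, h3⟩ | ⟨rfl, h3⟩
  · have hpm : ¬ p ∣ m := fun ⟨k, hk⟩ => h3 ⟨k, by rw [hk]; ring⟩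
    have hpo : p % 2 = 1 := hpr.eq_two_or_odd.resolve_left h2
    have hp4 : ¬ p ∣ 4 := fun h => h2 ((Nat.prime_dvd_prime_iff_eq hpr Nat.prime_two).1
      (hpr.dvd_of_dvd_pow (n := 2) h))
    rcases hm4 with h4 | h4
    · have : 4 ∣ m := by
        have h5 : 4 ∣ p * m := by omega
        refine Nat.Coprime.dvd_of_dvd_mul_left ?_ h5
        exact ((hpr.coprime_iff_not_dvd).2 hp4).symm
      obtain ⟨k, rfl⟩ := this
      refine ⟨0, k, by exact_mod_cast hpr.pos, by push_cast; ring, hprim hpr ?_⟩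
      intro h
      exact hpm (dvd_mul_of_dvd_right (by exact_mod_cast h) _)
    · have h5 : (p + m) % 4 = 0 := by
        rw [Nat.mul_mod] at h4
        have h6 : p % 4 = 1 ∨ p % 4 = 3 := by omega
        have h7 : m % 4 < 4 := Nat.mod_lt _ (by norm_num)
        rcases h6 with h6 | h6 <;> rw [h6] at h4 <;> interval_cases h8 : m % 4 <;> omega
      obtain ⟨k, hk⟩ : ∃ k, p + m = 4 * k := ⟨(p + m) / 4, by omega⟩
      refine ⟨p, k, by exact_mod_cast hpr.pos, ?_, hprim hpr ?_⟩
      · have : (p : ℤ) + m = 4 * k := by exact_mod_cast hk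
        push_cast; linear_combination (p : ℤ) * this
      · intro h
        have h6 : p ∣ k := by exact_mod_cast h
        exact hpm ((Nat.dvd_add_right (dvd_refl p)).1 (hk ▸ dvd_mul_of_dvd_right h6 _))
  · obtain ⟨k, hk⟩ : ∃ k, m = 8 * k + 2 := ⟨m / 8, by omega⟩
    refine ⟨2, 2 * k + 1, by norm_num, by rw [hk]; push_cast; ring, hprim hpr ?_⟩
    push_cast; omega

end QuadLat

/-! ### Counting lattice points -/

namespace QuadLat

lemma summable_and_tsum_of_fiber {S : Type*} (g : S → ℕ) (hfin : ∀ n, Finite {a // g a = n})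
    (F : ℕ → ℝ) (hF : ∀ n, 0 ≤ F n)
    (hs : Summable fun n => (Nat.card {a // g a = n} : ℝ) * F n) :
    Summable (fun a => F (g a)) ∧ ∑' a, F (g a) = ∑' n, (Nat.card {a // g a = n} : ℝ) * F n := by
  have hfun : ∀ n, HasSum (fun a : {a // g a = n} => F (g a))
    ((Nat.card {a // g a = n} : ℝ) * F n) := by
    intro n
    have := hfin n
    have := Fintype.ofFinite {a // g a = n}
    have : (fun a : {a // g a = n} => F (g a)) = fun _ => F n := by
      funext a; rw [a.2]
    rw [this, Nat.card_eq_fintype_card]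
    convert hasSum_fintype (fun _ : {a // g a = n} => F n) using 1
    simp
  have hsum : Summable (fun x : Σ n, {a // g a = n} => F (g x.2)) := by
    rw [summable_sigma_of_nonneg (fun _ => hF _)]
    refine ⟨fun n => (hfun n).summable, ?_⟩
    simpa only [(hfun _).tsum_eq] using hs
  have h1 := (Equiv.sigmaFiberEquiv g).summable_iff (f := fun a => F (g a))
  refine ⟨h1.1 hsum, ?_⟩
  rw [← (Equiv.sigmaFiberEquiv g).tsum_eq (fun a => F (g a))]
  refine (hsum.tsum_sigma' fun n => (hfun n).summable).trans ?_
  exact tsum_congr fun n => (hfun n).tsum_eq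

lemma tendsto_dirichlet {S : Type*} (g : S → ℕ) (hpos : ∀ a, g a ≠ 0)
    (hfin : ∀ n, Finite {a // g a = n}) {l : ℝ}
    (hc : Tendsto (fun N : ℕ => (Nat.card {a // g a ≤ N} : ℝ) / N) atTop (nhds l)) :
    (∀ s : ℝ, 1 < s → Summable fun a => (g a : ℝ) ^ (-s)) ∧
      Tendsto (fun s : ℝ => (s - 1) * ∑' a, (g a : ℝ) ^ (-s))
        (nhdsWithin 1 (Set.Ioi 1)) (nhds l) := by
  set f : ℕ → ℝ := fun n => Nat.card {a // g a = n} with hf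
  have hf0 : ∀ n, 0 ≤ f n := fun n => Nat.cast_nonneg _
  have hcard : ∀ N : ℕ, (∑ k ∈ Finset.Icc 1 N, f k) = Nat.card {a // g a ≤ N} := by
    intro N
    have e : {a // g a ≤ N} ≃ Σ k : Finset.Icc 1 N, {a // g a = k} :=
      { toFun := fun a => ⟨⟨g a, Finset.mem_Icc.2 ⟨Nat.pos_of_ne_zero (hpos a), a.2⟩⟩, ⟨a, rfl⟩⟩
        invFun := fun x => ⟨x.2, by rw [x.2.2]; exact (Finset.mem_Icc.1 x.1.2).2⟩
        left_inv := fun a => rfl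
        right_inv := by
          rintro ⟨⟨k, hk⟩, ⟨a, ha⟩⟩
          dsimp only at ha
          subst ha
          rfl }
    rw [Nat.card_congr e]
    have := hfin
    rw [Nat.card_sigma]
    push_cast
    rw [← Finset.sum_coe_sort (Finset.Icc 1 N)]
  have hlim : Tendsto (fun N : ℕ => (∑ k ∈ Finset.Icc 1 N, f k) / (N : ℝ)) atTop (nhds l) := by
    simpa only [hcard] using hc
  have hterm : ∀ (s : ℝ) (n : ℕ), LSeries.term (fun n => (f n : ℂ)) s n =
    ((f n * (n : ℝ) ^ (-s) : ℝ) : ℂ) := by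
    intro s n
    rcases eq_or_ne n 0 with rfl | hn
    · have : f 0 = 0 := by
        have : IsEmpty {a // g a = 0} := ⟨fun a => hpos a a.2⟩
        simp only [f, Nat.card_of_isEmpty, Nat.cast_zero]
      simp [this]
    · rw [LSeries.term_of_ne_zero hn, Real.rpow_neg (Nat.cast_nonneg _), div_eq_mul_inv]
      push_cast
      rw [Complex.ofReal_cpow (Nat.cast_nonneg _)]
      simp
  have hsum : ∀ s : ℝ, 1 < s → Summable fun n => f n * (n : ℝ) ^ (-s) := by
    intro s hs
    have h1 : LSeriesSummable (fun n => (f n : ℂ)) s := by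
      refine LSeriesSummable_of_sum_norm_bigO_and_nonneg (r := 1) ?_ hf0
        zero_le_one (by simpa using hs)
      exact Asymptotics.isBigO_atTop_natCast_rpow_of_tendsto_div_rpow (by simpa using hlim)
    have h2 : Summable (LSeries.term (fun n => (f n : ℂ)) s) := h1
    rw [funext (hterm s)] at h2
    exact Complex.summable_ofReal.1 h2
  have hfib := fun (s : ℝ) (hs : 1 < s) =>
    summable_and_tsum_of_fiber g hfin (fun n => (n : ℝ) ^ (-s))
    (fun n => by positivity) (hsum s hs)
  refine ⟨fun s hs => (hfib s hs).1, ?_⟩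
  have h3 := LSeries_tendsto_sub_mul_nhds_one_of_tendsto_sum_div_and_nonneg f hlim hf0
  have h4 := (Complex.continuous_re.tendsto _).comp h3
  rw [Complex.ofReal_re] at h4
  refine h4.congr' ?_
  filter_upwards [self_mem_nhdsWithin] with s hs
  rw [(hfib s hs).2, Function.comp_apply, LSeries, funext (hterm s), ← Complex.ofReal_tsum]
  norm_cast

section Count
variable {D : ℕ} [hD : NegDisc D]

/-- The embedding of `ℤ²` as the lattice spanned by `1` and `τ`. -/
noncomputable def tauHom (D : ℕ) (a b : ℤ) : ℤ × ℤ →+ ℂ where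
  toFun x := x.1 + x.2 * tau D a b
  map_zero' := by simp
  map_add' x y := by push_cast [Prod.fst_add, Prod.snd_add]; ring

lemma tauHom_apply (a b : ℤ) (x : ℤ × ℤ) : tauHom D a b x = x.1 + x.2 * tau D a b := rfl

lemma tau_im (a b : ℤ) : (tau D a b).im = √D / (2 * a) := rfl

lemma IsForm.tau_im_pos {a b c : ℤ} (h : IsForm D a b c) : 0 < (tau D a b).im := by
  have h1 : (0 : ℝ) < √D := Real.sqrt_pos.2 (by exact_mod_cast hD.pos)
  have h2 : (0 : ℝ) < a := by exact_mod_cast h.pos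
  rw [tau_im]; positivity

lemma tauHom_injective {a b c : ℤ} (h : IsForm D a b c) : Function.Injective (tauHom D a b) := by
  rw [injective_iff_map_eq_zero]
  rintro ⟨x, y⟩ hxy
  have h1 := congrArg Complex.im hxy
  have h2 := congrArg Complex.re hxy
  have h3 := h.tau_im_pos.ne'
  simp [tauHom_apply, h3] at h1
  subst h1
  simp [tauHom_apply] at h2
  simp [h2]

/-- The linear form `x ↦ α x₁ + β x₂` modulo `d`. -/
def linMod (d : ℕ) (α β : ℤ) : ℤ × ℤ →+ ZMod d where
  toFun x := ((α * x.1 + β * x.2 : ℤ) : ZMod d)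
  map_zero' := by simp
  map_add' x y := by push_cast [Prod.fst_add, Prod.snd_add]; ring

lemma mem_ker_linMod {d : ℕ} {α β : ℤ} {x : ℤ × ℤ} :
    x ∈ (linMod d α β).ker ↔ (d : ℤ) ∣ α * x.1 + β * x.2 := by
  rw [AddMonoidHom.mem_ker]
  exact ZMod.intCast_zmod_eq_zero_iff_dvd _ _

lemma linMod_surjective {d : ℕ} {α β : ℤ} (h : ∃ x : ℤ × ℤ, IsCoprime (α * x.1 + β * x.2) d) :
    Function.Surjective (linMod d α β) := by
  obtain ⟨x, u, v, h⟩ := h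
  intro z
  obtain ⟨z, rfl⟩ := ZMod.intCast_surjective z
  refine ⟨(z * u) • x, ?_⟩
  change ((α * ((z * u) • x).1 + β * ((z * u) • x).2 : ℤ) : ZMod d) = z
  have : α * ((z * u) • x).1 + β * ((z * u) • x).2 = z - d * (v * z) := by
    simp only [Prod.smul_fst, Prod.smul_snd, smul_eq_mul]
    linear_combination z * h
  rw [this]
  simp

lemma exists_tauBasis {a b c : ℤ} (h : IsForm D a b c) :
    ∃ B : Module.Basis (Fin 2) ℝ ℂ, ⇑B = ![1, tau D a b] := by
  have hdet : Complex.basisOneI.det ![1, tau D a b] = (tau D a b).im := by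
    rw [Module.Basis.det_apply, Matrix.det_fin_two]
    simp [Module.Basis.toMatrix_apply, Complex.coe_basisOneI_repr]
  have h1 := (Module.Basis.is_basis_iff_det Complex.basisOneI (v := ![1, tau D a b])).2
    (by rw [hdet]; exact h.tau_im_pos.ne'.isUnit)
  exact ⟨Module.Basis.mk h1.1 h1.2.ge, Module.Basis.coe_mk _ _⟩

open ZLattice ZSpan MeasureTheory in
lemma measureReal_fundamentalDomain_basisOneI :
    volume.real (fundamentalDomain Complex.basisOneI) = 1 := by
  rw [measureReal_congr (fundamentalDomain_ae_parallelepiped Complex.basisOneI volume),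
    ← Complex.toBasis_orthonormalBasisOneI, measureReal_def]
  have := Complex.orthonormalBasisOneI.volume_parallelepiped
  rw [OrthonormalBasis.coe_toBasis, this, ENNReal.toReal_one]

open ZLattice ZSpan MeasureTheory in
lemma covolume_tauBasis {a b c : ℤ} (h : IsForm D a b c) (B : Module.Basis (Fin 2) ℝ ℂ)
    (hB : ⇑B = ![1, tau D a b]) :
    covolume (Submodule.span ℤ (Set.range B)) = (tau D a b).im := by
  rw [covolume_eq_measure_fundamentalDomain _ _ (ZSpan.isAddFundamentalDomain' B volume),
    measureReal_fundamentalDomain _ volume Complex.basisOneI,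
      measureReal_fundamentalDomain_basisOneI, hB]
  have hdet : Complex.basisOneI.det ![1, tau D a b] = (tau D a b).im := by
    rw [Module.Basis.det_apply, Matrix.det_fin_two]
    simp [Module.Basis.toMatrix_apply, Complex.coe_basisOneI_repr]
  rw [hdet, mul_one, abs_of_pos h.tau_im_pos]

/-- The sublattice of `ℤ + ℤ τ` on which the linear form vanishes modulo `d`. -/
noncomputable def subLat (D : ℕ) (a b : ℤ) (d : ℕ) (α β : ℤ) : Submodule ℤ ℂ :=
  AddSubgroup.toIntSubmodule ((linMod d α β).ker.map (tauHom D a b))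

lemma mem_subLat {a b : ℤ} {d : ℕ} {α β : ℤ} {z : ℂ} :
    z ∈ subLat D a b d α β ↔ ∃ x : ℤ × ℤ, (d : ℤ) ∣ α * x.1 + β * x.2 ∧ tauHom D a b x = z := by
  change z ∈ (linMod d α β).ker.map (tauHom D a b) ↔ _
  simp only [AddSubgroup.mem_map, mem_ker_linMod]

lemma span_tauBasis {a b : ℤ} (B : Module.Basis (Fin 2) ℝ ℂ)
    (hB : ⇑B = ![1, tau D a b]) :
    (Submodule.span ℤ (Set.range B)).toAddSubgroup =
      (⊤ : AddSubgroup (ℤ × ℤ)).map (tauHom D a b) := by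
  ext z
  rw [hB, Matrix.range_cons, Matrix.range_cons, Matrix.range_empty, Set.union_empty]
  change z ∈ Submodule.span ℤ ({1} ∪ {tau D a b}) ↔ _
  rw [Set.singleton_union]
  change z ∈ tauSpan D a b ↔ _
  rw [mem_tauSpan]
  simp [tauHom_apply]

open ZLattice ZSpan MeasureTheory in
lemma tendsto_card_subLat {a b c : ℤ} (h : IsForm D a b c) {d : ℕ} (hd : d ≠ 0) {α β : ℤ}
    (hαβ : ∃ x : ℤ × ℤ, IsCoprime (α * x.1 + β * x.2) d) :
    Tendsto (fun N : ℕ => (Nat.card {x : ℤ × ℤ // (d : ℤ) ∣ α * x.1 + β * x.2 ∧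
      a * x.1 ^ 2 + b * x.1 * x.2 + c * x.2 ^ 2 ≤ N} : ℝ) / N) atTop (nhds (2 * π / √D / d)) := by
  obtain ⟨B, hB⟩ := exists_tauBasis h
  have hcov := covolume_tauBasis h B hB
  set L₁ := Submodule.span ℤ (Set.range B) with hL₁
  set L := subLat D a b d α β with hL
  have hle : L ≤ L₁ := by
    intro z hz
    change z ∈ L₁.toAddSubgroup
    rw [hL₁, span_tauBasis B hB]
    exact AddSubgroup.map_mono le_top hz
  have hdisc : DiscreteTopology L :=
    DiscreteTopology.of_subset (s := (L₁ : Set ℂ)) (inferInstanceAs (DiscreteTopology L₁)) hle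
  have hspan : Submodule.span ℝ (L : Set ℂ) = ⊤ := by
    have h1 : ∀ i, B i ∈ Submodule.span ℝ (L : Set ℂ) := by
      intro i
      have h2 : (d : ℝ) • B i ∈ Submodule.span ℝ (L : Set ℂ) := by
        refine Submodule.subset_span ?_
        rw [SetLike.mem_coe, hL, mem_subLat, hB]
        fin_cases i
        · exact ⟨(d, 0), by simp, by simp [tauHom_apply]⟩
        · exact ⟨(0, d), by simp, by simp [tauHom_apply]⟩
      have h3 := Submodule.smul_mem _ ((d : ℝ)⁻¹) h2
      rwa [smul_smul, inv_mul_cancel₀ (by exact_mod_cast hd), one_smul] at h3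
    rw [eq_top_iff, ← B.span_eq, Submodule.span_le]
    rintro _ ⟨i, rfl⟩
    exact h1 i
  have : IsZLattice ℝ L := ⟨hspan⟩
  have hrel := covolume_div_covolume_eq_relIndex' L L₁ hle
  have hrel2 : L.toAddSubgroup.relIndex L₁.toAddSubgroup = d := by
    rw [hL₁, span_tauBasis B hB]
    change ((linMod d α β).ker.map (tauHom D a b)).relIndex _ = d
    rw [AddSubgroup.relIndex_map_map_of_injective _ _ (tauHom_injective h),
      AddSubgroup.relIndex_top_right, AddSubgroup.index_ker,
      AddMonoidHom.range_eq_top.2 (linMod_surjective hαβ)]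
    simp
  rw [hrel2, hcov, div_eq_iff h.tau_im_pos.ne', tau_im] at hrel
  have hset : ∀ r : ℝ, {x : ℂ | x ∈ (Set.univ : Set ℂ) ∧ Complex.normSq x ≤ r ^ 2} =
      Metric.closedBall (0 : ℂ) |r| := by
    intro r
    ext z
    simp only [Set.mem_univ, true_and, Set.mem_ofPred_eq, mem_closedBall_zero_iff]
    rw [Complex.normSq_eq_norm_sq, sq_le_sq, abs_of_nonneg (norm_nonneg z)]
  have hset1 := hset 1
  rw [one_pow, abs_one] at hset1
  have key := covolume.tendsto_card_le_div' (L := L) (X := Set.univ) (F := Complex.normSq)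
    (fun _ _ _ _ => Set.mem_univ _) (fun x r _ => by
      rw [Complex.finrank_real_complex, Complex.real_smul, map_mul, Complex.normSq_ofReal, sq])
    (by rw [hset1]; exact Metric.isBounded_closedBall)
    (by rw [hset1]; exact measurableSet_closedBall)
    (by rw [hset1, frontier_closedBall _ one_ne_zero]; exact Measure.addHaar_sphere _ _ _)
  rw [hset1, hrel, measureReal_def, Complex.volume_closedBall] at key
  have haR := h.aR
  have hsD : (0 : ℝ) < √D := Real.sqrt_pos.2 (by exact_mod_cast hD.pos)
  have key2 :=
    (key.comp ((tendsto_natCast_atTop_atTop (R := ℝ)).atTop_div_const haR)).div_const (a : ℝ)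
  have hlim : ((NNReal.pi : NNReal) : ℝ) = π := rfl
  have e1 : (2 * π / √D / d) =
    (ENNReal.ofReal 1 ^ 2 * NNReal.pi).toReal / (d * (√D / (2 * a))) / a := by
    have hd' : (d : ℝ) ≠ 0 := by exact_mod_cast hd
    rw [ENNReal.ofReal_one, one_pow, one_mul, ENNReal.coe_toReal, hlim]
    field_simp
  rw [e1]
  refine key2.congr fun N => ?_
  simp only [Function.comp_apply]
  have hcard : Nat.card ({x : ℂ | x ∈ (Set.univ : Set ℂ) ∧ Complex.normSq x ≤ (N : ℝ) / a} ∩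
    L : Set ℂ) =
      Nat.card {x : ℤ × ℤ // (d : ℤ) ∣ α * x.1 + β * x.2 ∧
        a * x.1 ^ 2 + b * x.1 * x.2 + c * x.2 ^ 2 ≤ N} := by
    have hiff : ∀ x : ℤ × ℤ, Complex.normSq (tauHom D a b x) ≤ (N : ℝ) / a ↔
        a * x.1 ^ 2 + b * x.1 * x.2 + c * x.2 ^ 2 ≤ N := by
      intro x
      rw [le_div_iff₀ haR, mul_comm, tauHom_apply, h.normSq_eq]
      exact_mod_cast Iff.rfl
    symm
    refine Nat.card_congr (Equiv.ofBijective (fun x => ⟨tauHom D a b x.1,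
      ⟨Set.mem_univ _, (hiff _).2 x.2.2⟩, mem_subLat.2 ⟨x.1, x.2.1, rfl⟩⟩) ⟨?_, ?_⟩)
    · intro x y hxy
      exact Subtype.ext (tauHom_injective h (congrArg Subtype.val hxy))
    · rintro ⟨z, ⟨-, hz1⟩, hz2⟩
      obtain ⟨x, hx1, rfl⟩ := mem_subLat.1 hz2
      exact ⟨⟨x, hx1, (hiff x).1 hz1⟩, rfl⟩
  rw [hcard]
  field_simp

end Count

end QuadLat

/-! ### Lattice points with norm prime to the discriminant -/

namespace QuadLat

variable {D : ℕ} [hD : NegDisc D]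

lemma isCoprime_iff_forall_prime {z : ℤ} {m : ℕ} :
    IsCoprime z m ↔ ∀ p : ℕ, p.Prime → p ∣ m → ¬ (p : ℤ) ∣ z := by
  rw [Int.isCoprime_iff_gcd_eq_one]
  constructor
  · intro h p hp h1 h2
    exact hp.one_lt.ne' (Nat.dvd_one.1 (h ▸ Int.dvd_gcd h2 (by exact_mod_cast h1)))
  · intro h
    refine Nat.coprime_of_dvd fun p hp h1 h2 => ?_
    exact h p hp (by simpa using h2) (Int.natCast_dvd.2 h1)

lemma IsForm.exists_coprime {a b c : ℤ} (h : IsForm D a b c) (m : ℕ) (hm : m ≠ 0) :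
    ∃ x y : ℤ, IsCoprime (a * x ^ 2 + b * x * y + c * y ^ 2) m := by
  induction m using Nat.recOnPosPrimePosCoprime with
  | zero => exact absurd rfl hm
  | one => exact ⟨0, 0, by simpa using isCoprime_one_right⟩
  | prime_pow p n hp hn =>
    suffices h1 : ∃ x y : ℤ, ¬ (p : ℤ) ∣ a * x ^ 2 + b * x * y + c * y ^ 2 by
      obtain ⟨x, y, h1⟩ := h1
      refine ⟨x, y, isCoprime_iff_forall_prime.2 fun q hq hqp hqx => h1 ?_⟩
      rwa [(Nat.prime_dvd_prime_iff_eq hq hp).1 (hq.dvd_of_dvd_pow hqp)] at hqx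
    by_contra! hcon
    have e1 := hcon 1 0
    have e2 := hcon 0 1
    have e3 := hcon 1 1
    simp only [one_pow, mul_one, ne_eq, OfNat.ofNat_ne_zero, not_false_eq_true, zero_pow, mul_zero,
      add_zero, zero_add] at e1 e2 e3
    obtain ⟨u, v, w, huvw⟩ := h.prim
    have e4 : (p : ℤ) ∣ b := by
      have := dvd_sub (dvd_sub e3 e1) e2
      rwa [show a + b + c - a - c = b by ring] at this
    have : (p : ℤ) ∣ 1 := by
      rw [← huvw]
      exact dvd_add (dvd_add (dvd_mul_of_dvd_right e1 _) (dvd_mul_of_dvd_right e4 _))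
        (dvd_mul_of_dvd_right e2 _)
    exact hp.one_lt.ne' (Nat.dvd_one.1 (by exact_mod_cast this))
  | coprime m n hm1 hn1 hmn ihm ihn =>
    obtain ⟨x, y, h1⟩ := ihm (by omega)
    obtain ⟨x', y', h2⟩ := ihn (by omega)
    obtain ⟨u, v, huv⟩ := Nat.isCoprime_iff_coprime.2 hmn
    refine ⟨x * (v * n) + x' * (u * m), y * (v * n) + y' * (u * m), ?_⟩
    push_cast
    refine IsCoprime.mul_right ?_ ?_
    · have e : v * (n : ℤ) = 1 - u * m := by linarith
      rw [e]
      have : a * (x * (1 - u * m) + x' * (u * m)) ^ 2 +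
          b * (x * (1 - u * m) + x' * (u * m)) * (y * (1 - u * m) + y' * (u * m)) +
          c * (y * (1 - u * m) + y' * (u * m)) ^ 2 =
          (a * x ^ 2 + b * x * y + c * y ^ 2) +
            m * (a * (2 * x * (u * (x' - x)) + m * (u * (x' - x)) ^ 2)
           + b * (x * (u * (y' - y)) + y * (u * (x' - x)) + m * (u * (x' - x)) * (u * (y' - y)))
           + c * (2 * y * (u * (y' - y)) + m * (u * (y' - y)) ^ 2)) := by ring
      rw [this]
      exact h1.add_mul_left_left _
    · have e : u * (m : ℤ) = 1 - v * n := by linarith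
      rw [e]
      have : a * (x * (v * n) + x' * (1 - v * n)) ^ 2 +
          b * (x * (v * n) + x' * (1 - v * n)) * (y * (v * n) + y' * (1 - v * n)) +
          c * (y * (v * n) + y' * (1 - v * n)) ^ 2 =
          (a * x' ^ 2 + b * x' * y' + c * y' ^ 2) +
            n * (a * (2 * x' * (v * (x - x')) + n * (v * (x - x')) ^ 2)
           + b * (x' * (v * (y - y')) + y' * (v * (x - x')) + n * (v * (x - x')) * (v * (y - y')))
           + c * (2 * y' * (v * (y - y')) + n * (v * (y - y')) ^ 2)) := by ring
      rw [this]
      exact h2.add_mul_left_left _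

lemma IsForm.exists_linear {a b c : ℤ} (h : IsForm D a b c) : ∃ α β : ℤ,
    ∀ x y : ℤ, IsCoprime (a * x ^ 2 + b * x * y + c * y ^ 2) D ↔ IsCoprime (α * x + β * y) D := by
  obtain ⟨x₀, y₀, h0⟩ := h.exists_coprime D hD.pos.ne'
  have hd := h.disc
  suffices h1 : ∃ α β : ℤ, ∀ x y : ℤ, ∀ p : ℕ, p.Prime → p ∣ D →
      ((p : ℤ) ∣ (a * x ^ 2 + b * x * y + c * y ^ 2) * (a * x₀ ^ 2 + b * x₀ * y₀ + c * y₀ ^ 2) ↔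
        (p : ℤ) ∣ (α * x + β * y) ^ 2) by
    obtain ⟨α, β, h1⟩ := h1
    refine ⟨α, β, fun x y => ?_⟩
    rw [isCoprime_iff_forall_prime, isCoprime_iff_forall_prime]
    refine forall_congr' fun p => forall_congr' fun hp => forall_congr' fun hpD => not_congr ?_
    have hpp := Nat.prime_iff_prime_int.1 hp
    have h2 := h1 x y p hp hpD
    rw [hpp.dvd_mul, hpp.dvd_pow_iff_dvd two_ne_zero] at h2
    rw [← h2]
    have := isCoprime_iff_forall_prime.1 h0 p hp hpD
    tauto
  have hm := hD.mod_four
  rcases hm with hm | hm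
  · obtain ⟨n, hn⟩ : ∃ n, D = 4 * n := ⟨D / 4, by omega⟩
    have hb : Even b := by
      have : Even (b ^ 2) := ⟨2 * a * c - 2 * n, by rw [hn] at hd; push_cast at hd; linarith⟩
      exact (Int.even_pow.1 this).1
    obtain ⟨b', hb'⟩ := hb
    have hd' : b' ^ 2 + n = a * c := by
      rw [hn, hb'] at hd; push_cast at hd; linarith
    refine ⟨a * x₀ + b' * y₀ + n * y₀, b' * x₀ + c * y₀ - n * x₀, fun x y p hp hpD => ?_⟩
    have hk : (p : ℤ) ∣ 2 * n ∧ (p : ℤ) ∣ n * (n - 1) := by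
      rw [hn] at hpD
      rcases (Nat.Prime.dvd_mul hp).1 hpD with h1 | h1
      · have := (Nat.prime_dvd_prime_iff_eq hp Nat.prime_two).1 (hp.dvd_of_dvd_pow (n := 2) h1)
        subst this
        refine ⟨dvd_mul_right _ _, ?_⟩
        have := Int.even_mul_pred_self n
        exact even_iff_two_dvd.1 this
      · have h2 : (p : ℤ) ∣ n := by exact_mod_cast h1
        exact ⟨dvd_mul_of_dvd_right h2 _, dvd_mul_of_dvd_left h2 _⟩
    have hX : ((a * x₀ + b' * y₀ + n * y₀) * x + (b' * x₀ + c * y₀ - n * x₀) * y) ^ 2 =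
        (a * x ^ 2 + b * x * y + c * y ^ 2) * (a * x₀ ^ 2 + b * x₀ * y₀ + c * y₀ ^ 2) +
        (2 * n * ((a * x * x₀ + b' * (x * y₀ + y * x₀) + c * y * y₀) * (x * y₀ - y * x₀)) +
         n * (n - 1) * (x * y₀ - y * x₀) ^ 2) := by
      rw [hb']; linear_combination ((x * y₀ - y * x₀) ^ 2) * hd'
    rw [hX, Int.dvd_add_left]
    exact dvd_add (dvd_mul_of_dvd_left hk.1 _) (dvd_mul_of_dvd_left hk.2 _)
  · refine ⟨2 * a * x₀ + b * y₀, b * x₀ + 2 * c * y₀, fun x y p hp hpD => ?_⟩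
    have hp4 : ¬ (p : ℤ) ∣ 4 := by
      intro h4
      have h5 : p ∣ 2 ^ 2 := by exact_mod_cast h4
      have := (Nat.prime_dvd_prime_iff_eq hp Nat.prime_two).1 (hp.dvd_of_dvd_pow h5)
      subst this
      omega
    have hX : ((2 * a * x₀ + b * y₀) * x + (b * x₀ + 2 * c * y₀) * y) ^ 2 =
        4 * ((a * x ^ 2 + b * x * y + c * y ^ 2) * (a * x₀ ^ 2 + b * x₀ * y₀ + c * y₀ ^ 2)) +
        D * (-(x * y₀ - y * x₀) ^ 2) := by
      linear_combination ((x * y₀ - y * x₀) ^ 2) * hd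
    rw [hX, Int.dvd_add_left (dvd_mul_of_dvd_left (by exact_mod_cast hpD) _)]
    rw [(Nat.prime_iff_prime_int.1 hp).dvd_mul (b := (_ * _))]
    tauto

lemma IsForm.finite_le {a b c : ℤ} (h : IsForm D a b c) (N : ℕ) :
    {x : ℤ × ℤ | a * x.1 ^ 2 + b * x.1 * x.2 + c * x.2 ^ 2 ≤ N}.Finite := by
  have ha := h.pos
  have hd := h.disc
  have hD1 : (1 : ℤ) ≤ D := by exact_mod_cast hD.pos
  have hc : 0 < c := by
    by_contra hc
    nlinarith [sq_nonneg b]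
  have key : ∀ z M : ℤ, z ^ 2 ≤ M → -M ≤ z ∧ z ≤ M := by
    intro z M hz
    constructor <;> nlinarith
  refine (Set.finite_Icc ((-(4 * c * N), -(4 * a * N)) : ℤ × ℤ) (4 * c * N, 4 * a * N)).subset ?_
  rintro ⟨x, y⟩ hxy
  simp only [Set.mem_ofPred_eq] at hxy
  have h1 : y ^ 2 ≤ 4 * a * N := by
    have : 4 * a * (a * x ^ 2 + b * x * y + c * y ^ 2) = (2 * a * x + b * y) ^ 2 + D * y ^ 2 := by
      linear_combination (-y ^ 2) * hd
    nlinarith [sq_nonneg (2 * a * x + b * y), sq_nonneg y]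
  have h2 : x ^ 2 ≤ 4 * c * N := by
    have : 4 * c * (a * x ^ 2 + b * x * y + c * y ^ 2) = (2 * c * y + b * x) ^ 2 + D * x ^ 2 := by
      linear_combination (-x ^ 2) * hd
    nlinarith [sq_nonneg (2 * c * y + b * x), sq_nonneg x]
  obtain ⟨h3, h4⟩ := key _ _ h1
  obtain ⟨h5, h6⟩ := key _ _ h2
  exact ⟨⟨h5, h3⟩, ⟨h6, h4⟩⟩

lemma sum_moebius_dvd {m : ℕ} (hm : m ≠ 0) (z : ℤ) :
    (∑ d ∈ m.divisors, if (d : ℤ) ∣ z then (ArithmeticFunction.moebius d : ℤ) else 0) =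
      if IsCoprime z m then 1 else 0 := by
  have h1 : (∑ d ∈ (z.gcd m).divisors, (ArithmeticFunction.moebius d : ℤ)) =
      if z.gcd m = 1 then 1 else 0 := by
    rw [← ArithmeticFunction.coe_mul_zeta_apply, ArithmeticFunction.moebius_mul_coe_zeta,
      ArithmeticFunction.one_apply]
  rw [if_congr Int.isCoprime_iff_gcd_eq_one rfl rfl, ← h1, ← Finset.sum_filter]
  refine Finset.sum_congr ?_ fun _ _ => rfl
  ext d
  have hg : z.gcd m ≠ 0 := fun h => hm (by simpa using (Int.gcd_eq_zero_iff.1 h).2)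
  simp only [Finset.mem_filter, Nat.mem_divisors, hm, hg, ne_eq, not_false_eq_true, and_true]
  rw [Int.dvd_gcd_iff, Int.natCast_dvd_natCast, and_comm]

lemma sum_moebius_div {m : ℕ} (hm : m ≠ 0) :
    (∑ d ∈ m.divisors, (ArithmeticFunction.moebius d : ℝ) / d) = m.totient / m := by
  have h1 := (ArithmeticFunction.sum_eq_iff_sum_mul_moebius_eq (R := ℝ)
    (f := fun n => (n.totient : ℝ)) (g := fun n => (n : ℝ))).1
    (fun n _ => by exact_mod_cast Nat.sum_totient n) m (Nat.pos_of_ne_zero hm)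
  rw [← h1, Finset.sum_div, Nat.sum_divisorsAntidiagonal
    (fun d e => (ArithmeticFunction.moebius d : ℝ) * (e : ℝ) / m)]
  refine Finset.sum_congr rfl fun d hd => ?_
  have hdm := Nat.dvd_of_mem_divisors hd
  have hd0 : (d : ℝ) ≠ 0 := by exact_mod_cast (Nat.pos_of_mem_divisors hd).ne'
  have hm0 : (m : ℝ) ≠ 0 := by exact_mod_cast hm
  rw [Nat.cast_div hdm hd0]
  field_simp

open Classical in
lemma IsForm.tendsto_card {a b c : ℤ} (h : IsForm D a b c) :
    Tendsto (fun N : ℕ => (Nat.card {x : ℤ × ℤ //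
      IsCoprime (a * x.1 ^ 2 + b * x.1 * x.2 + c * x.2 ^ 2) D ∧
      a * x.1 ^ 2 + b * x.1 * x.2 + c * x.2 ^ 2 ≤ N} : ℝ) / N) atTop
      (nhds (2 * π / √D * (D.totient / D))) := by
  obtain ⟨α, β, hl⟩ := h.exists_linear
  obtain ⟨x₀, y₀, h0⟩ := h.exists_coprime D hD.pos.ne'
  have h1 : ∀ d ∈ D.divisors, Tendsto (fun N : ℕ => (ArithmeticFunction.moebius d : ℝ) *
      ((Nat.card {x : ℤ × ℤ // (d : ℤ) ∣ α * x.1 + β * x.2 ∧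
      a * x.1 ^ 2 + b * x.1 * x.2 + c * x.2 ^ 2 ≤ N} : ℝ) / N)) atTop
      (nhds ((ArithmeticFunction.moebius d : ℝ) * (2 * π / √D / d))) := by
    intro d hd
    have hdD := Nat.dvd_of_mem_divisors hd
    refine (tendsto_card_subLat h (Nat.pos_of_mem_divisors hd).ne' ⟨(x₀, y₀), ?_⟩).const_mul _
    exact ((hl x₀ y₀).1 h0).of_isCoprime_of_dvd_right (by exact_mod_cast hdD)
  have h2 := tendsto_finsetSum _ h1
  have e1 : ∑ d ∈ D.divisors, (ArithmeticFunction.moebius d : ℝ) * (2 * π / √D / d) =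
      2 * π / √D * (D.totient / D) := by
    rw [← sum_moebius_div hD.pos.ne', Finset.mul_sum]
    exact Finset.sum_congr rfl fun d _ => by ring
  rw [e1] at h2
  refine h2.congr fun N => ?_
  set S := (h.finite_le N).toFinset with hS
  have hcard : ∀ P : ℤ × ℤ → Prop, Nat.card {x : ℤ × ℤ // P x ∧
      a * x.1 ^ 2 + b * x.1 * x.2 + c * x.2 ^ 2 ≤ N} = ∑ x ∈ S, if P x then 1 else 0 := by
    intro P
    rw [Finset.sum_boole, Nat.cast_id, ← Nat.card_eq_finsetCard]
    refine Nat.card_congr (Equiv.subtypeEquivRight fun x => ?_)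
    simp [hS, and_comm]
  rw [hcard]
  simp_rw [hcard, mul_div_assoc']
  rw [← Finset.sum_div]
  congr 1
  push_cast
  simp_rw [Finset.mul_sum]
  rw [Finset.sum_comm]
  refine Finset.sum_congr rfl fun x _ => ?_
  have := sum_moebius_dvd hD.pos.ne' (α * x.1 + β * x.2)
  have h3 := congrArg (Int.cast (R := ℝ)) this
  push_cast at h3
  simp only [hl]
  convert h3 using 1
  · exact Finset.sum_congr rfl fun d _ => by split_ifs <;> simp

end QuadLat

/-! ### Counting integral lattices in a class -/

namespace QuadLat

variable {D : ℕ} [hD : NegDisc D]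
open QuadLat.Lat

lemma card_preimage_eq {G H : Type*} [Group G] [Group H] (f : G →* H) (S : Set H)
    (hS : S ⊆ f.range) : Nat.card (f ⁻¹' S) = Nat.card S * Nat.card f.ker := by
  rw [← Nat.card_prod]
  choose g hg using fun s : S => hS s.2
  refine (Nat.card_congr (Equiv.ofBijective
    (fun x : S × f.ker => (⟨x.2 * g x.1, by simp [hg, MonoidHom.mem_ker.1 x.2.2]⟩ : f ⁻¹' S))
    ⟨?_, ?_⟩)).symm
  · rintro ⟨s, k⟩ ⟨s', k'⟩ h
    have h1 : (k : G) * g s = k' * g s' := congrArg Subtype.val h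
    have h2 : s = s' := by
      have := congrArg f h1
      simp only [map_mul, MonoidHom.mem_ker.1 k.2, MonoidHom.mem_ker.1 k'.2, hg, one_mul] at this
      exact Subtype.ext this
    subst h2
    rw [Subtype.ext (mul_right_cancel h1)]
  · rintro ⟨v, hv⟩
    refine ⟨(⟨f v, hv⟩, ⟨v * (g ⟨f v, hv⟩)⁻¹, ?_⟩), ?_⟩
    · simp [MonoidHom.mem_ker, hg]
    · simp

lemma NegDisc.three_le (D : ℕ) [hD : NegDisc D] : 3 ≤ D := by
  have := hD.pos
  have := hD.mod_four
  omega

lemma princ_mul_inv_isInt {α : ℂˣ} {L : Lat D} :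
    (princHom D α * L⁻¹).IsInt ↔ (α : ℂ) ∈ L.carrier := by
  rw [← Lat.le_iff, princHom_carrier]
  constructor
  · intro h
    exact h (mem_sc_mul.2 ⟨1, one_mem_ord D, mul_one _⟩)
  · intro h z hz
    obtain ⟨w, hw, rfl⟩ := mem_sc_mul.1 hz
    rw [← L.mul_ord]
    exact Submodule.mul_mem_mul h hw

/-- The number of units of the order. -/
noncomputable def unitCard (D : ℕ) [NegDisc D] : ℕ := Nat.card (princHom D).ker

lemma mem_ker_princHom {α : ℂˣ} (h : α ∈ (princHom D).ker) :
    (α : ℂ) ∈ ord D ∧ Complex.normSq α = 1 := by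
  rw [MonoidHom.mem_ker] at h
  constructor
  · have h1 := congrArg Lat.carrier h
    rw [princHom_carrier, one_carrier] at h1
    rw [← h1]
    exact mem_sc_mul.2 ⟨1, one_mem_ord D, mul_one _⟩
  · have h1 := congrArg Lat.nrm h
    rwa [princHom_nrm, one_nrm] at h1

lemma mem_of_mem_ker (h3 : 3 < D) {α : ℂˣ} (h : α ∈ (princHom D).ker) :
    (α : ℂ) ∈ ({1, -1, Complex.I, -Complex.I} : Finset ℂ) ∧
      (4 < D → (α : ℂ) ∈ ({1, -1} : Finset ℂ)) := by
  obtain ⟨h1, h2⟩ := mem_ker_princHom h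
  obtain ⟨x, y, hxy⟩ := mem_ord.1 h1
  have him : (α : ℂ).im = y * (√D / 2) := by rw [← hxy]; simp [omega]
  have hsq : √(D : ℝ) ^ 2 = D := Real.sq_sqrt (Nat.cast_nonneg D)
  have hn : 4 * (α : ℂ).re ^ 2 + (y : ℝ) ^ 2 * D = 4 := by
    rw [Complex.normSq_apply, him] at h2
    linear_combination 4 * h2 - (y : ℝ) ^ 2 * hsq
  have hD4 : (4 : ℝ) ≤ D := by exact_mod_cast h3
  simp only [Finset.mem_insert, Finset.mem_singleton, Complex.ext_iff, Complex.neg_re,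
    Complex.neg_im, Complex.one_re, Complex.one_im, Complex.I_re, Complex.I_im, neg_zero, him]
  rcases eq_or_ne y 0 with rfl | hy
  · have hr : (α : ℂ).re ^ 2 = 1 := by push_cast at hn; linarith
    rcases (sq_eq_sq_iff_eq_or_eq_neg.1 (hr.trans (one_pow 2).symm)) with h | h <;> simp [h]
  · have hy1 : (1 : ℤ) ≤ y ^ 2 := Int.add_one_le_iff.2 (sq_pos_of_ne_zero hy)
    have hy2 : (1 : ℝ) ≤ (y : ℝ) ^ 2 := by exact_mod_cast hy1
    have hr : (α : ℂ).re = 0 := by nlinarith [sq_nonneg (α : ℂ).re]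
    have hDy : (y : ℝ) ^ 2 * D = 4 := by rw [hr] at hn; linarith
    have hD : (D : ℝ) = 4 := by nlinarith
    have hy3 : (y : ℝ) ^ 2 = 1 := by rw [hD] at hDy; linarith
    have hs : √(D : ℝ) = 2 := by
      rw [hD, show (4 : ℝ) = 2 ^ 2 by norm_num]; exact Real.sqrt_sq (by norm_num)
    refine ⟨?_, fun h => ?_⟩
    · rcases (sq_eq_sq_iff_eq_or_eq_neg.1 (hy3.trans (one_pow 2).symm)) with h | h <;>
      simp [h, hs, hr]
    · have : (4 : ℝ) < D := by exact_mod_cast h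
      linarith

lemma unitCard_bounds (h3 : 3 < D) :
    0 < unitCard D ∧ unitCard D ≤ 4 ∧ (4 < D → unitCard D ≤ 2) := by
  have hinj : ∀ S : Finset ℂ, (∀ α ∈ (princHom D).ker, (α : ℂ) ∈ S) →
      Finite (princHom D).ker ∧ unitCard D ≤ S.card := by
    intro S hS
    have hi : Function.Injective (fun α : (princHom D).ker => (⟨α.1, hS α.1 α.2⟩ : S)) := by
      intro α β h
      exact Subtype.ext (Units.ext (congrArg Subtype.val h))
    refine ⟨Finite.of_injective _ hi, ?_⟩
    rw [← Nat.card_eq_finsetCard]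
    exact Nat.card_le_card_of_injective _ hi
  obtain ⟨h1, h2⟩ := hinj _ fun α hα => (mem_of_mem_ker h3 hα).1
  refine ⟨Nat.card_pos, h2.trans Finset.card_le_four, fun h4 => ?_⟩
  exact (hinj _ fun α hα => (mem_of_mem_ker h3 hα).2 h4).2.trans Finset.card_le_two

/-- Integral lattices of class `C` with norm prime to `D`. -/
def clsInt (C : Cl D) : Set (Lat D) := {a | a.IsInt ∧ cls a = C ∧ a.nn.Coprime D}

/-- The products with `Λ` of the integral lattices of norm at most `N` prime to `D`, whose class is
inverse to that of `Λ`. -/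
def shiftInt (Λ : Lat D) (N : ℕ) : Set (Lat D) :=
  {M | (M * Λ⁻¹).IsInt ∧ cls (M * Λ⁻¹) = (cls Λ)⁻¹ ∧ (M * Λ⁻¹).nn.Coprime D ∧ (M * Λ⁻¹).nn ≤ N}

/-- Multiplication by `Λ` as a bijection. -/
noncomputable def shiftIntEquiv (Λ : Lat D) (N : ℕ) :
    {L : clsInt (cls Λ)⁻¹ // L.1.nn ≤ N} ≃ shiftInt Λ N where
  toFun L := ⟨L.1.1 * Λ, by
    have h1 := L.1.2
    have h2 := L.2
    unfold shiftInt
    rw [Set.mem_ofPred_eq, mul_inv_cancel_right]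
    exact ⟨h1.1, h1.2.1, h1.2.2, h2⟩⟩
  invFun M := ⟨⟨M.1 * Λ⁻¹, M.2.1, M.2.2.1, M.2.2.2.1⟩, M.2.2.2.2⟩
  left_inv L := Subtype.ext (Subtype.ext (mul_inv_cancel_right _ _))
  right_inv M := Subtype.ext (inv_mul_cancel_right _ _)

lemma shiftInt_subset (Λ : Lat D) (N : ℕ) : shiftInt Λ N ⊆ (princHom D).range := by
  intro M hM
  have h1 : cls (M * Λ⁻¹) = (cls Λ)⁻¹ := hM.2.1
  rw [map_mul, map_inv, mul_eq_right] at h1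
  obtain ⟨α, hα⟩ := cls_eq_one_iff.1 h1
  exact ⟨α, hα⟩

lemma IsForm.princ_isInt {a b c : ℤ} (h : IsForm D a b c) (x : ℤ × ℤ) (α : ℂˣ)
    (hα : (α : ℂ) = tauHom D a b x) : (princHom D α * (formLat h)⁻¹).IsInt ∧
      ((princHom D α * (formLat h)⁻¹).nn : ℤ) = a * x.1 ^ 2 + b * x.1 * x.2 + c * x.2 ^ 2 := by
  have hI : (princHom D α * (formLat h)⁻¹).IsInt := by
    rw [princ_mul_inv_isInt, formLat_carrier, mem_tauSpan]
    exact ⟨x.1, x.2, hα.symm⟩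
  refine ⟨hI, ?_⟩
  have h1 := hI.nrm_eq
  rw [mul_nrm, inv_nrm, princHom_nrm, formLat_nrm, inv_inv, hα, tauHom_apply, mul_comm,
    h.normSq_eq] at h1
  exact_mod_cast h1.symm

lemma IsForm.mem_shiftInt {a b c : ℤ} (h : IsForm D a b c) (N : ℕ) (x : ℤ × ℤ) (α : ℂˣ)
    (hα : (α : ℂ) = tauHom D a b x) : princHom D α ∈ shiftInt (formLat h) N ↔
      IsCoprime (a * x.1 ^ 2 + b * x.1 * x.2 + c * x.2 ^ 2) (D : ℤ) ∧
      a * x.1 ^ 2 + b * x.1 * x.2 + c * x.2 ^ 2 ≤ N := by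
  obtain ⟨hI, hn⟩ := h.princ_isInt x α hα
  rw [← hn, Nat.isCoprime_iff_coprime, Nat.cast_le]
  unfold shiftInt
  rw [Set.mem_ofPred_eq]
  have hc : cls (princHom D α * (formLat h)⁻¹) = (cls (formLat h))⁻¹ := by
    rw [map_mul, cls_princ, one_mul, map_inv]
  exact ⟨fun h => h.2.2, fun h => ⟨hI, hc, h⟩⟩

/-- Representations by a form correspond to generators. -/
lemma IsForm.nonempty_equiv {a b c : ℤ} (h : IsForm D a b c) (N : ℕ) :
    Nonempty ({x : ℤ × ℤ // IsCoprime (a * x.1 ^ 2 + b * x.1 * x.2 + c * x.2 ^ 2) (D : ℤ) ∧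
      a * x.1 ^ 2 + b * x.1 * x.2 + c * x.2 ^ 2 ≤ N} ≃
      princHom D ⁻¹' (shiftInt (formLat h) N)) := by
  have hne : ∀ x : ℤ × ℤ, IsCoprime (a * x.1 ^ 2 + b * x.1 * x.2 + c * x.2 ^ 2) (D : ℤ) →
      tauHom D a b x ≠ 0 := by
    intro x hx h0
    have : x = 0 := tauHom_injective h (by rw [h0, map_zero])
    subst this
    have h1 := Int.isCoprime_iff_gcd_eq_one.1 hx
    have := NegDisc.three_le D
    simp at h1
    omega
  let f : {x : ℤ × ℤ // IsCoprime (a * x.1 ^ 2 + b * x.1 * x.2 + c * x.2 ^ 2) (D : ℤ) ∧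
      a * x.1 ^ 2 + b * x.1 * x.2 + c * x.2 ^ 2 ≤ N} → princHom D ⁻¹' (shiftInt (formLat h) N) :=
    fun x => ⟨Units.mk0 _ (hne x.1 x.2.1), (h.mem_shiftInt N x.1 _ rfl).2 x.2⟩
  have hf : ∀ x, ((f x).1 : ℂ) = tauHom D a b x.1 := fun x => rfl
  refine ⟨Equiv.ofBijective f ⟨fun x y hxy => ?_, fun α => ?_⟩⟩
  · exact Subtype.ext (tauHom_injective h (by rw [← hf, ← hf, hxy]))
  · have h1 : (α.1 : ℂ) ∈ (formLat h).carrier := princ_mul_inv_isInt.1 α.2.1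
    rw [formLat_carrier, mem_tauSpan] at h1
    obtain ⟨x, y, hxy⟩ := h1
    refine ⟨⟨(x, y), (h.mem_shiftInt N (x, y) α hxy.symm).1 α.2⟩, ?_⟩
    exact Subtype.ext (Units.ext hxy)

lemma card_clsInt_mul {a b c : ℤ} (h : IsForm D a b c) (N : ℕ) :
    Nat.card {x : ℤ × ℤ // IsCoprime (a * x.1 ^ 2 + b * x.1 * x.2 + c * x.2 ^ 2) (D : ℤ) ∧
      a * x.1 ^ 2 + b * x.1 * x.2 + c * x.2 ^ 2 ≤ N} =
    Nat.card {L : clsInt (cls (formLat h))⁻¹ // L.1.nn ≤ N} * unitCard D := by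
  rw [Nat.card_congr (shiftIntEquiv _ N), unitCard, ← card_preimage_eq _ _ (shiftInt_subset _ N)]
  exact Nat.card_congr (h.nonempty_equiv N).some

/-- The residue attached to each class. -/
noncomputable def rho (D : ℕ) [NegDisc D] : ℝ := 2 * π / √D * (D.totient / D) / unitCard D

lemma tendsto_card_clsInt (h3 : 3 < D) (C : Cl D) :
    Tendsto (fun N : ℕ => (Nat.card {L : clsInt C // L.1.nn ≤ N} : ℝ) / N) atTop
      (nhds (rho D)) := by
  obtain ⟨a, b, c, h, -, -, hC⟩ := exists_reduced C⁻¹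
  have h1 := h.tendsto_card.div_const (unitCard D : ℝ)
  have hw : (unitCard D : ℝ) ≠ 0 := by exact_mod_cast (unitCard_bounds h3).1.ne'
  refine h1.congr fun N => ?_
  rw [card_clsInt_mul h N, hC, inv_inv]
  push_cast
  field_simp

lemma finite_clsInt_le (C : Cl D) (N : ℕ) : Finite {L : clsInt C // L.1.nn ≤ N} := by
  obtain ⟨a, b, c, h, -, -, hC⟩ := exists_reduced C⁻¹
  obtain rfl : C = (cls (formLat h))⁻¹ := by rw [hC, inv_inv]
  have h1 : (princHom D ⁻¹' (shiftInt (formLat h) N)).Finite := by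
    have : Finite {x : ℤ × ℤ // IsCoprime (a * x.1 ^ 2 + b * x.1 * x.2 + c * x.2 ^ 2) (D : ℤ) ∧
      a * x.1 ^ 2 + b * x.1 * x.2 + c * x.2 ^ 2 ≤ N} := (h.finite_le N).subset fun x hx => hx.2
    exact Set.finite_coe_iff.1 (Finite.of_equiv _ (h.nonempty_equiv N).some)
  have h2 : Finite (shiftInt (formLat h) N) := by
    refine ((h1.image (princHom D)).subset fun M hM => ?_).to_subtype
    obtain ⟨α, rfl⟩ := shiftInt_subset _ N hM
    exact ⟨α, hM, rfl⟩
  exact Finite.of_equiv _ (shiftIntEquiv _ N).symm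

lemma tendsto_clsInt (h3 : 3 < D) (C : Cl D) :
    (∀ s : ℝ, 1 < s → Summable fun L : clsInt C => (L.1.nn : ℝ) ^ (-s)) ∧
    Tendsto (fun s : ℝ => (s - 1) * ∑' L : clsInt C, (L.1.nn : ℝ) ^ (-s))
      (nhdsWithin 1 (Set.Ioi 1)) (nhds (rho D)) := by
  refine tendsto_dirichlet (fun L : clsInt C => L.1.nn) (fun L => L.2.1.nn_pos.ne') ?_
    (tendsto_card_clsInt h3 C)
  intro n
  have := finite_clsInt_le C n
  exact Finite.of_injective (fun x : {L : clsInt C // L.1.nn = n} =>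
    (⟨x.1, x.2.le⟩ : {L : clsInt C // L.1.nn ≤ n})) fun x y hxy =>
      Subtype.ext (congrArg (fun z : {L : clsInt C // L.1.nn ≤ n} => z.1) hxy)

end QuadLat

/-! ### Dirichlet series of sets of natural numbers -/

namespace QuadLat

/-- The Dirichlet series with coefficients `f` at the real point `s`. -/
noncomputable def dser (f : ℕ → ℝ) (s : ℝ) : ℝ := ∑' n : ℕ, f n * (n : ℝ) ^ (-s)

lemma dser_summable {f : ℕ → ℝ} {K : ℝ} (hf : ∀ n, |f n| ≤ K) {s : ℝ} (hs : 1 < s) :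
    Summable fun n : ℕ => f n * (n : ℝ) ^ (-s) := by
  have h1 : Summable fun n : ℕ => (n : ℝ) ^ (-s) := Real.summable_nat_rpow.2 (by linarith)
  refine Summable.of_norm_bounded (h1.mul_left K) fun n => ?_
  rw [norm_mul, Real.norm_eq_abs, Real.norm_of_nonneg (Real.rpow_nonneg (Nat.cast_nonneg _) _)]
  exact mul_le_mul_of_nonneg_right (hf n) (Real.rpow_nonneg (Nat.cast_nonneg _) _)

lemma dser_add {f g : ℕ → ℝ} {K L : ℝ} (hf : ∀ n, |f n| ≤ K) (hg : ∀ n, |g n| ≤ L) {s : ℝ}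
    (hs : 1 < s) : dser (fun n => f n + g n) s = dser f s + dser g s := by
  unfold dser
  rw [← (dser_summable hf hs).tsum_add (dser_summable hg hs)]
  exact tsum_congr fun n => by ring

lemma dser_sub {f g : ℕ → ℝ} {K L : ℝ} (hf : ∀ n, |f n| ≤ K) (hg : ∀ n, |g n| ≤ L) {s : ℝ}
    (hs : 1 < s) : dser (fun n => f n - g n) s = dser f s - dser g s := by
  unfold dser
  rw [← (dser_summable hf hs).tsum_sub (dser_summable hg hs)]
  exact tsum_congr fun n => by ring

lemma dser_const_mul (c : ℝ) (f : ℕ → ℝ) (s : ℝ) : dser (fun n => c * f n) s = c * dser f s := by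
  unfold dser
  rw [← tsum_mul_left]
  exact tsum_congr fun n => by ring

lemma dser_sum {ι : Type*} (t : Finset ι) {f : ι → ℕ → ℝ} {K : ℝ} (hf : ∀ i ∈ t, ∀ n, |f i n| ≤ K)
    {s : ℝ} (hs : 1 < s) : dser (fun n => ∑ i ∈ t, f i n) s = ∑ i ∈ t, dser (f i) s := by
  unfold dser
  rw [← Summable.tsum_finsetSum fun i hi => dser_summable (hf i hi) hs]
  exact tsum_congr fun n => Finset.sum_mul _ _ _

lemma dser_mono {f g : ℕ → ℝ} {K L : ℝ} (hf : ∀ n, |f n| ≤ K) (hg : ∀ n, |g n| ≤ L)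
    (hfg : ∀ n, n ≠ 0 → f n ≤ g n) {s : ℝ} (hs : 1 < s) : dser f s ≤ dser g s := by
  refine (dser_summable hf hs).tsum_le_tsum (fun n => ?_) (dser_summable hg hs)
  rcases eq_or_ne n 0 with rfl | hn
  · rw [Nat.cast_zero, Real.zero_rpow (by linarith), mul_zero, mul_zero]
  · exact mul_le_mul_of_nonneg_right (hfg n hn) (Real.rpow_nonneg (Nat.cast_nonneg _) _)

lemma dser_nonneg {f : ℕ → ℝ} (hf : ∀ n, 0 ≤ f n) (s : ℝ) : 0 ≤ dser f s :=
  tsum_nonneg fun n => mul_nonneg (hf n) (Real.rpow_nonneg (Nat.cast_nonneg _) _)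

lemma abs_dser_le {f g : ℕ → ℝ} {K : ℝ} (hg : ∀ n, |g n| ≤ K)
    (hfg : ∀ n, |f n| ≤ g n) {s : ℝ} (hs : 1 < s) : |dser f s| ≤ dser g s := by
  have hf : ∀ n, |f n| ≤ K := fun n => (hfg n).trans ((le_abs_self _).trans (hg n))
  rw [abs_le]
  constructor
  · have := dser_mono (f := fun n => -1 * g n) (g := f) (K := K) (L := K)
      (fun n => by simpa using hg n) hf (fun n _ => by linarith [(abs_le.1 (hfg n)).1]) hs
    rw [dser_const_mul] at this
    linarith
  · exact dser_mono hf hg (fun n _ => (abs_le.1 (hfg n)).2) hs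

open Classical in
lemma dser_shift (f : ℕ → ℝ) {p : ℕ} (hp : p ≠ 0) (s : ℝ) :
    dser (fun n => if p ∣ n then f (n / p) else 0) s = (p : ℝ) ^ (-s) * dser f s := by
  unfold dser
  have hinj : Function.Injective fun n : ℕ => p * n := fun a b h =>
    Nat.eq_of_mul_eq_mul_left (Nat.pos_of_ne_zero hp) h
  rw [← tsum_mul_left, ← hinj.tsum_eq]
  · refine tsum_congr fun n => ?_
    beta_reduce
    rw [if_pos (dvd_mul_right _ _), Nat.mul_div_cancel_left _ (Nat.pos_of_ne_zero hp), Nat.cast_mul,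
      Real.mul_rpow (Nat.cast_nonneg _) (Nat.cast_nonneg _)]
    ring
  · intro n hn
    by_cases h : p ∣ n
    · obtain ⟨m, rfl⟩ := h
      exact ⟨m, rfl⟩
    · simp [h] at hn

open Classical in
/-- The restriction of `g` to integers not divisible by elements of `V`. -/
noncomputable def sieve (V : Finset ℕ) (g : ℕ → ℝ) (n : ℕ) : ℝ := if ∃ p ∈ V, p ∣ n then 0 else g n

lemma abs_sieve_le {V : Finset ℕ} {g : ℕ → ℝ} {K : ℝ} (hg : ∀ n, |g n| ≤ K) (n : ℕ) :
    |sieve V g n| ≤ K := by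
  unfold sieve
  split_ifs
  · rw [abs_zero]; exact (abs_nonneg _).trans (hg n)
  · exact hg n

lemma dser_sieve_insert {V : Finset ℕ} {g : ℕ → ℝ} {K z : ℝ} {p : ℕ} (hp : p.Prime) (hpV : p ∉ V)
    (hV : ∀ q ∈ V, q.Prime) (hg : ∀ n, |g n| ≤ K) (hz : ∀ n, g (p * n) = z * g n) {s : ℝ}
    (hs : 1 < s) :
    dser (sieve (insert p V) g) s = (1 - z * (p : ℝ) ^ (-s)) * dser (sieve V g) s := by
  classical
  have h1 := dser_shift (fun n => z * sieve V g n) hp.ne_zero s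
  rw [dser_const_mul] at h1
  have h2 : ∀ n, |(if p ∣ n then z * sieve V g (n / p) else 0)| ≤ |z| * K := by
    intro n
    split_ifs
    · rw [abs_mul]; exact mul_le_mul_of_nonneg_left (abs_sieve_le hg _) (abs_nonneg _)
    · rw [abs_zero]; exact mul_nonneg (abs_nonneg _) ((abs_nonneg _).trans (hg 0))
  have h3 := dser_sub (abs_sieve_le (V := V) hg) h2 hs
  rw [h1] at h3
  rw [show (1 - z * (p : ℝ) ^ (-s)) * dser (sieve V g) s =
    dser (sieve V g) s - (p : ℝ) ^ (-s) * (z * dser (sieve V g) s) by ring, ← h3]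
  congr 1
  funext n
  by_cases hpn : p ∣ n
  · obtain ⟨m, rfl⟩ := hpn
    rw [if_pos (dvd_mul_right _ _), Nat.mul_div_cancel_left _ hp.pos]
    have h4 : (∃ q ∈ V, q ∣ p * m) ↔ ∃ q ∈ V, q ∣ m := by
      refine exists_congr fun q => and_congr_right fun hq => ?_
      rw [(hV q hq).dvd_mul, Nat.prime_dvd_prime_iff_eq (hV q hq) hp]
      refine or_iff_right ?_
      rintro rfl
      exact hpV hq
    have h5 : ∃ q ∈ insert p V, q ∣ p * m := ⟨p, Finset.mem_insert_self _ _, dvd_mul_right _ _⟩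
    unfold sieve
    simp only [h4, h5, if_true, hz]
    split_ifs <;> ring
  · rw [if_neg hpn, sub_zero]
    unfold sieve
    simp [hpn]

lemma dser_sieve {V : Finset ℕ} {g : ℕ → ℝ} {K z : ℝ} (hV : ∀ q ∈ V, q.Prime)
    (hg : ∀ n, |g n| ≤ K) (hz : ∀ p ∈ V, ∀ n, g (p * n) = z * g n) {s : ℝ} (hs : 1 < s) :
    dser (sieve V g) s = (∏ p ∈ V, (1 - z * (p : ℝ) ^ (-s))) * dser g s := by
  classical
  induction V using Finset.induction_on with
  | empty =>
    have : sieve ∅ g = g := by funext n; simp [sieve]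
    simp [this]
  | insert p V hpV ih =>
    rw [dser_sieve_insert (hV p (Finset.mem_insert_self _ _)) hpV
      (fun q hq => hV q (Finset.mem_insert_of_mem hq)) hg (hz p (Finset.mem_insert_self _ _)) hs,
      ih (fun q hq => hV q (Finset.mem_insert_of_mem hq))
        fun q hq => hz q (Finset.mem_insert_of_mem hq), Finset.prod_insert hpV, mul_assoc]

open Classical in
/-- The indicator of a set of integers. -/
noncomputable def ind (A : Set ℕ) (n : ℕ) : ℝ := if n ∈ A then 1 else 0

lemma ind_nonneg (A : Set ℕ) (n : ℕ) : 0 ≤ ind A n := by unfold ind; split_ifs <;> norm_num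
lemma abs_ind_le (A : Set ℕ) (n : ℕ) : |ind A n| ≤ 1 := by unfold ind; split_ifs <;> norm_num

/-- Completely multiplicative twists on a divergent set of primes make the series small. -/
lemma eventually_abs_dser_le {A : Set ℕ} {Q : Set ℕ} (hp : ∀ p ∈ Q, p.Prime)
    (hA : ∀ p ∈ Q, ∀ n, p * n ∈ A ↔ n ∈ A) (hdiv : ¬ Summable fun p : Q => (p.1 : ℝ)⁻¹)
    {g : ℕ → ℝ} {z : ℝ} (hz1 : -1 ≤ z) (hz2 : z ≤ 1 / 2) (hg : ∀ n, |g n| ≤ ind A n)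
    (hz : ∀ p ∈ Q, ∀ n, g (p * n) = z * g n) {ε : ℝ} (hε : 0 < ε) :
    ∀ᶠ s in nhdsWithin 1 (Set.Ioi 1), |dser g s| ≤ ε * dser (ind A) s := by
  obtain ⟨V, hV⟩ : ∃ V : Finset Q, -4 * Real.log ε < ∑ p ∈ V, (p.1 : ℝ)⁻¹ := by
    by_contra! hcon
    exact hdiv (summable_of_sum_le (fun p => by positivity) hcon)
  have h1 : Tendsto (fun s : ℝ => ∑ p ∈ V, (p.1 : ℝ) ^ (-s)) (nhdsWithin 1 (Set.Ioi 1))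
      (nhds (∑ p ∈ V, (p.1 : ℝ)⁻¹)) := by
    refine tendsto_finsetSum _ fun p _ => ?_
    have h2 : (p.1 : ℝ) ≠ 0 := by exact_mod_cast (hp p.1 p.2).ne_zero
    have h3 : ContinuousAt (fun s : ℝ => (p.1 : ℝ) ^ (-s)) 1 :=
      (Real.continuousAt_const_rpow h2).comp continuousAt_neg
    have h4 := h3.tendsto
    rw [Real.rpow_neg_one] at h4
    exact h4.mono_left nhdsWithin_le_nhds
  filter_upwards [h1.eventually_const_lt hV, self_mem_nhdsWithin] with s hs1 hs
  rw [Set.mem_Ioi] at hs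
  classical
  set W : Finset ℕ := V.map (Function.Embedding.subtype _) with hW
  have hWP : ∀ p ∈ W, p ∈ Q := by
    intro p hp
    simp only [hW, Finset.mem_map, Function.Embedding.subtype_apply] at hp
    obtain ⟨q, -, rfl⟩ := hp
    exact q.2
  have hsum : ∑ p ∈ V, (p.1 : ℝ) ^ (-s) = ∑ p ∈ W, (p : ℝ) ^ (-s) := by simp [hW]
  rw [hsum] at hs1
  have hWp : ∀ p ∈ W, p.Prime := fun p h => hp p (hWP p h)
  have hg1 : ∀ n, |g n| ≤ 1 := fun n => (hg n).trans ((le_abs_self _).trans (abs_ind_le _ _))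
  have e1 := dser_sieve hWp hg1 (fun p h => hz p (hWP p h)) hs
  have e2 := dser_sieve (z := 1) hWp (abs_ind_le A)
    (fun p h n => by simp [ind, hA p (hWP p h)]) hs
  have e3 : |dser (sieve W g) s| ≤ dser (sieve W (ind A)) s := by
    refine abs_dser_le (abs_sieve_le (abs_ind_le A)) (fun n => ?_) hs
    unfold sieve
    split_ifs
    · simp
    · exact hg n
  rw [e1, e2, abs_mul] at e3
  have hx : ∀ p ∈ W, 0 < (p : ℝ) ^ (-s) ∧ (p : ℝ) ^ (-s) ≤ 1 := fun p h =>
    ⟨Real.rpow_pos_of_pos (by exact_mod_cast (hWp p h).pos) _,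
      Real.rpow_le_one_of_one_le_of_nonpos (by exact_mod_cast (hWp p h).one_le) (by linarith)⟩
  have hQ : 0 < ∏ p ∈ W, (1 - z * (p : ℝ) ^ (-s)) :=
    Finset.prod_pos fun p h => by nlinarith [(hx p h).1, (hx p h).2]
  have hPQ : ∏ p ∈ W, (1 - 1 * (p : ℝ) ^ (-s)) ≤
      (∏ p ∈ W, Real.exp (-((p : ℝ) ^ (-s)) / 4)) * ∏ p ∈ W, (1 - z * (p : ℝ) ^ (-s)) := by
    rw [← Finset.prod_mul_distrib]
    refine Finset.prod_le_prod (fun p h => by linarith [(hx p h).2]) fun p h => ?_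
    obtain ⟨h1, h2⟩ := hx p h
    have h3 := Real.add_one_le_exp (-((p : ℝ) ^ (-s)) / 4)
    have h4 : 0 ≤ 1 - z * (p : ℝ) ^ (-s) := by nlinarith
    refine le_trans ?_ (mul_le_mul_of_nonneg_right h3 h4)
    nlinarith [mul_pos h1 h1]
  have hexp : ∏ p ∈ W, Real.exp (-((p : ℝ) ^ (-s)) / 4) ≤ ε := by
    rw [← Real.exp_sum, ← Real.le_log_iff_exp_le hε, ← Finset.sum_div, Finset.sum_neg_distrib]
    linarith
  have hT := dser_nonneg (ind_nonneg A) s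
  rw [abs_of_pos hQ] at e3
  have e4 : (∏ p ∈ W, (1 - z * (p : ℝ) ^ (-s))) * |dser g s| ≤
      (∏ p ∈ W, (1 - z * (p : ℝ) ^ (-s))) * (ε * dser (ind A) s) := by
    refine e3.trans ((mul_le_mul_of_nonneg_right hPQ hT).trans ?_)
    have := mul_le_mul_of_nonneg_right hexp (mul_nonneg hQ.le hT)
    linarith
  exact le_of_mul_le_mul_left e4 hQ

end QuadLat

/-! ### Rich classes -/

namespace QuadLat

variable {D : ℕ} [hD : NegDisc D]
open QuadLat.Lat

/-- The primes which are norms of lattices of class `C`. -/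
def clsPrimes (C : Cl D) : Set ℕ := {p | p.Prime ∧ ¬ p ∣ D ∧ C ∈ Rep D p}

variable (D) in
/-- The classes with many primes. -/
def richCls : Set (Cl D) := {C | ¬ Summable fun p : clsPrimes C => (p.1 : ℝ)⁻¹}

/-- The Dirichlet series of the set of norms. -/
noncomputable def normSer (D : ℕ) [NegDisc D] (s : ℝ) : ℝ := dser (ind (normSet D)) s

lemma clsPrimes_mem {C : Cl D} {p : ℕ} (hp : p ∈ clsPrimes C) : p ∈ normSet D :=
  ⟨(Nat.Prime.coprime_iff_not_dvd hp.1).2 hp.2.1, ⟨C, hp.2.2⟩⟩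

lemma clsPrimes_mul_mem {C : Cl D} {p : ℕ} (hp : p ∈ clsPrimes C) (n : ℕ) :
    p * n ∈ normSet D ↔ n ∈ normSet D :=
  ⟨normSet.of_prime_mul hp.1 (clsPrimes_mem hp), normSet.mul (clsPrimes_mem hp)⟩

/-- The norms of given genus. -/
def genusSet (γ : Gen D) : Set ℕ := {n | n ∈ normSet D ∧ genus D n = γ}

lemma Gen.mul_self (γ : Gen D) : γ * γ = 1 := by
  obtain ⟨C, rfl⟩ := QuotientGroup.mk'_surjective _ γ
  rw [← map_mul, QuotientGroup.mk'_apply, QuotientGroup.eq_one_iff]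
  exact ⟨C, pow_two C⟩

lemma genus_close {C : Cl D} (hC : C ∈ richCls D) (γ : Gen D) {ε : ℝ} (hε : 0 < ε) :
    ∀ᶠ s in nhdsWithin 1 (Set.Ioi 1),
      |dser (ind (genusSet γ)) s - dser (ind (genusSet (γ * toGen C))) s| ≤ ε * normSer D s := by
  have h1 := eventually_abs_dser_le (A := normSet D) (Q := clsPrimes C)
    (g := fun n => ind (genusSet γ) n - ind (genusSet (γ * toGen C)) n) (z := -1)
    (fun p hp => hp.1) (fun p hp => clsPrimes_mul_mem hp) hC (by norm_num) (by norm_num) ?_ ?_ hε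
  · filter_upwards [h1, self_mem_nhdsWithin] with s hs hs1
    rwa [dser_sub (abs_ind_le _) (abs_ind_le _) hs1] at hs
  · intro n
    unfold ind genusSet
    simp only [Set.mem_ofPred_eq]
    by_cases hn : n ∈ normSet D
    · simp only [hn, true_and, if_true]
      split_ifs <;> norm_num
    · simp [hn]
  · intro p hp n
    classical
    unfold ind genusSet
    have hm := clsPrimes_mul_mem hp n
    simp only [Set.mem_ofPred_eq, hm]
    by_cases hn : n ∈ normSet D
    · simp only [hn, true_and]
      rw [genus_mul (clsPrimes_mem hp) hn, genus_eq (clsPrimes_mem hp).1 hp.2.2]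
      have e1 : toGen C * genus D n = γ ↔ genus D n = γ * toGen C := by
        constructor
        · rintro rfl
          rw [mul_comm (toGen C), mul_assoc, Gen.mul_self, mul_one]
        · intro h
          rw [h, mul_comm, mul_assoc, Gen.mul_self, mul_one]
      have e2 : toGen C * genus D n = γ * toGen C ↔ genus D n = γ := by
        rw [mul_comm, mul_left_inj]
      rw [if_congr e1 rfl rfl, if_congr e2 rfl rfl]
      ring
    · simp [hn]

lemma genus_close_of_closure (hH : Subgroup.closure (richCls D) = ⊤) (C : Cl D) :
    ∀ (γ : Gen D) {ε : ℝ}, 0 < ε → ∀ᶠ s in nhdsWithin 1 (Set.Ioi 1),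
      |dser (ind (genusSet γ)) s - dser (ind (genusSet (γ * toGen C))) s| ≤ ε * normSer D s := by
  have hC : C ∈ Subgroup.closure (richCls D) := by rw [hH]; trivial
  induction hC using Subgroup.closure_induction with
  | mem C hC => exact fun γ ε hε => genus_close hC γ hε
  | one =>
    intro γ ε hε
    refine Filter.Eventually.of_forall fun s => ?_
    rw [map_one, mul_one, sub_self, abs_zero]
    exact mul_nonneg hε.le (dser_nonneg (ind_nonneg _) s)
  | mul C E _ _ h1 h2 =>
    intro γ ε hε
    filter_upwards [h1 γ (half_pos hε), h2 (γ * toGen C) (half_pos hε)] with s hs1 hs2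
    rw [map_mul, ← mul_assoc]
    refine (abs_sub_le _ _ _).trans ((add_le_add hs1 hs2).trans (by linarith))
  | inv C _ h1 =>
    intro γ ε hε
    filter_upwards [h1 (γ * toGen C⁻¹) hε] with s hs1
    rw [abs_sub_comm]
    rwa [mul_assoc, ← map_mul, inv_mul_cancel, map_one, mul_one] at hs1

lemma genusSet_ge (hH : Subgroup.closure (richCls D) = ⊤) (γ : Gen D) {ε : ℝ} (hε : 0 < ε) :
    ∀ᶠ s in nhdsWithin 1 (Set.Ioi 1),
      (1 / Nat.card (Gen D) - ε) * normSer D s ≤ dser (ind (genusSet γ)) s := by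
  classical
  have hfin : Finite (Gen D) := inferInstance
  have := Fintype.ofFinite (Gen D)
  have h1 : ∀ δ : Gen D, ∀ᶠ s in nhdsWithin 1 (Set.Ioi 1),
      |dser (ind (genusSet γ)) s - dser (ind (genusSet δ)) s| ≤ ε * normSer D s := by
    intro δ
    obtain ⟨C, hC⟩ := QuotientGroup.mk'_surjective _ (γ⁻¹ * δ)
    have := genus_close_of_closure hH C γ hε
    rwa [show toGen C = γ⁻¹ * δ from hC, mul_inv_cancel_left] at this
  filter_upwards [Filter.eventually_all.2 h1, self_mem_nhdsWithin] with s hs hs1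
  have e1 : normSer D s = ∑ δ : Gen D, dser (ind (genusSet δ)) s := by
    rw [← dser_sum _ (fun i _ => abs_ind_le _) hs1, normSer]
    congr 1
    funext n
    unfold ind genusSet
    simp only [Set.mem_ofPred_eq]
    by_cases hn : n ∈ normSet D <;> simp [hn]
  have e2 : normSer D s ≤ ∑ δ : Gen D, (dser (ind (genusSet γ)) s + ε * normSer D s) := by
    conv_lhs => rw [e1]
    exact Finset.sum_le_sum fun δ _ => by linarith [(abs_le.1 (hs δ)).1]
  rw [Finset.sum_const, Finset.card_univ, ← Nat.card_eq_fintype_card, nsmul_eq_mul] at e2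
  have hG : (0 : ℝ) < Nat.card (Gen D) := by exact_mod_cast Nat.card_pos
  have e3 : 1 / (Nat.card (Gen D) : ℝ) * normSer D s ≤
      dser (ind (genusSet γ)) s + ε * normSer D s := by
    rw [one_div, inv_mul_le_iff₀ hG]
    exact e2
  linarith

/-- Norms with few prime factors of class `C`. -/
def fewSet (C : Cl D) : Set ℕ := {n | n ∈ normSet D ∧ cnt C n < Nat.card (Cl D)}

lemma fewSet_le {C : Cl D} (hC : C ∈ richCls D) {ε : ℝ} (hε : 0 < ε) :
    ∀ᶠ s in nhdsWithin 1 (Set.Ioi 1), dser (ind (fewSet C)) s ≤ ε * normSer D s := by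
  set h := Nat.card (Cl D)
  have hpow : ∀ k : ℕ, 0 < (1 / 2 : ℝ) ^ k ∧ (1 / 2 : ℝ) ^ k ≤ 1 := fun k =>
    ⟨by positivity, pow_le_one₀ (by norm_num) (by norm_num)⟩
  have hb : ∀ n, |ind (normSet D) n * (1 / 2 : ℝ) ^ cnt C n| ≤ ind (normSet D) n := by
    intro n
    rw [abs_mul, abs_of_nonneg (ind_nonneg _ _), abs_of_pos (hpow _).1]
    exact mul_le_of_le_one_right (ind_nonneg _ _) (hpow _).2
  have h1 := eventually_abs_dser_le (A := normSet D) (Q := clsPrimes C)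
    (g := fun n => ind (normSet D) n * (1 / 2 : ℝ) ^ cnt C n) (z := 1 / 2)
    (fun p hp => hp.1) (fun p hp => clsPrimes_mul_mem hp) hC (by norm_num) le_rfl hb ?_
    (mul_pos hε (hpow h).1)
  · filter_upwards [h1, self_mem_nhdsWithin] with s hs hs1
    have e1 := dser_mono (f := fun n => (1 / 2 : ℝ) ^ h * ind (fewSet C) n) (K := 1) (L := 1) ?_
      (fun n => (hb n).trans ((le_abs_self _).trans (abs_ind_le _ _))) ?_ hs1
    · rw [dser_const_mul] at e1
      have e2 := (e1.trans (le_abs_self _)).trans hs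
      refine le_of_mul_le_mul_left (a := (1 / 2 : ℝ) ^ h) (e2.trans (le_of_eq ?_)) (hpow h).1
      rw [normSer]; ring
    · intro n
      rw [abs_mul, abs_of_pos (hpow _).1]
      exact mul_le_one₀ (hpow _).2 (abs_nonneg _) (abs_ind_le _ _)
    · intro n _
      unfold ind fewSet
      simp only [Set.mem_ofPred_eq]
      by_cases hn : n ∈ normSet D
      · simp only [hn, true_and, if_true, one_mul]
        split_ifs with h2
        · rw [mul_one]
          exact pow_le_pow_of_le_one (by norm_num) (by norm_num) h2.le
        · rw [mul_zero]; exact (hpow _).1.le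
      · simp [hn]
  · intro p hp n
    classical
    unfold ind
    have hm := clsPrimes_mul_mem hp n
    simp only [hm]
    by_cases hn : n ∈ normSet D
    · simp only [hn, if_true]
      rw [cnt_mul_of_mem hp.1 (normSet.pos hn).ne' hp.2.2, pow_succ]
      ring
    · simp [hn]

/-- Norms prime to `D` represented by the class `C`. -/
def repSet (C : Cl D) : Set ℕ := {n | n ∈ normSet D ∧ C ∈ Rep D n}

lemma repSet_ge (hH : Subgroup.closure (richCls D) = ⊤) (C : Cl D) {ε : ℝ} (hε : 0 < ε) :
    ∀ᶠ s in nhdsWithin 1 (Set.Ioi 1),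
      (1 / Nat.card (Gen D) - ε) * normSer D s ≤ dser (ind (repSet C)) s := by
  classical
  have := Fintype.ofFinite (Cl D)
  set t : Finset (Cl D) := Finset.univ.filter (· ∈ richCls D) with ht
  have hδ : 0 < ε / 2 / (t.card + 1) := by positivity
  have h1 : ∀ E ∈ t, ∀ᶠ s in nhdsWithin 1 (Set.Ioi 1),
      dser (ind (fewSet E)) s ≤ ε / 2 / (t.card + 1) * normSer D s := fun E hE =>
    fewSet_le (Finset.mem_filter.1 hE).2 hδ
  filter_upwards [genusSet_ge hH (toGen C) (half_pos hε), (Finset.eventually_all t).2 h1,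
    self_mem_nhdsWithin] with s hs1 hs2 hs
  have hT : 0 ≤ normSer D s := dser_nonneg (ind_nonneg _) s
  have hsumb : ∀ n, |∑ E ∈ t, ind (fewSet E) n| ≤ t.card := by
    intro n
    refine (Finset.abs_sum_le_sum_abs _ _).trans ?_
    refine (Finset.sum_le_sum fun E _ => abs_ind_le _ _).trans ?_
    simp
  have e1 : dser (ind (genusSet (toGen C))) s ≤
      dser (fun n => ind (repSet C) n + ∑ E ∈ t, ind (fewSet E) n) s := by
    refine dser_mono (K := 1) (L := 1 + t.card) (abs_ind_le _) (fun n =>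
      (abs_add_le _ _).trans (add_le_add (abs_ind_le _ _) (hsumb n))) (fun n _ => ?_) hs
    have hnn : 0 ≤ ∑ E ∈ t, ind (fewSet E) n := Finset.sum_nonneg fun E _ => ind_nonneg _ _
    by_cases hg : n ∈ genusSet (toGen C)
    · by_cases hr : n ∈ repSet C
      · have : ind (repSet C) n = 1 := if_pos hr
        linarith [(le_abs_self _).trans (abs_ind_le (genusSet (toGen C)) n)]
      · obtain ⟨E, hE, hE2⟩ : ∃ E ∈ richCls D, cnt E n < Nat.card (Cl D) := by
          by_contra! hcon
          exact hr ⟨hg.1, mem_Rep_of_cnt hH hg.1 hcon hg.2⟩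
        have h2 : ind (fewSet E) n = 1 := if_pos ⟨hg.1, hE2⟩
        have h3 := Finset.single_le_sum (f := fun E => ind (fewSet E) n)
          (fun E _ => ind_nonneg _ _) (show E ∈ t from by simp [ht, hE])
        rw [h2] at h3
        linarith [(le_abs_self _).trans (abs_ind_le (genusSet (toGen C)) n),
          ind_nonneg (repSet C) n]
    · have : ind (genusSet (toGen C)) n = 0 := if_neg hg
      rw [this]
      exact add_nonneg (ind_nonneg _ _) hnn
  rw [dser_add (abs_ind_le _) hsumb hs, dser_sum t (fun E _ => abs_ind_le _) hs] at e1
  have e2 := Finset.sum_le_sum hs2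
  rw [Finset.sum_const, nsmul_eq_mul] at e2
  have e3 : (t.card : ℝ) * (ε / 2 / (t.card + 1) * normSer D s) ≤ ε / 2 * normSer D s := by
    rw [← mul_assoc]
    refine mul_le_mul_of_nonneg_right ?_ hT
    rw [mul_div_assoc', div_le_iff₀ (by positivity)]
    nlinarith
  linarith

end QuadLat

/-! ### Sieved series of integral lattices -/

namespace QuadLat

variable {D : ℕ} [hD : NegDisc D]
open QuadLat.Lat

/-- Integral lattices of class `C` not contained in any element of `V`. -/
def sieveInt (V : Finset (Lat D)) (C : Cl D) : Set (Lat D) :=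
  {a | a ∈ clsInt C ∧ ∀ P ∈ V, ¬ a.carrier ≤ P.carrier}

/-- The Dirichlet series of `sieveInt V C`. -/
noncomputable def sieveSer (V : Finset (Lat D)) (C : Cl D) (s : ℝ) : ℝ :=
  ∑' a : sieveInt V C, (a.1.nn : ℝ) ^ (-s)

lemma sieveInt_summable (h3 : 3 < D) (V : Finset (Lat D)) (C : Cl D) {s : ℝ} (hs : 1 < s) :
    Summable fun a : sieveInt V C => (a.1.nn : ℝ) ^ (-s) :=
  ((tendsto_clsInt h3 C).1 s hs).comp_injective
    (i := fun a : sieveInt V C => (⟨a.1, a.2.1⟩ : clsInt C)) fun _ _ h =>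
      Subtype.ext (congrArg (fun z : clsInt C => z.1) h)

lemma Lat.IsPr.eq_of_le {P Q : Lat D} {p q : ℕ} (hP : P.IsPr p) (hQ : Q.IsPr q)
    (h : P.carrier ≤ Q.carrier) : P = Q := by
  obtain ⟨b, hb, rfl⟩ := exists_eq_mul_of_le h
  have h1 := hP.nn_eq
  rw [hQ.isInt.nn_mul hb, hQ.nn_eq] at h1
  have h2 : q = p := (Nat.prime_dvd_prime_iff_eq hQ.prime hP.prime).1 ⟨_, h1.symm⟩
  subst h2
  have h3 : b.nn = 1 := Nat.eq_of_mul_eq_mul_left hQ.prime.pos (h1.trans (mul_one q).symm)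
  rw [hb.eq_one h3, mul_one]

lemma sieveInt_mul {V : Finset (Lat D)} {C : Cl D} {P : Lat D} {p : ℕ} (hP : P.IsPr p)
    (hPV : P ∉ V) (hV : ∀ Q ∈ V, ∃ q, Q.IsPr q) (a : Lat D) :
    a ∈ sieveInt V C ∧ a.carrier ≤ P.carrier ↔
      a ∈ (P * ·) '' sieveInt V (C * (cls P)⁻¹) := by
  constructor
  · rintro ⟨⟨⟨h1, h2, h3⟩, h4⟩, h5⟩
    obtain ⟨b, hb, rfl⟩ := exists_eq_mul_of_le h5
    refine ⟨b, ⟨⟨hb, ?_, ?_⟩, fun Q hQ h6 => h4 Q hQ ?_⟩, rfl⟩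
    · rw [← h2, map_mul, mul_comm, inv_mul_cancel_left]
    · rw [hP.isInt.nn_mul hb] at h3
      exact Nat.Coprime.coprime_mul_left h3
    · rw [mul_comm, mul_carrier, ← Q.mul_ord]
      exact mul_le_mul' h6 hP.isInt
  · rintro ⟨b, ⟨⟨h1, h2, h3⟩, h4⟩, rfl⟩
    refine ⟨⟨⟨hP.isInt.mul h1, ?_, ?_⟩, fun Q hQ h6 => ?_⟩, ?_⟩
    · rw [map_mul, h2, mul_comm, inv_mul_cancel_right]
    · rw [hP.isInt.nn_mul h1, hP.nn_eq]
      exact Nat.Coprime.mul_left ((Nat.Prime.coprime_iff_not_dvd hP.prime).2 hP.not_dvd) h3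
    · obtain ⟨q, hq⟩ := hV Q hQ
      rcases hq.le_or_le hP.isInt h1 h6 with h | h
      · exact hPV (hP.eq_of_le hq h ▸ hQ)
      · exact h4 Q hQ h
    · change (P * b).carrier ≤ _
      rw [mul_carrier]
      conv_rhs => rw [← P.mul_ord]
      exact mul_le_mul' le_rfl h1

lemma tsum_mul_image {P : Lat D} {p : ℕ} (hP : P.IsPr p) {S : Set (Lat D)}
    (hS : ∀ a ∈ S, a.IsInt) (s : ℝ) :
    ∑' a : ((P * ·) '' S : Set (Lat D)), (a.1.nn : ℝ) ^ (-s) =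
      (p : ℝ) ^ (-s) * ∑' a : S, (a.1.nn : ℝ) ^ (-s) := by
  rw [tsum_image (fun a : Lat D => (a.nn : ℝ) ^ (-s)) (mul_right_injective P).injOn,
    ← tsum_mul_left]
  refine tsum_congr fun a => ?_
  rw [hP.isInt.nn_mul (hS a.1 a.2), hP.nn_eq, Nat.cast_mul,
    Real.mul_rpow (Nat.cast_nonneg _) (Nat.cast_nonneg _)]

open Classical in
lemma sieveSer_insert (h3 : 3 < D) {V : Finset (Lat D)} {P : Lat D} {p : ℕ} (hP : P.IsPr p)
    (hPV : P ∉ V) (hV : ∀ Q ∈ V, ∃ q, Q.IsPr q) (C : Cl D) {s : ℝ} (hs : 1 < s) :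
    sieveSer (insert P V) C s =
      sieveSer V C s - (p : ℝ) ^ (-s) * sieveSer V (C * (cls P)⁻¹) s := by
  have h1 : sieveInt V C = sieveInt (insert P V) C ∪ (P * ·) '' sieveInt V (C * (cls P)⁻¹) := by
    ext a
    rw [Set.mem_union, ← sieveInt_mul hP hPV hV]
    unfold sieveInt
    simp only [Set.mem_ofPred_eq, Finset.mem_insert, forall_eq_or_imp]
    tauto
  have hdis : Disjoint (sieveInt (insert P V) C) ((P * ·) '' sieveInt V (C * (cls P)⁻¹)) := by
    rw [Set.disjoint_left]
    intro a ha ha2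
    rw [← sieveInt_mul hP hPV hV] at ha2
    exact ha.2 P (Finset.mem_insert_self _ _) ha2.2
  have h2 : Summable fun a : ((P * ·) '' sieveInt V (C * (cls P)⁻¹) : Set (Lat D)) =>
      (a.1.nn : ℝ) ^ (-s) :=
    (sieveInt_summable h3 V C hs).comp_injective
      (i := Set.inclusion fun a ha => ((sieveInt_mul hP hPV hV a).2 ha).1)
      (Set.inclusion_injective _)
  have h4 := Summable.tsum_union_disjoint (f := fun a : Lat D => (a.nn : ℝ) ^ (-s)) hdis
    (sieveInt_summable h3 _ C hs) h2
  have h5 := tsum_congr_set_coe (fun a : Lat D => (a.nn : ℝ) ^ (-s)) h1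
  have h6 := tsum_mul_image hP (S := sieveInt V (C * (cls P)⁻¹)) (fun a ha => ha.1.1) s
  unfold sieveSer
  linarith

lemma tendsto_sieveSer (h3 : 3 < D) {V : Finset (Lat D)} (hV : ∀ Q ∈ V, ∃ q, Q.IsPr q) (C : Cl D) :
    Tendsto (fun s : ℝ => (s - 1) * sieveSer V C s) (nhdsWithin 1 (Set.Ioi 1))
      (nhds (rho D * ∏ P ∈ V, (1 - (P.nn : ℝ)⁻¹))) := by
  classical
  induction V using Finset.induction_on generalizing C with
  | empty =>
    rw [Finset.prod_empty, mul_one]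
    have : sieveInt ∅ C = clsInt C := by ext a; simp [sieveInt]
    unfold sieveSer
    rw [this]
    exact (tendsto_clsInt h3 C).2
  | insert P V hPV ih =>
    have ih' := ih fun Q hQ => hV Q (Finset.mem_insert_of_mem hQ)
    obtain ⟨p, hP⟩ := hV P (Finset.mem_insert_self _ _)
    have hc : Tendsto (fun s : ℝ => (p : ℝ) ^ (-s)) (nhdsWithin 1 (Set.Ioi 1))
        (nhds (p : ℝ)⁻¹) := by
      have h2 : (p : ℝ) ≠ 0 := by exact_mod_cast hP.prime.ne_zero
      have h4 := ((Real.continuousAt_const_rpow h2).comp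
        (x := (1 : ℝ)) continuousAt_neg).tendsto
      simp only [Function.comp, Real.rpow_neg_one] at h4
      exact h4.mono_left nhdsWithin_le_nhds
    have h1 := (ih' C).sub (hc.mul (ih' (C * (cls P)⁻¹)))
    rw [Finset.prod_insert hPV, hP.nn_eq]
    refine (h1.congr' ?_).trans (le_of_eq (congrArg nhds (by ring)))
    filter_upwards [self_mem_nhdsWithin] with s hs
    rw [sieveSer_insert h3 hP hPV (fun Q hQ => hV Q (Finset.mem_insert_of_mem hQ)) C hs]
    ring

/-- Lattices of prime norm with class outside `K`. -/
def prOutside (K : Subgroup (Cl D)) : Set (Lat D) := {P | (∃ p, P.IsPr p) ∧ cls P ∉ K}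

lemma cls_mem_of_not_le (K : Subgroup (Cl D)) {a : Lat D} (ha : a.IsInt) (hc : a.nn.Coprime D)
    (h : ∀ P ∈ prOutside K, ¬ a.carrier ≤ P.carrier) : cls a ∈ K := by
  induction hn : a.nn using Nat.strong_induction_on generalizing a with
  | _ n ih =>
    by_cases h1 : a.nn = 1
    · rw [ha.eq_one h1, map_one]; exact K.one_mem
    obtain ⟨p, hp, hpa⟩ := Nat.exists_prime_and_dvd h1
    have hpD := not_dvd_of_coprime hp hpa hc
    obtain ⟨Q, b, hQ, hb, rfl⟩ := exists_eq_atom_mul hp hpD ha hpa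
    obtain ⟨hQi, hQn⟩ := atom_or_conj hp hQ
    have hle : (Q * b).carrier ≤ Q.carrier := by
      rw [mul_carrier]
      conv_rhs => rw [← Q.mul_ord]
      exact mul_le_mul' le_rfl hb
    have hle' : (Q * b).carrier ≤ b.carrier := by
      rw [mul_comm, mul_carrier]
      conv_rhs => rw [← b.mul_ord]
      exact mul_le_mul' le_rfl hQi
    have hnn := hQi.nn_mul hb
    have hQ1 : 1 < Q.nn := by
      rw [hQn]; exact Nat.one_lt_pow (fdeg_pos p).ne' hp.one_lt
    have hbK : cls b ∈ K := by
      refine ih b.nn ?_ hb ?_ (fun P hP hbP => h P hP (hle'.trans hbP)) rfl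
      · rw [← hn, hnn]; exact lt_mul_of_one_lt_left hb.nn_pos hQ1
      · rw [hnn] at hc; exact Nat.Coprime.coprime_mul_left hc
    rw [map_mul]
    refine K.mul_mem ?_ hbK
    by_cases hP : ∃ P : Lat D, P.IsPr p
    · have hQP : Q.IsPr p := by
        rcases hQ with rfl | rfl
        exacts [atom_isPr hP, (atom_isPr hP).conj]
      by_contra hK
      exact h Q ⟨⟨p, hQP⟩, hK⟩ hle
    · have : NeZero p := ⟨hp.ne_zero⟩
      have h2 : Q = ofNat D p := by
        rcases hQ with rfl | rfl
        exacts [atom_eq_ofNat hP, by rw [atom_eq_ofNat hP, ofNat_conj]]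
      rw [h2, cls_ofNat]
      exact K.one_mem

end QuadLat

/-! ### Rich classes generate the class group -/

namespace QuadLat

variable {D : ℕ} [hD : NegDisc D]
open QuadLat.Lat

lemma rho_pos (h3 : 3 < D) : 0 < rho D := by
  have h1 : (0 : ℝ) < D := by exact_mod_cast (by omega : 0 < D)
  have h2 : (0 : ℝ) < D.totient := by exact_mod_cast Nat.totient_pos.2 (by omega : 0 < D)
  have h3 : (0 : ℝ) < unitCard D := by exact_mod_cast (unitCard_bounds h3).1
  unfold rho
  positivity

lemma summable_prOutside {K : Subgroup (Cl D)} (hK : richCls D ⊆ K) :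
    Summable fun P : prOutside K => (P.1.nn : ℝ)⁻¹ := by
  classical
  let F : (Σ x : Cl D × Bool, clsPrimes x.1) → ℝ := fun y => if y.1.1 ∈ K then 0 else (y.2.1 : ℝ)⁻¹
  have hF : Summable F := by
    refine (summable_sigma_of_nonneg fun y => ?_).2 ⟨fun x => ?_, ?_⟩
    · change 0 ≤ (if y.1.1 ∈ K then 0 else (y.2.1 : ℝ)⁻¹)
      split_ifs <;> positivity
    · change Summable fun y : clsPrimes x.1 => if x.1 ∈ K then 0 else (y.1 : ℝ)⁻¹
      by_cases h : x.1 ∈ K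
      · simp only [h, if_true]; exact summable_zero
      · simp only [h, if_false]
        by_contra h2
        exact h (hK h2)
    · have := Fintype.ofFinite (Cl D)
      exact (hasSum_fintype _).summable
  let e : prOutside K → Σ x : Cl D × Bool, clsPrimes x.1 := fun P =>
    ⟨(cls P.1, decide (P.1 = atom D P.1.nn)), ⟨P.1.nn, by
      obtain ⟨p, hp⟩ := P.2.1
      rw [hp.nn_eq]
      exact ⟨hp.prime, hp.not_dvd, P.1, hp.isInt, hp.nn_eq, rfl⟩⟩⟩
  have he1 : ∀ P, (e P).2.1 = P.1.nn := fun P => rfl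
  have he2 : ∀ P, (e P).1.2 = decide (P.1 = atom D P.1.nn) := fun P => rfl
  have he : Function.Injective e := by
    intro P Q h
    have h1 : P.1.nn = Q.1.nn := by rw [← he1, ← he1, h]
    have h2 : decide (P.1 = atom D P.1.nn) = decide (Q.1 = atom D Q.1.nn) := by
      rw [← he2, ← he2, h]
    rw [decide_eq_decide, ← h1] at h2
    obtain ⟨p, hp⟩ := P.2.1
    obtain ⟨q, hq⟩ := Q.2.1
    have hpq : q = p := by rw [← hq.nn_eq, ← h1, hp.nn_eq]
    subst hpq
    rw [hp.nn_eq] at h2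
    have ha := atom_isPr ⟨P.1, hp⟩
    apply Subtype.ext
    by_cases h4 : P.1 = atom D q
    · rw [h4, h2.1 h4]
    · rw [(ha.eq_or_eq_conj hp).resolve_left h4,
        (ha.eq_or_eq_conj hq).resolve_left fun h => h4 (h2.2 h)]
  refine (hF.comp_injective he).congr fun P => ?_
  change (if cls P.1 ∈ K then 0 else (P.1.nn : ℝ)⁻¹) = _
  rw [if_neg P.2.2]

lemma tsum_le_tsum_of_sigma {α ι : Type*} {β : ι → Type*} {F : α → ℝ} {g : (Σ i, β i) → ℝ}
    (hg0 : ∀ y, 0 ≤ g y) (hgs : ∀ i, Summable fun b => g ⟨i, b⟩) {u : ι → ℝ} (hu : Summable u)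
    (hgu : ∀ i, ∑' b, g ⟨i, b⟩ ≤ u i) {e : α → Σ i, β i} (he : Function.Injective e)
    (hF : ∀ a, F a = g (e a)) : ∑' a, F a ≤ ∑' i, u i := by
  have hfs : Summable fun i => ∑' b, g ⟨i, b⟩ :=
    hu.of_nonneg_of_le (fun i => tsum_nonneg fun b => hg0 _) hgu
  have hg : Summable g := (summable_sigma_of_nonneg hg0).2 ⟨hgs, hfs⟩
  rw [tsum_congr hF]
  exact (tsum_comp_le_tsum_of_inj hg hg0 he).trans
    ((hg.tsum_sigma' hgs).trans_le (hfs.tsum_le_tsum hgu hu))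

lemma sieveSer_le_of_forall (h3 : 3 < D) {V : Finset (Lat D)} (hV : ∀ Q ∈ V, ∃ q, Q.IsPr q)
    {J : Set (Lat D)} (hJ : ∀ P ∈ J, ∃ p, P.IsPr p) (hJV : ∀ P ∈ J, P ∉ V)
    (hJs : Summable fun P : J => (P.1.nn : ℝ)⁻¹) {C : Cl D}
    (hC : ∀ a ∈ sieveInt V C, ∃ P ∈ J, a.carrier ≤ P.carrier) {s M : ℝ} (hs : 1 < s)
    (hM : ∀ C', sieveSer V C' s ≤ M) :
    sieveSer V C s ≤ (∑' P : J, (P.1.nn : ℝ)⁻¹) * M := by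
  have hP1 : ∀ P : J, ((P.1.nn : ℝ) ^ (-s)) ≤ (P.1.nn : ℝ)⁻¹ := by
    intro P
    obtain ⟨p, hp⟩ := hJ P.1 P.2
    rw [hp.nn_eq, ← Real.rpow_neg_one]
    exact Real.rpow_le_rpow_of_exponent_le (by exact_mod_cast hp.prime.one_lt.le) (by linarith)
  have hfib : ∀ P : J, ∑' b : sieveInt V (C * (cls P.1)⁻¹),
      (P.1.nn : ℝ) ^ (-s) * (b.1.nn : ℝ) ^ (-s) ≤ (P.1.nn : ℝ)⁻¹ * M := by
    intro P
    rw [tsum_mul_left]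
    exact mul_le_mul (hP1 P) (hM _) (tsum_nonneg fun a => Real.rpow_nonneg (Nat.cast_nonneg _) _)
      (inv_nonneg.2 (Nat.cast_nonneg _))
  have hex : ∀ a : sieveInt V C, ∃ y : Σ P : J, sieveInt V (C * (cls P.1)⁻¹),
      y.1.1 * y.2.1 = a.1 := by
    intro a
    obtain ⟨P, hPJ, hP⟩ := hC a.1 a.2
    obtain ⟨p, hp⟩ := hJ P hPJ
    obtain ⟨b, hb, hab⟩ := (sieveInt_mul hp (hJV P hPJ) hV a.1).1 ⟨a.2, hP⟩
    exact ⟨⟨⟨P, hPJ⟩, ⟨b, hb⟩⟩, hab⟩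
  choose e he using hex
  have hinj : Function.Injective e := fun a b h => Subtype.ext (by rw [← he, ← he, h])
  have hg0 : ∀ y : Σ P : J, sieveInt V (C * (cls P.1)⁻¹),
      0 ≤ (y.1.1.nn : ℝ) ^ (-s) * (y.2.1.nn : ℝ) ^ (-s) := fun y =>
    mul_nonneg (Real.rpow_nonneg (Nat.cast_nonneg _) _) (Real.rpow_nonneg (Nat.cast_nonneg _) _)
  have hgs : ∀ P : J, Summable fun b : sieveInt V (C * (cls P.1)⁻¹) =>
      (P.1.nn : ℝ) ^ (-s) * (b.1.nn : ℝ) ^ (-s) := fun P =>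
    (sieveInt_summable h3 V _ hs).mul_left _
  have hF : ∀ a : sieveInt V C, (a.1.nn : ℝ) ^ (-s) =
      ((e a).1.1.nn : ℝ) ^ (-s) * ((e a).2.1.nn : ℝ) ^ (-s) := by
    intro a
    obtain ⟨p, hp⟩ := hJ (e a).1.1 (e a).1.2
    rw [← he a, hp.isInt.nn_mul (e a).2.2.1.1, Nat.cast_mul,
      Real.mul_rpow (Nat.cast_nonneg _) (Nat.cast_nonneg _)]
  rw [← tsum_mul_right]
  exact tsum_le_tsum_of_sigma (β := fun P : J => ↥(sieveInt V (C * (cls P.1)⁻¹)))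
    (g := fun y => (y.1.1.nn : ℝ) ^ (-s) * (y.2.1.nn : ℝ) ^ (-s))
    hg0 hgs (hJs.mul_right M) hfib hinj hF

/-- The class group is generated by the classes containing many primes. -/
theorem closure_richCls (h3 : 3 < D) : Subgroup.closure (richCls D) = ⊤ := by
  classical
  set K := Subgroup.closure (richCls D) with hK
  refine (Subgroup.eq_top_iff' K).2 fun C => ?_
  by_contra hCK
  have hsum := summable_prOutside (K := K) Subgroup.subset_closure
  obtain ⟨V', hV'⟩ := ((tendsto_tsum_compl_atTop_zero
    fun P : prOutside K => (P.1.nn : ℝ)⁻¹).eventually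
      (gt_mem_nhds (show (0 : ℝ) < 1 / 4 by norm_num))).exists
  set V : Finset (Lat D) := V'.map (Function.Embedding.subtype _) with hVdef
  have hVB : ∀ Q ∈ V, Q ∈ prOutside K := by
    intro Q hQ
    obtain ⟨R, -, rfl⟩ := Finset.mem_map.1 hQ
    exact R.2
  have hV : ∀ Q ∈ V, ∃ q, Q.IsPr q := fun Q hQ => (hVB Q hQ).1
  set J : Set (Lat D) := {P | P ∈ prOutside K ∧ P ∉ V} with hJ
  let e : J ≃ {x : prOutside K // x ∉ V'} :=
    { toFun := fun P => ⟨⟨P.1, P.2.1⟩, fun h => P.2.2 (Finset.mem_map.2 ⟨_, h, rfl⟩)⟩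
      invFun := fun x => ⟨x.1.1, x.1.2, fun h => x.2 (by
        obtain ⟨R, hR, hRx⟩ := Finset.mem_map.1 h
        rwa [← Subtype.ext (a1 := R) (a2 := x.1) hRx])⟩
      left_inv := fun _ => rfl
      right_inv := fun _ => rfl }
  have hJs : Summable fun P : J => (P.1.nn : ℝ)⁻¹ :=
    hsum.comp_injective (i := fun P : J => (⟨P.1, P.2.1⟩ : prOutside K)) fun P Q h =>
      Subtype.ext (congrArg (fun z : prOutside K => z.1) h)
  have hJt : ∑' P : J, (P.1.nn : ℝ)⁻¹ < 1 / 4 := by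
    have := e.tsum_eq fun x : {x : prOutside K // x ∉ V'} => (x.1.1.nn : ℝ)⁻¹
    exact lt_of_eq_of_lt this hV'
  have hJ0 : 0 ≤ ∑' P : J, (P.1.nn : ℝ)⁻¹ := tsum_nonneg fun P => by positivity
  have hCJ : ∀ a ∈ sieveInt V C, ∃ P ∈ J, a.carrier ≤ P.carrier := by
    intro a ha
    by_contra! hno
    refine hCK (ha.1.2.1 ▸ cls_mem_of_not_le K ha.1.1 ha.1.2.2 fun P hP hle => ?_)
    by_cases hPV : P ∈ V
    · exact ha.2 P hPV hle
    · exact hno P ⟨hP, hPV⟩ hle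
  set c := rho D * ∏ P ∈ V, (1 - (P.nn : ℝ)⁻¹) with hc
  have hc0 : 0 < c := by
    refine mul_pos (rho_pos h3) (Finset.prod_pos fun P hP => ?_)
    obtain ⟨p, hp⟩ := hV P hP
    rw [hp.nn_eq, sub_pos]
    exact inv_lt_one_of_one_lt₀ (by exact_mod_cast hp.prime.one_lt)
  have hup : ∀ᶠ s in nhdsWithin (1 : ℝ) (Set.Ioi 1), ∀ C',
      (s - 1) * sieveSer V C' s < 3 / 2 * c :=
    eventually_all.2 fun C' => (tendsto_sieveSer h3 hV C').eventually
      (gt_mem_nhds (by linarith))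
  have hlo : ∀ᶠ s in nhdsWithin (1 : ℝ) (Set.Ioi 1), c / 2 < (s - 1) * sieveSer V C s :=
    (tendsto_sieveSer h3 hV C).eventually (lt_mem_nhds (by linarith))
  obtain ⟨s, ⟨h1, h2⟩, hs⟩ := ((hup.and hlo).and self_mem_nhdsWithin).exists
  have hs0 : 0 < s - 1 := sub_pos.2 hs
  have h5 := sieveSer_le_of_forall h3 hV (fun P hP => hP.1.1) (fun P hP => hP.2) hJs hCJ hs
    (M := 3 / 2 * c / (s - 1)) fun C' => by
      rw [le_div_iff₀ hs0, mul_comm]; exact (h1 C').le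
  have h6 : (s - 1) * sieveSer V C s ≤ 1 / 4 * (3 / 2 * c) := by
    calc (s - 1) * sieveSer V C s
        ≤ (s - 1) * ((∑' P : J, (P.1.nn : ℝ)⁻¹) * (3 / 2 * c / (s - 1))) :=
          mul_le_mul_of_nonneg_left h5 hs0.le
      _ = (∑' P : J, (P.1.nn : ℝ)⁻¹) * (3 / 2 * c) := by field_simp
      _ ≤ _ := mul_le_mul_of_nonneg_right hJt.le (by linarith)
  linarith

end QuadLat

/-! ### Lower bounds for the norm series -/

namespace QuadLat

variable {D : ℕ} [hD : NegDisc D]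
open QuadLat.Lat

lemma dser_ind_eq (A : Set ℕ) (s : ℝ) : dser (ind A) s = ∑' n : A, (n.1 : ℝ) ^ (-s) := by
  rw [tsum_subtype A fun n : ℕ => (n : ℝ) ^ (-s)]
  refine tsum_congr fun n => ?_
  unfold ind
  by_cases h : n ∈ A <;> simp [h]

lemma dser_ind_summable (A : Set ℕ) {s : ℝ} (hs : 1 < s) :
    Summable fun n : A => (n.1 : ℝ) ^ (-s) :=
  (Real.summable_nat_rpow.2 (by linarith)).comp_injective Subtype.val_injective

lemma sum_tsum_clsInt_le (h3 : 3 < D) [Fintype (Cl D)] {s : ℝ} (hs : 1 < s) :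
    ∑ C : Cl D, ∑' a : clsInt C, (a.1.nn : ℝ) ^ (-s) ≤ normSer D s ^ 2 := by
  have hex : ∀ y : Σ C : Cl D, clsInt C, ∃ m n : ℕ, m ≠ 0 ∧ n ≠ 0 ∧
      y.2.1 = atoms D m * (atoms D n).conj ∧ atomsNorm D m ∈ normSet D ∧
      atomsNorm D n ∈ normSet D ∧ y.2.1.nn = atomsNorm D m * atomsNorm D n := by
    intro y
    obtain ⟨m, n, hm, hn, h⟩ := exists_eq_atoms_mul y.2.2.1 y.2.2.2.2
    obtain ⟨h1, h2⟩ := atoms_isInt_and_nn (D := D) m hm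
    obtain ⟨h4, h5⟩ := atoms_isInt_and_nn (D := D) n hn
    have h6 : y.2.1.nn = atomsNorm D m * atomsNorm D n := by
      rw [h, h1.nn_mul h4.conj, nn_conj, h2, h5]
    have h7 := y.2.2.2.2
    rw [h6] at h7
    exact ⟨m, n, hm, hn, h, ⟨h7.coprime_mul_right, _, _, h1, h2, rfl⟩,
      ⟨h7.coprime_mul_left, _, _, h4, h5, rfl⟩, h6⟩
  choose m n hm hn hmn hmA hnA hnn using hex
  have hinj : Function.Injective fun y : Σ C : Cl D, clsInt C =>
      ((⟨atomsNorm D (m y), hmA y⟩, ⟨atomsNorm D (n y), hnA y⟩) : normSet D × normSet D) := by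
    intro y z h
    rw [Prod.mk.injEq, Subtype.mk.injEq, Subtype.mk.injEq] at h
    have h1 := atomsNorm_injOn (hm y) (hm z) h.1
    have h2 := atomsNorm_injOn (hn y) (hn z) h.2
    have h4 : y.2.1 = z.2.1 := by rw [hmn y, hmn z, h1, h2]
    obtain ⟨C, a, ha, rfl, hc⟩ := y
    obtain ⟨E, b, hb, rfl, hd⟩ := z
    change a = b at h4
    subst h4
    rfl
  have hA := dser_ind_summable (normSet D) hs
  have hAA := hA.mul_of_nonneg hA (fun n => Real.rpow_nonneg (Nat.cast_nonneg _) _)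
    (fun n => Real.rpow_nonneg (Nat.cast_nonneg _) _)
  have hF : ∀ y : Σ C : Cl D, clsInt C, (y.2.1.nn : ℝ) ^ (-s) =
      (atomsNorm D (m y) : ℝ) ^ (-s) * (atomsNorm D (n y) : ℝ) ^ (-s) := by
    intro y
    rw [hnn y, Nat.cast_mul, Real.mul_rpow (Nat.cast_nonneg _) (Nat.cast_nonneg _)]
  have hS : Summable fun y : Σ C : Cl D, clsInt C => (y.2.1.nn : ℝ) ^ (-s) :=
    (hAA.comp_injective hinj).congr fun y => (hF y).symm
  have h1 := hS.tsum_sigma' fun C => (tendsto_clsInt h3 C).1 s hs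
  have h2 := tsum_fintype (L := .unconditional _)
    fun C : Cl D => ∑' a : clsInt C, (a.1.nn : ℝ) ^ (-s)
  have h4 := tsum_comp_le_tsum_of_inj (f := fun y : normSet D × normSet D =>
      (y.1.1 : ℝ) ^ (-s) * (y.2.1 : ℝ) ^ (-s)) hAA
    (fun y => mul_nonneg (Real.rpow_nonneg (Nat.cast_nonneg _) _)
      (Real.rpow_nonneg (Nat.cast_nonneg _) _)) hinj
  have h5 := hA.tsum_mul_tsum hA hAA
  have h6 := tsum_congr (L := .unconditional _) hF
  rw [normSer, dser_ind_eq, pow_two, h5, ← h2]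
  exact (h1.symm.trans h6).trans_le h4

/-- Lower bound for the Dirichlet series of norms near `1`. -/
lemma normSer_sq_ge (h3 : 3 < D) {c : ℝ} (hc : c < Nat.card (Cl D) * rho D) :
    ∀ᶠ s in nhdsWithin (1 : ℝ) (Set.Ioi 1), c ≤ (s - 1) * normSer D s ^ 2 := by
  have := Fintype.ofFinite (Cl D)
  have h1 := tendsto_finsetSum (Finset.univ : Finset (Cl D)) fun C _ => (tendsto_clsInt h3 C).2
  rw [Finset.sum_const, nsmul_eq_mul, Finset.card_univ, ← Nat.card_eq_fintype_card] at h1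
  filter_upwards [h1.eventually (lt_mem_nhds hc), self_mem_nhdsWithin] with s hs hs1
  rw [← Finset.mul_sum] at hs
  exact hs.le.trans (mul_le_mul_of_nonneg_left (sum_tsum_clsInt_le h3 hs1) (sub_pos.2 hs1).le)

/-- Numbers represented by the class `C` whose prime divisors dividing `D` lie in `R`. -/
def boostSet (R : Finset ℕ) (C : Cl D) : Set ℕ :=
  {n | C ∈ Rep D n ∧ ∀ p, p.Prime → p ∣ n → p ∣ D → p ∈ R}

lemma dser_boostSet_insert {R : Finset ℕ} {p : ℕ} (hp : p.Prime) (hpD : p ∣ D) (hpR : p ∉ R)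
    {E : Cl D} (hE : E ∈ Rep D p) (C : Cl D) {s : ℝ} (hs : 1 < s) :
    dser (ind (boostSet R C)) s + (p : ℝ) ^ (-s) * dser (ind (boostSet (insert p R) (C * E⁻¹))) s ≤
      dser (ind (boostSet (insert p R) C)) s := by
  classical
  have hb : ∀ n, |if p ∣ n then ind (boostSet (insert p R) (C * E⁻¹)) (n / p) else 0| ≤ 1 := by
    intro n
    split_ifs
    · exact abs_ind_le _ _
    · norm_num
  rw [← dser_shift _ hp.ne_zero, ← dser_add (abs_ind_le _) hb hs]
  refine dser_mono (K := 2) (fun n => (abs_add_le _ _).trans ?_) (abs_ind_le _) (fun n hn => ?_) hs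
  · linarith [hb n, abs_ind_le (boostSet R C) n]
  by_cases hpn : p ∣ n
  · obtain ⟨k, rfl⟩ := hpn
    rw [if_pos (dvd_mul_right _ _), Nat.mul_div_cancel_left _ hp.pos]
    have h1 : p * k ∉ boostSet R C := fun h => hpR (h.2 p hp (dvd_mul_right _ _) hpD)
    unfold ind
    rw [if_neg h1, zero_add]
    by_cases h2 : k ∈ boostSet (insert p R) (C * E⁻¹)
    · rw [if_pos h2, if_pos]
      refine ⟨?_, fun q hq hqn hqD => ?_⟩
      · have := rep_mul hE h2.1
        rwa [mul_comm E, inv_mul_cancel_right] at this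
      · rcases (hq.dvd_mul).1 hqn with h | h
        · rw [(Nat.prime_dvd_prime_iff_eq hq hp).1 h]; exact Finset.mem_insert_self _ _
        · exact h2.2 q hq h hqD
    · rw [if_neg h2]; split_ifs <;> norm_num
  · rw [if_neg hpn, add_zero]
    unfold ind
    by_cases h2 : n ∈ boostSet R C
    · rw [if_pos h2, if_pos]
      exact ⟨h2.1, fun q hq hqn hqD => Finset.mem_insert_of_mem (h2.2 q hq hqn hqD)⟩
    · rw [if_neg h2]; split_ifs <;> norm_num

lemma boostSet_ge (h3 : 3 < D) {R : Finset ℕ} (hR : R ⊆ boost D) {c : ℝ}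
    (hc : c < (∏ p ∈ R, (1 - (p : ℝ)⁻¹)⁻¹) / Nat.card (Gen D)) :
    ∀ᶠ s in nhdsWithin (1 : ℝ) (Set.Ioi 1), ∀ C : Cl D,
      c * normSer D s ≤ dser (ind (boostSet R C)) s := by
  classical
  induction R using Finset.induction_on generalizing c with
  | empty =>
    rw [Finset.prod_empty] at hc
    refine eventually_all.2 fun C => ?_
    filter_upwards [repSet_ge (closure_richCls h3) C (sub_pos.2 hc), self_mem_nhdsWithin]
      with s hs hs1
    rw [sub_sub_cancel] at hs
    refine hs.trans (dser_mono (abs_ind_le _) (abs_ind_le _) (fun n _ => ?_) hs1)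
    unfold ind
    by_cases h : n ∈ repSet C
    · rw [if_pos h, if_pos]
      exact ⟨h.2, fun p hp hpn hpD => absurd hpD (not_dvd_of_coprime hp hpn h.1.1)⟩
    · rw [if_neg h]; split_ifs <;> norm_num
  | insert p R hpR ih =>
    obtain ⟨⟨hp, hpD⟩, -⟩ := mem_boost.1 (hR (Finset.mem_insert_self _ _))
    obtain ⟨E, hE⟩ := exists_mem_Rep_of_mem_boost (hR (Finset.mem_insert_self _ _))
    have hp1 : 0 < 1 - (p : ℝ)⁻¹ :=
      sub_pos.2 (inv_lt_one_of_one_lt₀ (by exact_mod_cast hp.one_lt))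
    rw [Finset.prod_insert hpR, mul_div_assoc, inv_mul_eq_div, lt_div_iff₀ hp1] at hc
    obtain ⟨d, hd1, hd2⟩ := exists_between hc
    have hlim : Tendsto (fun s : ℝ => c * (1 - (p : ℝ) ^ (-s))) (nhdsWithin 1 (Set.Ioi 1))
        (nhds (c * (1 - (p : ℝ)⁻¹))) := by
      have h2 : (p : ℝ) ≠ 0 := by exact_mod_cast hp.ne_zero
      have h4 := ((Real.continuousAt_const_rpow h2).comp
        (x := (1 : ℝ)) continuousAt_neg).tendsto
      simp only [Function.comp, Real.rpow_neg_one] at h4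
      exact ((h4.mono_left nhdsWithin_le_nhds).const_sub 1).const_mul c
    filter_upwards [ih (fun q hq => hR (Finset.mem_insert_of_mem hq)) hd2,
      hlim.eventually (gt_mem_nhds hd1), self_mem_nhdsWithin] with s hs hs2 hs1 C
    obtain ⟨C₀, hC₀⟩ := Finite.exists_min fun C : Cl D => dser (ind (boostSet (insert p R) C)) s
    refine le_trans ?_ (hC₀ C)
    have h5 := dser_boostSet_insert hp hpD hpR hE C₀ hs1
    have hps : (p : ℝ) ^ (-s) < 1 :=
      Real.rpow_lt_one_of_one_lt_of_neg (by exact_mod_cast hp.one_lt) (by linarith [hs1.out])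
    have hps0 : 0 ≤ (p : ℝ) ^ (-s) := Real.rpow_nonneg (Nat.cast_nonneg _) _
    have h6 := mul_le_mul_of_nonneg_left (hC₀ (C₀ * E⁻¹)) hps0
    have hT : 0 ≤ normSer D s := dser_nonneg (ind_nonneg _) s
    have h7 := hs C₀
    have h8 := mul_le_mul_of_nonneg_right hs2.le hT
    refine le_of_mul_le_mul_right ?_ (sub_pos.2 hps)
    nlinarith

end QuadLat

/-! ### From counting functions to Dirichlet series -/

namespace QuadLat

/-- The number of elements of `S` in `[1, t]`. -/
noncomputable def countUpTo (S : Set ℕ) (t : ℝ) : ℝ := ∑ k ∈ Finset.Icc 1 ⌊t⌋₊, ind S k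

lemma countUpTo_nonneg (S : Set ℕ) (t : ℝ) : 0 ≤ countUpTo S t :=
  Finset.sum_nonneg fun k _ => ind_nonneg S k

lemma countUpTo_le (S : Set ℕ) {t : ℝ} (ht : 0 ≤ t) : countUpTo S t ≤ t := by
  have h1 : countUpTo S t ≤ ∑ k ∈ Finset.Icc 1 ⌊t⌋₊, (1 : ℝ) :=
    Finset.sum_le_sum fun k _ => (le_abs_self _).trans (abs_ind_le S k)
  rw [Finset.sum_const, Nat.card_Icc, nsmul_eq_mul, mul_one, Nat.add_sub_cancel] at h1
  exact h1.trans (Nat.floor_le ht)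

lemma dser_ind_eq_integral (S : Set ℕ) {s : ℝ} (hs : 1 < s) :
    dser (ind S) s = s * ∫ t in Set.Ioi (1 : ℝ), countUpTo S t * t ^ (-(s + 1)) := by
  have h := LSeries_eq_mul_integral_of_nonneg (ind S) (r := 1) (s := (s : ℂ)) zero_le_one
    (by simpa using hs) ?_ (ind_nonneg S)
  · apply Complex.ofReal_injective
    have h1 : LSeries (fun n => ((ind S n : ℝ) : ℂ)) s = (dser (ind S) s : ℂ) := by
      unfold dser LSeries
      rw [Complex.ofReal_tsum]
      refine tsum_congr fun n => ?_
      rw [LSeries.term_def]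
      split_ifs with hn
      · rw [hn, Nat.cast_zero, Real.zero_rpow (by linarith), mul_zero, Complex.ofReal_zero]
      · rw [Complex.ofReal_mul, Complex.ofReal_cpow (Nat.cast_nonneg _), Complex.ofReal_natCast,
          Complex.ofReal_neg, Complex.cpow_neg, div_eq_mul_inv]
    rw [← h1, h, Complex.ofReal_mul, ← integral_complex_ofReal]
    congr 1
    refine MeasureTheory.setIntegral_congr_fun measurableSet_Ioi fun t ht => ?_
    have ht0 : (0 : ℝ) ≤ t := by linarith [ht.out]
    change _ = (((countUpTo S t * t ^ (-(s + 1)) : ℝ)) : ℂ)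
    rw [Complex.ofReal_mul, Complex.ofReal_cpow ht0, countUpTo]
    push_cast
    rfl
  · refine Asymptotics.IsBigO.of_bound 1 (Eventually.of_forall fun n => ?_)
    have h1 := countUpTo_le S (Nat.cast_nonneg n)
    have h2 := countUpTo_nonneg S n
    rw [countUpTo, Nat.floor_natCast] at h1 h2
    rw [Real.rpow_one, one_mul, Real.norm_of_nonneg h2, Real.norm_of_nonneg (Nat.cast_nonneg _)]
    exact h1

lemma dser_ind_le_of_count_le {S : Set ℕ} {F K : ℝ}
    (hF : ∀ t, 1 < t → countUpTo S t ≤ F * (t / √(Real.log t)) + K) {s : ℝ} (hs : 1 < s) :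
    dser (ind S) s ≤ K + s * F * (√π / √(s - 1)) := by
  have hs0 : 0 < s - 1 := by linarith
  have hsub : ∫ t in Set.Ioi (1 : ℝ), countUpTo S t * t ^ (-(s + 1)) =
      ∫ u in Set.Ioi (0 : ℝ), rexp u * (countUpTo S (rexp u) * (rexp u) ^ (-(s + 1))) := by
    have h1 := MeasureTheory.integral_image_eq_integral_abs_deriv_smul (f := rexp) (f' := rexp)
      (measurableSet_Ioi (a := (0 : ℝ))) (fun x _ => (Real.hasDerivAt_exp x).hasDerivWithinAt)
      Real.exp_injective.injOn fun t => countUpTo S t * t ^ (-(s + 1))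
    rw [Real.image_exp_Ioi, Real.exp_zero] at h1
    rw [h1]
    refine MeasureTheory.setIntegral_congr_fun measurableSet_Ioi fun t _ => ?_
    simp only [smul_eq_mul, abs_of_pos (Real.exp_pos t)]
  have hint1 : MeasureTheory.IntegrableOn (fun u : ℝ => u ^ (-(1 / 2) : ℝ) * rexp (-((s - 1) * u)))
      (Set.Ioi 0) := by
    have := integrableOn_rpow_mul_exp_neg_mul_rpow (p := 1) (s := -(1 / 2)) (b := s - 1)
      (by norm_num) one_pos hs0
    simpa only [Real.rpow_one, neg_mul] using this
  have hint2 : MeasureTheory.IntegrableOn (fun u : ℝ => rexp (-s * u)) (Set.Ioi 0) :=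
    exp_neg_integrableOn_Ioi 0 (by linarith)
  have hval1 : ∫ u in Set.Ioi (0 : ℝ), u ^ (-(1 / 2) : ℝ) * rexp (-((s - 1) * u)) =
      √π / √(s - 1) := by
    have := Real.integral_rpow_mul_exp_neg_mul_Ioi (a := 1 / 2) (r := s - 1) (by norm_num) hs0
    rw [show (1 / 2 - 1 : ℝ) = -(1 / 2) by norm_num] at this
    rw [this, Real.Gamma_one_half_eq, ← Real.sqrt_eq_rpow, Real.sqrt_div zero_le_one,
      Real.sqrt_one]
    ring
  have hval2 : ∫ u in Set.Ioi (0 : ℝ), rexp (-s * u) = 1 / s := by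
    rw [integral_exp_mul_Ioi (by linarith) 0]
    rw [mul_zero, Real.exp_zero, neg_div_neg_eq]
  have hle : ∫ t in Set.Ioi (1 : ℝ), countUpTo S t * t ^ (-(s + 1)) ≤
      F * (√π / √(s - 1)) + K * (1 / s) := by
    rw [hsub, ← hval1, ← hval2, ← MeasureTheory.integral_const_mul,
      ← MeasureTheory.integral_const_mul, ← MeasureTheory.integral_add (hint1.const_mul F)
      (hint2.const_mul K)]
    refine MeasureTheory.integral_mono_of_nonneg (Eventually.of_forall fun u => ?_)
      ((hint1.const_mul F).add (hint2.const_mul K)) ?_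
    · exact mul_nonneg (Real.exp_pos u).le (mul_nonneg (countUpTo_nonneg _ _)
        (Real.rpow_nonneg (Real.exp_pos u).le _))
    · refine (MeasureTheory.ae_restrict_mem measurableSet_Ioi).mono fun u hu => ?_
      have hu0 : 0 < u := hu
      have h1 := hF (rexp u) (Real.one_lt_exp_iff.2 hu0)
      rw [Real.log_exp] at h1
      have h2 : rexp u * (rexp u) ^ (-(s + 1)) = rexp (-s * u) := by
        rw [← Real.exp_mul, ← Real.exp_add]; congr 1; ring
      have h4 : rexp u / √u * rexp (-s * u) = u ^ (-(1 / 2) : ℝ) * rexp (-((s - 1) * u)) := by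
        rw [Real.rpow_neg hu0.le, ← Real.sqrt_eq_rpow, div_eq_inv_mul, mul_assoc, ← Real.exp_add]
        congr 2; ring
      have h5 := mul_le_mul_of_nonneg_right h1 (Real.exp_pos (-s * u)).le
      calc rexp u * (countUpTo S (rexp u) * (rexp u) ^ (-(s + 1)))
          = countUpTo S (rexp u) * rexp (-s * u) := by rw [← h2]; ring
        _ ≤ (F * (rexp u / √u) + K) * rexp (-s * u) := h5
        _ = _ := by rw [add_mul, mul_assoc, h4]
  rw [dser_ind_eq_integral S hs]
  refine (mul_le_mul_of_nonneg_left hle (by linarith)).trans (le_of_eq ?_)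
  have : s ≠ 0 := by linarith
  field_simp
  ring

/-- An Abelian theorem: comparison of the count of `S` and its Dirichlet series. -/
lemma le_of_tendsto_count {S : Set ℕ} {F e : ℝ}
    (hF : Tendsto (fun t : ℝ => countUpTo S t * √(Real.log t) / t) atTop (nhds F))
    (he : ∀ᶠ s in nhdsWithin (1 : ℝ) (Set.Ioi 1), e ≤ (s - 1) * dser (ind S) s ^ 2) :
    e ≤ π * F ^ 2 := by
  have hF0 : 0 ≤ F := ge_of_tendsto hF ((eventually_gt_atTop 0).mono fun t ht =>
    div_nonneg (mul_nonneg (countUpTo_nonneg _ _) (Real.sqrt_nonneg _)) ht.le)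
  have key : ∀ G, F < G → e ≤ π * G ^ 2 := by
    intro G hG
    have hG0 : 0 < G := hF0.trans_lt hG
    obtain ⟨t₀, ht₀⟩ := eventually_atTop.1 (hF.eventually (gt_mem_nhds hG))
    set K := max t₀ 1 with hK
    have hK1 : 1 ≤ K := le_max_right _ _
    have hb : ∀ t, 1 < t → countUpTo S t ≤ G * (t / √(Real.log t)) + K := by
      intro t ht
      have hlog : 0 < √(Real.log t) := Real.sqrt_pos.2 (Real.log_pos ht)
      have ht0 : 0 < t := by linarith
      rcases le_total t K with h | h
      · have := countUpTo_le S ht0.le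
        have h2 : 0 ≤ G * (t / √(Real.log t)) := by positivity
        linarith
      · have h1 := ht₀ t ((le_max_left _ _).trans h)
        rw [div_lt_iff₀ ht0, ← lt_div_iff₀ hlog, mul_div_assoc] at h1
        linarith
    have hlim : Tendsto (fun s : ℝ => (K * √(s - 1) + s * G * √π) ^ 2)
        (nhdsWithin 1 (Set.Ioi 1)) (nhds ((K * √((1 : ℝ) - 1) + 1 * G * √π) ^ 2)) :=
      (Continuous.tendsto (by fun_prop) 1).mono_left nhdsWithin_le_nhds
    rw [sub_self, Real.sqrt_zero, mul_zero, zero_add, one_mul, mul_pow, Real.sq_sqrt pi_pos.le,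
      mul_comm] at hlim
    refine ge_of_tendsto hlim ?_
    filter_upwards [he, self_mem_nhdsWithin] with s hs hs1
    have hs0 : 0 < s - 1 := sub_pos.2 hs1
    refine hs.trans ?_
    have h1 := dser_ind_le_of_count_le hb hs1
    have h2 := dser_nonneg (ind_nonneg S) s
    have h4 : 0 < √(s - 1) := Real.sqrt_pos.2 hs0
    calc (s - 1) * dser (ind S) s ^ 2 = (√(s - 1) * dser (ind S) s) ^ 2 := by
          rw [mul_pow, Real.sq_sqrt hs0.le]
      _ ≤ (√(s - 1) * (K + s * G * (√π / √(s - 1)))) ^ 2 := by gcongr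
      _ = _ := by congr 1; field_simp
  have hlim : Tendsto (fun G : ℝ => π * G ^ 2) (nhdsWithin F (Set.Ioi F)) (nhds (π * F ^ 2)) :=
    (Continuous.tendsto (by fun_prop) F).mono_left nhdsWithin_le_nhds
  exact ge_of_tendsto hlim (eventually_mem_nhdsWithin.mono fun G hG => key G hG)

end QuadLat

/-! ### The lower bound for the density constant of a class -/

namespace QuadLat

variable {D : ℕ} [hD : NegDisc D]
open QuadLat.Lat

/-- The numbers represented by the class `C`. -/
def repr (C : Cl D) : Set ℕ := {n | C ∈ Rep D n}

lemma card_Gen_bounds : 0 < Nat.card (Gen D) ∧ Nat.card (Gen D) ≤ Nat.card (Cl D) := by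
  have hs : Function.Surjective (toGen : Cl D → Gen D) := QuotientGroup.mk'_surjective _
  have : Finite (Gen D) := Finite.of_surjective _ hs
  exact ⟨Nat.card_pos, Nat.card_le_card_of_surjective _ hs⟩

lemma prod_boost_pos : 0 < ∏ p ∈ boost D, (1 - (p : ℝ)⁻¹)⁻¹ := by
  refine Finset.prod_pos fun p hp => inv_pos.2 (sub_pos.2 (inv_lt_one_of_one_lt₀ ?_))
  exact_mod_cast (mem_boost.1 hp).1.1.one_lt

lemma pi_mul_sq_ge (h3 : 3 < D) (C : Cl D) {F : ℝ}
    (hF : Tendsto (fun t : ℝ => countUpTo (repr C) t * √(Real.log t) / t) atTop (nhds F)) :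
    Nat.card (Cl D) * rho D * ((∏ p ∈ boost D, (1 - (p : ℝ)⁻¹)⁻¹) / Nat.card (Gen D)) ^ 2 ≤
      π * F ^ 2 := by
  have hg : (0 : ℝ) < Nat.card (Gen D) := by exact_mod_cast (card_Gen_bounds (D := D)).1
  have hh : (0 : ℝ) < Nat.card (Cl D) := by
    exact_mod_cast (card_Gen_bounds (D := D)).1.trans_le card_Gen_bounds.2
  have hX : 0 < (∏ p ∈ boost D, (1 - (p : ℝ)⁻¹)⁻¹) / Nat.card (Gen D) := div_pos prod_boost_pos hg
  have hY : 0 < Nat.card (Cl D) * rho D := mul_pos hh (rho_pos h3)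
  set X := (∏ p ∈ boost D, (1 - (p : ℝ)⁻¹)⁻¹) / Nat.card (Gen D) with hXd
  set Y := Nat.card (Cl D) * rho D with hYd
  have key : ∀ r : ℝ, 0 < r → r < 1 → (r * Y) * (r * X) ^ 2 ≤ π * F ^ 2 := by
    intro r hr0 hr1
    refine le_of_tendsto_count hF ?_
    filter_upwards [normSer_sq_ge h3 (c := r * Y) (mul_lt_of_lt_one_left hY hr1),
      boostSet_ge h3 (R := boost D) subset_rfl (c := r * X) (mul_lt_of_lt_one_left hX hr1),
      self_mem_nhdsWithin] with s hs1 hs2 hs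
    have hs0 : 0 < s - 1 := sub_pos.2 hs
    have hT : 0 ≤ normSer D s := dser_nonneg (ind_nonneg _) s
    have h4 : dser (ind (boostSet (boost D) C)) s ≤ dser (ind (repr C)) s := by
      refine dser_mono (abs_ind_le _) (abs_ind_le _) (fun n _ => ?_) hs
      unfold ind
      by_cases h : n ∈ boostSet (boost D) C
      · rw [if_pos h, if_pos]
        exact h.1
      · rw [if_neg h]; split_ifs <;> norm_num
    have h5 : (r * X * normSer D s) ^ 2 ≤ dser (ind (repr C)) s ^ 2 :=
      pow_le_pow_left₀ (by positivity) ((hs2 C).trans h4) 2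
    calc (r * Y) * (r * X) ^ 2 ≤ ((s - 1) * normSer D s ^ 2) * (r * X) ^ 2 :=
          mul_le_mul_of_nonneg_right hs1 (sq_nonneg _)
      _ = (s - 1) * (r * X * normSer D s) ^ 2 := by ring
      _ ≤ _ := mul_le_mul_of_nonneg_left h5 hs0.le
  have hlim : Tendsto (fun r : ℝ => (r * Y) * (r * X) ^ 2) (nhdsWithin 1 (Set.Iio 1))
      (nhds ((1 * Y) * (1 * X) ^ 2)) :=
    (Continuous.tendsto (by fun_prop) 1).mono_left nhdsWithin_le_nhds
  rw [one_mul, one_mul] at hlim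
  refine le_of_tendsto hlim ?_
  filter_upwards [self_mem_nhdsWithin, nhdsWithin_le_nhds (lt_mem_nhds one_pos)] with r h1 h2
  exact key r h2 h1

lemma sq_limit_ge (h3 : 3 < D) (C : Cl D) {F : ℝ}
    (hF : Tendsto (fun t : ℝ => countUpTo (repr C) t * √(Real.log t) / t) atTop (nhds F)) :
    √2 / 4 ≤ (F * (√D / 2)) ^ 2 := by
  have h1 := pi_mul_sq_ge h3 C hF
  obtain ⟨hg, hgh⟩ := card_Gen_bounds (D := D)
  obtain ⟨hw0, hw4, hw2⟩ := unitCard_bounds h3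
  have hD0 : (0 : ℝ) < D := by exact_mod_cast hD.pos
  have hphi : (0 : ℝ) < D.totient := by exact_mod_cast Nat.totient_pos.2 hD.pos
  set P := ∏ p ∈ boost D, (1 - (p : ℝ)⁻¹)⁻¹ with hP
  have hP0 : 0 < P := prod_boost_pos
  set g := Nat.card (Gen D) with hgd
  set h := Nat.card (Cl D) with hhd
  set w := unitCard D with hwd
  have hg' : (0 : ℝ) < g := by exact_mod_cast hg
  have hgh' : (g : ℝ) ≤ h := by exact_mod_cast hgh
  have hw' : (0 : ℝ) < w := by exact_mod_cast hw0
  have hsD : 0 < √(D : ℝ) := Real.sqrt_pos.2 hD0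
  have hsD2 : √(D : ℝ) ^ 2 = D := Real.sq_sqrt hD0.le
  have h2 : √D * (D.totient / D) * P ^ 2 / (2 * w * g) ≤ (F * (√D / 2)) ^ 2 := by
    have h4 : rho D = 2 * π / √D * (D.totient / D) / w := rfl
    rw [h4] at h1
    have h5 : (g : ℝ) * (2 / √D * (D.totient / D) / w) * (P / g) ^ 2 ≤ F ^ 2 := by
      refine le_of_mul_le_mul_left (le_trans ?_ h1) pi_pos
      calc π * ((g : ℝ) * (2 / √D * (D.totient / D) / w) * (P / g) ^ 2)
          = g * (2 * π / √D * (D.totient / D) / w) * (P / g) ^ 2 := by ring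
        _ ≤ _ := by gcongr
    calc √D * (D.totient / D) * P ^ 2 / (2 * w * g)
        = ((g : ℝ) * (2 / √D * (D.totient / D) / w) * (P / g) ^ 2) * (√D ^ 2 / 4) := by
          field_simp
          ring
      _ ≤ F ^ 2 * (√D ^ 2 / 4) := by gcongr
      _ = _ := by ring
  refine le_trans ?_ h2
  rw [le_div_iff₀ (by positivity)]
  by_cases hD4 : D = 4
  · have hsub := subsingleton_Cl_four hD4
    have hg1 : (g : ℝ) = 1 := by
      have : h ≤ 1 := Finite.card_le_one_iff_subsingleton.2 hsub
      exact_mod_cast le_antisymm (hgh.trans this) hg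
    have hP2 : 2 ≤ P := by
      have hmem : 2 ∈ boost D := by
        rw [mem_boost]
        exact ⟨⟨Nat.prime_two, by omega⟩, Or.inr ⟨rfl, by omega⟩⟩
      have h5 : ∀ p ∈ boost D, 1 ≤ (1 - (p : ℝ)⁻¹)⁻¹ := by
        intro p hp
        have hp1 : (1 : ℝ) < p := by exact_mod_cast (mem_boost.1 hp).1.1.one_lt
        refine (one_le_inv₀ (sub_pos.2 (inv_lt_one_of_one_lt₀ hp1))).2 ?_
        have : 0 < (p : ℝ)⁻¹ := by positivity
        linarith
      have h6 : ∏ p ∈ (boost D).erase 2, (1 : ℝ) ≤ ∏ p ∈ (boost D).erase 2, (1 - (p : ℝ)⁻¹)⁻¹ :=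
        Finset.prod_le_prod (fun _ _ => zero_le_one) fun p hp => h5 p (Finset.mem_of_mem_erase hp)
      rw [Finset.prod_const_one] at h6
      rw [hP, ← Finset.mul_prod_erase _ _ hmem,
        show (1 - ((2 : ℕ) : ℝ)⁻¹)⁻¹ = 2 by norm_num]
      linarith
    have hphi2 : (D.totient : ℝ) = 2 := by
      have : D.totient = 2 := by rw [hD4]; decide
      rw [this]; norm_num
    have hD4' : (D : ℝ) = 4 := by rw [hD4]; norm_num
    have hs4 : √(4 : ℝ) = 2 := by
      rw [show (4 : ℝ) = 2 ^ 2 by norm_num, Real.sqrt_sq (by norm_num)]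
    have hw4' : (w : ℝ) ≤ 4 := by exact_mod_cast hw4
    have hs2 : √2 ≤ 2 := by
      rw [Real.sqrt_le_left (by norm_num)]; norm_num
    have hs20 : 0 ≤ √2 := Real.sqrt_nonneg 2
    rw [hg1, hphi2, hD4', hs4]
    nlinarith
  · have h5 := sqrt_two_mul_card_Gen_le hD4
    have hw2' : (w : ℝ) ≤ 2 := by exact_mod_cast hw2 (by omega)
    calc √2 / 4 * (2 * w * g) = (w / 2) * (√2 * g) := by ring
      _ ≤ 1 * (√2 * g) := by gcongr; linarith
      _ ≤ _ := by rw [one_mul]; exact h5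

end QuadLat

/-! ### The numerical comparison -/

namespace QuadLat

lemma sum_inv_sq_le (N : ℕ) :
    ∑ k ∈ Finset.range N, (1 : ℝ) / (2 * (k : ℝ) + 5) ^ 2 ≤ 1 / 8 - 1 / (4 * (N : ℝ) + 8) := by
  induction N with
  | zero => norm_num
  | succ n ih =>
    rw [Finset.sum_range_succ]
    have h : (1 : ℝ) / (2 * (n : ℝ) + 5) ^ 2 ≤
      1 / (4 * (n : ℝ) + 8) - 1 / (4 * ((n : ℝ) + 1) + 8) := by
      rw [div_sub_div _ _ (by positivity) (by positivity), div_le_div_iff₀ (by positivity)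
        (by positivity)]
      ring_nf
      nlinarith [(Nat.cast_nonneg n : (0 : ℝ) ≤ n)]
    push_cast
    linarith

lemma one_sub_sum_le_prod {ι : Type*} (s : Finset ι) {f : ι → ℝ} (hf0 : ∀ i, 0 ≤ f i)
    (hf1 : ∀ i, f i ≤ 1) : 1 - ∑ i ∈ s, f i ≤ ∏ i ∈ s, (1 - f i) := by
  classical
  induction s using Finset.induction_on with
  | empty => simp
  | insert a s ha ih =>
    rw [Finset.sum_insert ha, Finset.prod_insert ha]
    have h1 : ∏ i ∈ s, (1 - f i) ≤ 1 :=
      Finset.prod_le_one (fun i _ => sub_nonneg.2 (hf1 i)) fun i _ => by linarith [hf0 i]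
    nlinarith [hf0 a, hf1 a]

lemma sum_inv_sq_prime_le (s : Finset {p : ℕ // p.Prime ∧ p % 3 = 2}) :
    ∑ p ∈ s, (1 : ℝ) / (p.1 : ℝ) ^ 2 ≤ 3 / 8 := by
  classical
  set t : Finset ℕ := s.image Subtype.val with ht
  have h1 : ∑ p ∈ s, (1 : ℝ) / (p.1 : ℝ) ^ 2 = ∑ n ∈ t, (1 : ℝ) / (n : ℝ) ^ 2 := by
    rw [ht, Finset.sum_image Subtype.val_injective.injOn]
  obtain ⟨N, hN⟩ : ∃ N, ∀ n ∈ t, n < N := ⟨t.sup id + 1, fun n hn =>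
    Nat.lt_succ_of_le (Finset.le_sup (f := id) hn)⟩
  have hsub : t ⊆ insert 2 ((Finset.range N).image fun k => 2 * k + 5) := by
    intro n hn
    have hnN := hN n hn
    obtain ⟨⟨p, hp, hp3⟩, -, rfl⟩ := Finset.mem_image.1 hn
    rw [Finset.mem_insert, Finset.mem_image]
    rcases hp.eq_two_or_odd with h | h
    · exact Or.inl h
    · have h2 := hp.two_le
      refine Or.inr ⟨(p - 5) / 2, Finset.mem_range.2 ?_, ?_⟩
      · have : p < N := hnN
        omega
      · change 2 * ((p - 5) / 2) + 5 = p
        omega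
  have hnot : (2 : ℕ) ∉ (Finset.range N).image fun k => 2 * k + 5 := by
    rw [Finset.mem_image]; rintro ⟨k, -, hk⟩; omega
  have h2 := Finset.sum_le_sum_of_subset_of_nonneg hsub (f := fun n : ℕ => (1 : ℝ) / (n : ℝ) ^ 2)
    fun n _ _ => by positivity
  have himg : ∑ n ∈ (Finset.range N).image (fun k : ℕ => (2 * k + 5 : ℕ)),
    (1 : ℝ) / ((n : ℕ) : ℝ) ^ 2 =
      ∑ k ∈ Finset.range N, (1 : ℝ) / (2 * (k : ℝ) + 5) ^ 2 := by
    rw [Finset.sum_image fun a _ b _ h => by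
      have : 2 * a + 5 = 2 * b + 5 := h
      omega]
    exact Finset.sum_congr rfl fun k _ => by push_cast; rfl
  rw [Finset.sum_insert hnot, himg] at h2
  push_cast at h2
  have h3 := sum_inv_sq_le N
  have h4 : (0 : ℝ) ≤ 1 / (4 * (N : ℝ) + 8) := by positivity
  rw [h1]
  linarith

lemma tprod_le : ∏' p : {p : ℕ // p.Prime ∧ p % 3 = 2},
    (1 - (p.1 : ℝ) ^ (-(2 : ℝ))) ^ (-(1 : ℝ) / 2) ≤ √(8 / 5) := by
  refine tprod_le_of_prod_le' (Real.one_le_sqrt.2 (by norm_num)) fun s => ?_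
  have hp1 : ∀ p : {p : ℕ // p.Prime ∧ p % 3 = 2}, (1 : ℝ) / (p.1 : ℝ) ^ 2 < 1 := by
    intro p
    have : (1 : ℝ) < p.1 := by exact_mod_cast p.2.1.one_lt
    rw [div_lt_one (by positivity)]
    exact one_lt_pow₀ this two_ne_zero
  have heq : ∀ p : {p : ℕ // p.Prime ∧ p % 3 = 2},
      (1 - (p.1 : ℝ) ^ (-(2 : ℝ))) ^ (-(1 : ℝ) / 2) = √((1 - (1 : ℝ) / (p.1 : ℝ) ^ 2)⁻¹) := by
    intro p
    have h0 := sub_pos.2 (hp1 p)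
    rw [Real.rpow_neg (Nat.cast_nonneg _), Real.rpow_two, ← one_div, neg_div,
      Real.rpow_neg h0.le, ← Real.sqrt_eq_rpow, Real.sqrt_inv]
  rw [Finset.prod_congr rfl fun p _ => heq p, ← Real.sqrt_prod _ fun p _ =>
    inv_nonneg.2 (sub_pos.2 (hp1 p)).le, Finset.prod_inv_distrib]
  refine Real.sqrt_le_sqrt ?_
  have h1 := one_sub_sum_le_prod s (f := fun p => (1 : ℝ) / (p.1 : ℝ) ^ 2)
    (fun p => by positivity) fun p => (hp1 p).le
  have h2 := sum_inv_sq_prime_le s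
  have h3 : (5 : ℝ) / 8 ≤ ∏ p ∈ s, (1 - (1 : ℝ) / (p.1 : ℝ) ^ 2) := by linarith
  rw [show (8 : ℝ) / 5 = (5 / 8)⁻¹ by norm_num]
  exact inv_anti₀ (by norm_num) h3

lemma hexErdos_lt_of_sq_ge {F : ℝ} (hF : 0 ≤ F) (h : √2 / 4 ≤ F ^ 2) : hexErdos < F := by
  have h2 : (0 : ℝ) ≤ 2 ^ (-(3 : ℝ) / 2) * 3 ^ ((1 : ℝ) / 4) := by positivity
  have h1 : hexErdos ≤ 2 ^ (-(3 : ℝ) / 2) * 3 ^ ((1 : ℝ) / 4) * √(8 / 5) :=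
    mul_le_mul_of_nonneg_left tprod_le h2
  refine h1.trans_lt (lt_of_pow_lt_pow_left₀ 2 hF (lt_of_lt_of_le ?_ h))
  have h3 : ((2 : ℝ) ^ (-(3 : ℝ) / 2)) ^ 2 = 1 / 8 := by
    rw [← Real.rpow_natCast, ← Real.rpow_mul (by norm_num)]
    norm_num
  have h4 : ((3 : ℝ) ^ ((1 : ℝ) / 4)) ^ 2 = √3 := by
    rw [← Real.rpow_natCast, ← Real.rpow_mul (by norm_num), Real.sqrt_eq_rpow]
    norm_num
  rw [mul_pow, mul_pow, h3, h4, Real.sq_sqrt (by norm_num)]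
  have h5 : √3 * (4 / 5) < √2 := by
    refine Real.lt_sqrt_of_sq_lt ?_
    rw [mul_pow, Real.sq_sqrt (by norm_num)]
    norm_num
  linarith

end QuadLat

/-! ### Values of positive definite binary forms -/

namespace QuadLat

/-- The positive values up to `x` of the real binary quadratic form `a X² + b X Y + c Y²`. -/
def valSet (a b c x : ℝ) : Set ℝ :=
  {r | 0 < r ∧ r ≤ x ∧ ∃ m n : ℤ, a * m ^ 2 + b * m * n + c * n ^ 2 = r}

lemma norm_sq_eq_gram (v₁ v₂ : EuclideanSpace ℝ (Fin 2)) (m n : ℤ) :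
    ‖m • v₁ + n • v₂‖ ^ 2 = (v₁ 0 ^ 2 + v₁ 1 ^ 2) * m ^ 2 +
      2 * (v₁ 0 * v₂ 0 + v₁ 1 * v₂ 1) * m * n + (v₂ 0 ^ 2 + v₂ 1 ^ 2) * n ^ 2 := by
  rw [EuclideanSpace.norm_sq_eq, Fin.sum_univ_two]
  simp only [PiLp.add_apply, PiLp.smul_apply, zsmul_eq_mul, Real.norm_eq_abs, sq_abs]
  ring

lemma NL_latticeOf (v₁ v₂ : EuclideanSpace ℝ (Fin 2)) (x : ℝ) :
    NL (latticeOf v₁ v₂) x = (valSet (v₁ 0 ^ 2 + v₁ 1 ^ 2) (2 * (v₁ 0 * v₂ 0 + v₁ 1 * v₂ 1))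
      (v₂ 0 ^ 2 + v₂ 1 ^ 2) x).ncard := by
  unfold NL valSet
  congr 1
  ext r
  simp only [Set.mem_ofPred_eq]
  refine and_congr_right fun _ => and_congr_right fun _ => ?_
  constructor
  · rintro ⟨_, ⟨m, n, rfl⟩, h⟩
    exact ⟨m, n, by rw [← h, norm_sq_eq_gram]⟩
  · rintro ⟨m, n, h⟩
    exact ⟨_, ⟨m, n, rfl⟩, by rw [norm_sq_eq_gram, h]⟩

section Gram
variable {a b c : ℝ}

lemma gram_nonneg (hd : b ^ 2 + 4 = 4 * a * c) (u v : ℝ) :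
    v ^ 2 ≤ a * (a * u ^ 2 + b * u * v + c * v ^ 2) := by
  nlinarith [sq_nonneg (2 * a * u + b * v)]

lemma c_pos_of_gram (ha : 0 < a) (hd : b ^ 2 + 4 = 4 * a * c) : 0 < c := by
  by_contra! h
  nlinarith [sq_nonneg b]

lemma gram_pos (ha : 0 < a) (hd : b ^ 2 + 4 = 4 * a * c) {m n : ℤ} (h : m ≠ 0) :
    0 < a * (m : ℝ) ^ 2 + b * m * n + c * n ^ 2 := by
  have hc := c_pos_of_gram ha hd
  have h1 := gram_nonneg (a := c) (b := b) (c := a) (by linarith) (n : ℝ) (m : ℝ)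
  have h2 : (m : ℝ) ≠ 0 := by exact_mod_cast h
  have h3 : 0 < (m : ℝ) ^ 2 := by positivity
  have h4 : 0 < c * (c * (n : ℝ) ^ 2 + b * n * m + a * m ^ 2) := h3.trans_le h1
  have := pos_of_mul_pos_right h4 hc.le
  linarith

lemma finite_valSet (ha : 0 < a) (hd : b ^ 2 + 4 = 4 * a * c) (x : ℝ) :
    (valSet a b c x).Finite := by
  have hc := c_pos_of_gram ha hd
  obtain ⟨M, hM⟩ := exists_nat_gt ((a + c) * x)
  refine (((Finset.Icc (-M : ℤ) M ×ˢ Finset.Icc (-M : ℤ) M).image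
    fun p : ℤ × ℤ => a * (p.1 : ℝ) ^ 2 + b * p.1 * p.2 + c * p.2 ^ 2).finite_toSet).subset ?_
  rintro r ⟨hr, hrx, m, n, h⟩
  have h1 := gram_nonneg hd m n
  have h2 := gram_nonneg (a := c) (b := b) (c := a) (by linarith) (n : ℝ) (m : ℝ)
  have hx : 0 < x := hr.trans_le hrx
  have key : ∀ k : ℤ, (k : ℝ) ^ 2 ≤ (a + c) * x → k ∈ Finset.Icc (-M : ℤ) M := by
    intro k hk
    have h3 : k ^ 2 < (M : ℤ) := by exact_mod_cast hk.trans_lt hM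
    rw [Finset.mem_Icc]
    constructor <;> nlinarith
  refine Finset.mem_coe.2 (Finset.mem_image.2 ⟨(m, n),
    Finset.mem_product.2 ⟨key m ?_, key n ?_⟩, h⟩)
  · calc (m : ℝ) ^ 2 ≤ c * (c * (n : ℝ) ^ 2 + b * n * m + a * m ^ 2) := h2
      _ = c * r := by rw [← h]; ring
      _ ≤ _ := by nlinarith
  · calc (n : ℝ) ^ 2 ≤ _ := h1
      _ = a * r := by rw [← h]
      _ ≤ _ := by nlinarith

/-- The form is proportional to an integral form. -/
def IsRat (a b c : ℝ) : Prop := ∃ (t : ℝ) (A B C : ℤ), a = t * A ∧ b = t * B ∧ c = t * C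

lemma eq_of_proportional {r : ℝ} (hr : r ≠ 0) {m n m' n' : ℤ} (hm : 0 < m) (hm' : 0 < m')
    (h : a * (m : ℝ) ^ 2 + b * m * n + c * n ^ 2 = r)
    (h' : a * (m' : ℝ) ^ 2 + b * m' * n' + c * n' ^ 2 = r) (hp : m * n' - m' * n = 0) :
    (m, n) = (m', n') := by
  have hpR : (m : ℝ) * n' = m' * n := by
    have : m * n' = m' * n := by linarith
    exact_mod_cast this
  have h1 : r * ((m' : ℝ) ^ 2 - m ^ 2) = 0 := by
    have h2 : (m' : ℝ) ^ 2 * r = (m : ℝ) ^ 2 * r := by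
      calc (m' : ℝ) ^ 2 * r = a * m ^ 2 * m' ^ 2 + b * m * m' * (m' * n) + c * (m' * n) ^ 2 := by
            rw [← h]; ring
        _ = (m : ℝ) ^ 2 * r := by rw [← hpR, ← h']; ring
    linarith
  have h3 : (m' : ℝ) ^ 2 = m ^ 2 := by
    rcases mul_eq_zero.1 h1 with h | h
    · exact absurd h hr
    · linarith
  have h4 : m' = m := by
    have h5 : m' ^ 2 = m ^ 2 := by exact_mod_cast h3
    nlinarith
  subst h4
  have : n' = n := mul_left_cancel₀ hm.ne' (by linarith)
  rw [this]

lemma isRat_of_three {r : ℝ} (hr : r ≠ 0) {m₀ n₀ m₁ n₁ m₂ n₂ : ℤ} (hm₀ : 0 < m₀) (hm₁ : 0 < m₁)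
    (hm₂ : 0 < m₂) (h₀ : a * (m₀ : ℝ) ^ 2 + b * m₀ * n₀ + c * n₀ ^ 2 = r)
    (h₁ : a * (m₁ : ℝ) ^ 2 + b * m₁ * n₁ + c * n₁ ^ 2 = r)
    (h₂ : a * (m₂ : ℝ) ^ 2 + b * m₂ * n₂ + c * n₂ ^ 2 = r)
    (h01 : (m₀, n₀) ≠ (m₁, n₁)) (h02 : (m₀, n₀) ≠ (m₂, n₂)) (h12 : (m₁, n₁) ≠ (m₂, n₂)) :
    IsRat a b c := by
  have d01 := mt (eq_of_proportional hr hm₀ hm₁ h₀ h₁) h01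
  have d02 := mt (eq_of_proportional hr hm₀ hm₂ h₀ h₂) h02
  have d12 := mt (eq_of_proportional hr hm₁ hm₂ h₁ h₂) h12
  obtain ⟨d, hd⟩ : ∃ d, d = (m₀ * n₁ - m₁ * n₀) * (m₀ * n₂ - m₂ * n₀) * (m₁ * n₂ - m₂ * n₁) :=
    ⟨_, rfl⟩
  have hd0 : (d : ℝ) ≠ 0 := by
    rw [hd]; exact_mod_cast mul_ne_zero (mul_ne_zero d01 d02) d12
  refine ⟨r / d, (m₁ * n₁ * n₂ ^ 2 - m₂ * n₂ * n₁ ^ 2) - (m₀ * n₀ * n₂ ^ 2 - m₂ * n₂ * n₀ ^ 2) +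
      (m₀ * n₀ * n₁ ^ 2 - m₁ * n₁ * n₀ ^ 2),
    -(m₁ ^ 2 * n₂ ^ 2 - m₂ ^ 2 * n₁ ^ 2) + (m₀ ^ 2 * n₂ ^ 2 - m₂ ^ 2 * n₀ ^ 2) -
      (m₀ ^ 2 * n₁ ^ 2 - m₁ ^ 2 * n₀ ^ 2),
    (m₁ ^ 2 * (m₂ * n₂) - m₂ ^ 2 * (m₁ * n₁)) - (m₀ ^ 2 * (m₂ * n₂) - m₂ ^ 2 * (m₀ * n₀)) +
      (m₀ ^ 2 * (m₁ * n₁) - m₁ ^ 2 * (m₀ * n₀)), ?_, ?_, ?_⟩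
  · rw [div_mul_eq_mul_div, eq_div_iff hd0, hd]
    push_cast
    linear_combination ((m₁ * n₁ * n₂ ^ 2 - m₂ * n₂ * n₁ ^ 2 : ℝ)) * h₀ -
      ((m₀ * n₀ * n₂ ^ 2 - m₂ * n₂ * n₀ ^ 2 : ℝ)) * h₁ +
      ((m₀ * n₀ * n₁ ^ 2 - m₁ * n₁ * n₀ ^ 2 : ℝ)) * h₂
  · rw [div_mul_eq_mul_div, eq_div_iff hd0, hd]
    push_cast
    linear_combination (-(m₁ ^ 2 * n₂ ^ 2 - m₂ ^ 2 * n₁ ^ 2 : ℝ)) * h₀ +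
      ((m₀ ^ 2 * n₂ ^ 2 - m₂ ^ 2 * n₀ ^ 2 : ℝ)) * h₁ -
      ((m₀ ^ 2 * n₁ ^ 2 - m₁ ^ 2 * n₀ ^ 2 : ℝ)) * h₂
  · rw [div_mul_eq_mul_div, eq_div_iff hd0, hd]
    push_cast
    linear_combination ((m₁ ^ 2 * (m₂ * n₂) - m₂ ^ 2 * (m₁ * n₁) : ℝ)) * h₀ -
      ((m₀ ^ 2 * (m₂ * n₂) - m₂ ^ 2 * (m₀ * n₀) : ℝ)) * h₁ +
      ((m₀ ^ 2 * (m₁ * n₁) - m₁ ^ 2 * (m₀ * n₀) : ℝ)) * h₂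

lemma le_ncard_valSet (ha : 0 < a) (hd : b ^ 2 + 4 = 4 * a * c) (hirr : ¬ IsRat a b c) {x : ℝ}
    (hx : 4 * (a + |b| + c) ≤ x) : x / (8 * (a + |b| + c)) ≤ ((valSet a b c x).ncard : ℝ) := by
  classical
  have hc := c_pos_of_gram ha hd
  obtain ⟨M, hM⟩ : ∃ M, M = a + |b| + c := ⟨_, rfl⟩
  have hM0 : 0 < M := by rw [hM]; positivity
  rw [← hM] at hx ⊢
  obtain ⟨K, hK⟩ : ∃ K, K = ⌊√(x / M)⌋₊ := ⟨_, rfl⟩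
  have hxM : 4 ≤ x / M := by rwa [le_div_iff₀ hM0]
  have hKle : (K : ℝ) ≤ √(x / M) := by rw [hK]; exact Nat.floor_le (Real.sqrt_nonneg _)
  have hKlt : √(x / M) < K + 1 := by rw [hK]; exact Nat.lt_floor_add_one _
  have hs2 : 2 ≤ √(x / M) := Real.le_sqrt_of_sq_le (by linarith)
  have hsq : √(x / M) ^ 2 = x / M := Real.sq_sqrt (by linarith)
  have hKM : (K : ℝ) ^ 2 * M ≤ x := by
    rw [← le_div_iff₀ hM0, ← hsq]; gcongr
  let f : ℤ × ℤ → ℝ := fun p => a * (p.1 : ℝ) ^ 2 + b * p.1 * p.2 + c * p.2 ^ 2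
  let s : Finset (ℤ × ℤ) := Finset.Icc (1 : ℤ) K ×ˢ Finset.Icc (1 : ℤ) K
  have hs : ∀ p ∈ s, (1 ≤ p.1 ∧ p.1 ≤ K) ∧ 1 ≤ p.2 ∧ p.2 ≤ K := fun p hp => by
    simpa [s] using hp
  have h1 : s.card ≤ 2 * (s.image f).card := by
    refine Finset.card_le_mul_card_image s 2 fun r hr => ?_
    obtain ⟨p₀, hp₀, rfl⟩ := Finset.mem_image.1 hr
    by_contra! hcon
    obtain ⟨p, hp, q, hq, t, ht, hpq, hpt, hqt⟩ := Finset.two_lt_card.1 hcon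
    rw [Finset.mem_filter] at hp hq ht
    have hr0 : f p₀ ≠ 0 := (gram_pos ha hd (by have := (hs p₀ hp₀).1.1; omega)).ne'
    exact hirr (isRat_of_three hr0 (by have := (hs p hp.1).1.1; omega)
      (by have := (hs q hq.1).1.1; omega) (by have := (hs t ht.1).1.1; omega) hp.2 hq.2 ht.2
      hpq hpt hqt)
  have h2 : (s.image f).card ≤ (valSet a b c x).ncard := by
    rw [← Set.ncard_coe_finset]
    refine Set.ncard_le_ncard ?_ (finite_valSet ha hd x)
    intro r hr
    obtain ⟨p, hp, rfl⟩ := Finset.mem_image.1 (Finset.mem_coe.1 hr)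
    obtain ⟨⟨h3, h4⟩, h5, h6⟩ := hs p hp
    refine ⟨gram_pos ha hd (by omega), ?_, p.1, p.2, rfl⟩
    have h3' : (1 : ℝ) ≤ p.1 := by exact_mod_cast h3
    have h4' : (p.1 : ℝ) ≤ K := by exact_mod_cast h4
    have h5' : (1 : ℝ) ≤ p.2 := by exact_mod_cast h5
    have h6' : (p.2 : ℝ) ≤ K := by exact_mod_cast h6
    have h7 : b * p.1 * p.2 ≤ |b| * K ^ 2 := by
      calc b * p.1 * p.2 = b * (p.1 * p.2) := by ring
        _ ≤ |b| * (p.1 * p.2) := by gcongr; exact le_abs_self b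
        _ ≤ |b| * (K * K) := by gcongr
        _ = _ := by ring
    have h8 : a * (p.1 : ℝ) ^ 2 ≤ a * K ^ 2 := by gcongr
    have h9 : c * (p.2 : ℝ) ^ 2 ≤ c * K ^ 2 := by gcongr
    calc f p = a * (p.1 : ℝ) ^ 2 + b * p.1 * p.2 + c * p.2 ^ 2 := rfl
      _ ≤ K ^ 2 * M := by rw [hM]; linarith
      _ ≤ x := hKM
  have h3 : s.card = K ^ 2 := by simp [s, sq]
  have h4 : (K : ℝ) ^ 2 ≤ 2 * (valSet a b c x).ncard := by
    have : K ^ 2 ≤ 2 * (valSet a b c x).ncard := by omega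
    exact_mod_cast this
  have h5 : x / M ≤ 4 * (K : ℝ) ^ 2 := by
    rw [← hsq]; nlinarith
  calc x / (8 * M) = x / M / 8 := by field_simp
    _ ≤ _ := by linarith

lemma isRat_of_tendsto (ha : 0 < a) (hd : b ^ 2 + 4 = 4 * a * c) {F : ℝ}
    (hF : Tendsto (fun x : ℝ => ((valSet a b c x).ncard : ℝ) * √(Real.log x) / x) atTop (nhds F)) :
    IsRat a b c := by
  by_contra hirr
  have hc := c_pos_of_gram ha hd
  have hM : 0 < a + |b| + c := by positivity
  refine not_tendsto_nhds_of_tendsto_atTop ?_ F hF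
  have h1 : Tendsto (fun x : ℝ => 1 / (8 * (a + |b| + c)) * √(Real.log x)) atTop atTop :=
    (Real.tendsto_sqrt_atTop.comp Real.tendsto_log_atTop).const_mul_atTop (by positivity)
  refine tendsto_atTop_mono' _ ?_ h1
  filter_upwards [eventually_ge_atTop (4 * (a + |b| + c)), eventually_gt_atTop 0] with x hx hx0
  rw [le_div_iff₀ hx0]
  calc _ = x / (8 * (a + |b| + c)) * √(Real.log x) := by ring
    _ ≤ _ := by gcongr; exact le_ncard_valSet ha hd hirr hx

end Gram

lemma exists_primitive {A B C : ℤ} (h : A ≠ 0) : ∃ g A' B' C' : ℤ, 0 < g ∧ A = g * A' ∧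
    B = g * B' ∧ C = g * C' ∧ ∃ u v w : ℤ, u * A' + v * B' + w * C' = 1 := by
  obtain ⟨g, hg⟩ : ∃ g : ℤ, g = Int.gcd (Int.gcd A B) C := ⟨_, rfl⟩
  have h1 : (Int.gcd A B : ℤ) = A * Int.gcdA A B + B * Int.gcdB A B := Int.gcd_eq_gcd_ab _ _
  have h2 : g = Int.gcd A B * Int.gcdA (Int.gcd A B) C + C * Int.gcdB (Int.gcd A B) C := by
    rw [hg]; exact Int.gcd_eq_gcd_ab _ _
  have hgAB : g ∣ Int.gcd A B := hg ▸ Int.gcd_dvd_left ..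
  obtain ⟨A', hA⟩ := hgAB.trans (Int.gcd_dvd_left ..)
  obtain ⟨B', hB⟩ := hgAB.trans (Int.gcd_dvd_right ..)
  obtain ⟨C', hC⟩ : g ∣ C := hg ▸ Int.gcd_dvd_right ..
  have hg0 : g ≠ 0 := by
    rintro h0
    rw [h0, zero_mul] at hA
    exact h hA
  refine ⟨g, A', B', C', lt_of_le_of_ne (hg ▸ Int.natCast_nonneg _) hg0.symm, hA, hB, hC,
    Int.gcdA A B * Int.gcdA (Int.gcd A B) C, Int.gcdB A B * Int.gcdA (Int.gcd A B) C,
    Int.gcdB (Int.gcd A B) C, mul_left_cancel₀ hg0 ?_⟩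
  generalize Int.gcdA (Int.gcd A B) C = e at *
  generalize Int.gcdB (Int.gcd A B) C = e' at *
  generalize Int.gcdA A B = e₁ at *
  generalize Int.gcdB A B = e₂ at *
  linear_combination -h2 - e * h1 - e * e₁ * hA - e * e₂ * hB - e' * hC

/-- A positive definite form proportional to an integral form is a positive multiple of a
primitive integral one. -/
lemma IsRat.exists_form {a b c : ℝ} (ha : 0 < a) (hd : b ^ 2 + 4 = 4 * a * c) (h : IsRat a b c) :
    ∃ (t : ℝ) (D : ℕ) (A B C : ℤ), 0 < t ∧ 0 < D ∧ a = t * A ∧ b = t * B ∧ c = t * C ∧ 0 < A ∧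
      B ^ 2 + (D : ℤ) = 4 * A * C ∧ (∃ u v w : ℤ, u * A + v * B + w * C = 1) ∧
      t * √D = 2 := by
  obtain ⟨t, A, B, C, hA, hB, hC, ht⟩ : ∃ (t : ℝ) (A B C : ℤ), a = t * A ∧ b = t * B ∧
      c = t * C ∧ 0 < t := by
    obtain ⟨t, A, B, C, hA, hB, hC⟩ := h
    rcases lt_trichotomy t 0 with ht | ht | ht
    · exact ⟨-t, -A, -B, -C, by simpa using hA, by simpa using hB, by simpa using hC,
        neg_pos.2 ht⟩
    · rw [ht, zero_mul] at hA; exact absurd hA ha.ne'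
    · exact ⟨t, A, B, C, hA, hB, hC, ht⟩
  have hA0 : (0 : ℝ) < A := by rw [hA] at ha; exact pos_of_mul_pos_right ha ht.le
  obtain ⟨g, A', B', C', hg, rfl, rfl, rfl, hprim⟩ :=
    exists_primitive (B := B) (C := C) (show A ≠ 0 by rintro rfl; simp at hA0)
  have hgR : (0 : ℝ) < g := by exact_mod_cast hg
  push_cast at hA hB hC hA0
  have hd' : (t * g) ^ 2 * (4 * A' * C' - B' ^ 2) = 4 := by
    rw [hA, hB, hC] at hd; linear_combination -hd
  have hD0 : (0 : ℝ) < 4 * A' * C' - B' ^ 2 := by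
    have : 0 < (t * g) ^ 2 := by positivity
    refine pos_of_mul_pos_right (a := (t * g) ^ 2) ?_ this.le
    rw [hd']; norm_num
  have hD0' : 0 < 4 * A' * C' - B' ^ 2 := by exact_mod_cast hD0
  obtain ⟨D, hD⟩ := Int.eq_ofNat_of_zero_le hD0'.le
  have hDR : (4 * A' * C' - B' ^ 2 : ℝ) = D := by exact_mod_cast hD
  refine ⟨t * g, D, A', B', C', by positivity, by omega, by rw [hA]; ring, by rw [hB]; ring,
    by rw [hC]; ring, by exact_mod_cast pos_of_mul_pos_right hA0 hgR.le, by linarith, hprim, ?_⟩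
  have h1 : (t * g * √D) ^ 2 = 2 ^ 2 := by
    rw [mul_pow, Real.sq_sqrt (Nat.cast_nonneg D), ← hDR, hd']; norm_num
  exact (pow_left_inj₀ (by positivity) (by norm_num) two_ne_zero).1 h1

end QuadLat

/-! ### Integral forms, and the hexagonal lattice -/

namespace QuadLat

section Rational
variable {D : ℕ} [hD : NegDisc D]
open QuadLat.Lat

lemma mem_repr_iff {a b c : ℤ} (h : IsForm D a b c) {n : ℕ} :
    n ∈ repr (cls (formLat h)) ↔
      0 < n ∧ ∃ x y : ℤ, a * x ^ 2 + b * x * y + c * y ^ 2 = (n : ℤ) := by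
  constructor
  · intro hn
    obtain ⟨L, hL, rfl, hcls⟩ := rep_inv hn
    refine ⟨hL.nn_pos, ?_⟩
    obtain ⟨α, hα⟩ := cls_eq_one_iff.1 (show cls (L * formLat h) = 1 by
      rw [map_mul, hcls, inv_mul_cancel])
    obtain rfl : L = princHom D α * (formLat h)⁻¹ := by rw [hα, mul_inv_cancel_right]
    have hmem := princ_mul_inv_isInt.1 hL
    rw [formLat_carrier, mem_tauSpan] at hmem
    obtain ⟨x, y, hxy⟩ := hmem
    exact ⟨x, y, (h.princ_isInt (x, y) α hxy.symm).2.symm⟩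
  · rintro ⟨hn, x, y, hxy⟩
    have h0 : tauHom D a b (x, y) ≠ 0 := by
      intro h0
      have h1 := h.normSq_eq x y
      have h2 : (x : ℂ) + y * tau D a b = 0 := h0
      rw [h2, map_zero, mul_zero] at h1
      have h3 : (a * x ^ 2 + b * x * y + c * y ^ 2 : ℝ) = n := by exact_mod_cast hxy
      rw [← h1] at h3
      have h4 : (0 : ℝ) < n := by exact_mod_cast hn
      exact h4.ne h3
    obtain ⟨h1, h2⟩ := h.princ_isInt (x, y) (Units.mk0 _ h0) rfl
    have h3 : cls (formLat h) = (cls (princHom D (Units.mk0 _ h0) * (formLat h)⁻¹))⁻¹ := by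
      rw [map_mul, map_inv, cls_princ, one_mul, inv_inv]
    have h4 : (princHom D (Units.mk0 _ h0) * (formLat h)⁻¹).nn = n :=
      Nat.cast_injective (R := ℤ) (h2.trans hxy)
    rw [h3]
    exact rep_inv ⟨_, h1, h4, rfl⟩

lemma ncard_valSet_eq {a b c : ℤ} (h : IsForm D a b c) {t : ℝ} (ht : 0 < t) {x : ℝ}
    (hx : 0 ≤ x) :
    ((valSet (t * a) (t * b) (t * c) x).ncard : ℝ) =
      countUpTo (repr (cls (formLat h))) (x / t) := by
  classical
  have hset : valSet (t * a) (t * b) (t * c) x = (fun k : ℕ => t * (k : ℝ)) ''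
      ((Finset.Icc 1 ⌊x / t⌋₊).filter (· ∈ repr (cls (formLat h))) : Finset ℕ) := by
    ext r
    simp only [Set.mem_image, Finset.coe_filter, Set.mem_ofPred_eq, Finset.mem_Icc]
    constructor
    · rintro ⟨hr, hrx, m, n, hmn⟩
      have h1 : r = t * ((a * m ^ 2 + b * m * n + c * n ^ 2 : ℤ) : ℝ) := by
        rw [← hmn]; push_cast; ring
      have h2 : 0 < a * m ^ 2 + b * m * n + c * n ^ 2 := by
        rw [h1] at hr
        exact_mod_cast pos_of_mul_pos_right hr ht.le
      obtain ⟨k, hk⟩ := Int.eq_ofNat_of_zero_le h2.le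
      rw [hk] at h1 h2
      push_cast at h1
      have hk0 : 0 < k := by exact_mod_cast h2
      refine ⟨k, ⟨⟨hk0, Nat.le_floor ?_⟩, (mem_repr_iff h).2 ⟨hk0, m, n, hk⟩⟩, h1.symm⟩
      rw [le_div_iff₀ ht, mul_comm]
      exact h1 ▸ hrx
    · rintro ⟨k, ⟨⟨hk0, hkx⟩, hk⟩, rfl⟩
      obtain ⟨-, m, n, hmn⟩ := (mem_repr_iff h).1 hk
      have hkR : (0 : ℝ) < k := by exact_mod_cast hk0
      have h2 : (k : ℝ) ≤ x / t := (Nat.le_floor_iff (by positivity)).1 hkx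
      rw [le_div_iff₀ ht, mul_comm] at h2
      refine ⟨by positivity, h2, m, n, ?_⟩
      have h3 : (a * m ^ 2 + b * m * n + c * n ^ 2 : ℝ) = k := by exact_mod_cast hmn
      rw [← h3]; ring
  rw [hset, Set.ncard_image_of_injective _ (fun k l hkl => by
    have : (k : ℝ) = l := mul_left_cancel₀ ht.ne' hkl
    exact_mod_cast this), Set.ncard_coe_finset, countUpTo, Finset.card_filter]
  push_cast
  rfl

lemma tendsto_countUpTo_repr {a b c : ℤ} (h : IsForm D a b c) {t F : ℝ} (ht : 0 < t)
    (hF : Tendsto (fun x : ℝ => ((valSet (t * a) (t * b) (t * c) x).ncard : ℝ) *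
      √(Real.log x) / x) atTop (nhds F)) :
    Tendsto (fun y : ℝ => countUpTo (repr (cls (formLat h))) y * √(Real.log y) / y) atTop
      (nhds (F * t)) := by
  have h1 : Tendsto (fun y : ℝ => t * y) atTop atTop := tendsto_id.const_mul_atTop ht
  have h2 : Tendsto (fun y : ℝ => √(Real.log y / Real.log (t * y))) atTop (nhds 1) := by
    have h3 : Tendsto (fun y : ℝ => Real.log (t * y) / Real.log y) atTop (nhds 1) := by
      have h4 : Tendsto (fun y : ℝ => Real.log t / Real.log y + 1) atTop (nhds (0 + 1)) :=
        (tendsto_const_nhds.div_atTop Real.tendsto_log_atTop).add_const 1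
      rw [zero_add] at h4
      refine h4.congr' ?_
      filter_upwards [eventually_gt_atTop 1] with y hy
      rw [Real.log_mul ht.ne' (by linarith), add_div, div_self (Real.log_pos hy).ne']
    have h5 := (h3.inv₀ one_ne_zero).sqrt
    rw [inv_one, Real.sqrt_one] at h5
    simpa only [inv_div] using h5
  have h6 := ((hF.comp h1).mul_const t).mul h2
  rw [mul_one] at h6
  refine h6.congr' ?_
  filter_upwards [eventually_gt_atTop 1, h1.eventually_gt_atTop 1] with y hy hty
  have hlog := Real.log_pos hty
  have hs := Real.sqrt_pos.2 hlog
  simp only [Function.comp]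
  rw [ncard_valSet_eq h ht (by positivity), mul_div_cancel_left₀ _ ht.ne',
    Real.sqrt_div (Real.log_pos hy).le]
  field_simp

end Rational

section Hexagonal

/-- The Euclidean plane. -/
abbrev Plane := EuclideanSpace ℝ (Fin 2)

lemma latticeOf_add (v w : Plane) (k : ℤ) : latticeOf v (w + k • v) = latticeOf v w := by
  ext z
  constructor
  · rintro ⟨m, n, rfl⟩; exact ⟨m + n * k, n, by module⟩
  · rintro ⟨m, n, rfl⟩; exact ⟨m - n * k, n, by module⟩

lemma latticeOf_swap (v w : Plane) : latticeOf w v = latticeOf v w := by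
  ext z
  constructor
  · rintro ⟨m, n, rfl⟩; exact ⟨n, m, by module⟩
  · rintro ⟨m, n, rfl⟩; exact ⟨n, m, by module⟩

lemma latticeOf_neg (v w : Plane) : latticeOf v (-w) = latticeOf v w := by
  ext z
  constructor
  · rintro ⟨m, n, rfl⟩; exact ⟨m, -n, by module⟩
  · rintro ⟨m, n, rfl⟩; exact ⟨m, -n, by module⟩

lemma exists_basis_of_disc_three {t : ℝ} : ∀ (N : ℕ) (A B C : ℤ) (v w : Plane), 0 < A → 0 < C →
    A + C ≤ N → B ^ 2 + 3 = 4 * A * C → inner ℝ v v = t * A → 2 * inner ℝ v w = t * B →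
    inner ℝ w w = t * C → ∃ v' w' : Plane, latticeOf v' w' = latticeOf v w ∧ inner ℝ v' v' = t ∧
      2 * inner ℝ v' w' = t ∧ inner ℝ w' w' = t := by
  intro N
  induction N with
  | zero => intro A B C v w hA hC hN; norm_cast at hN; omega
  | succ N ih =>
    have step : ∀ (A B C : ℤ) (v w : Plane) (e : ℤ), 0 < A → 0 < C → A + C ≤ (N + 1 : ℕ) →
        B ^ 2 + 3 = 4 * A * C → inner ℝ v v = t * A → 2 * inner ℝ v w = t * B →
        inner ℝ w w = t * C → e ^ 2 = 1 → A + e * B < 0 →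
        ∃ v' w' : Plane, latticeOf v' w' = latticeOf v w ∧ inner ℝ v' v' = t ∧
          2 * inner ℝ v' w' = t ∧ inner ℝ w' w' = t := by
      intro A B C v w e hA hC hN hd hv hvw hw he hlt
      have heR : (e : ℝ) ^ 2 = 1 := by exact_mod_cast he
      have hd' : (B + 2 * e * A) ^ 2 + 3 = 4 * A * (A + e * B + C) := by
        linear_combination hd + 4 * A ^ 2 * he
      obtain ⟨v', w', hl, h⟩ := ih A (B + 2 * e * A) (A + e * B + C) v (w + e • v) hA
        (by nlinarith [sq_nonneg (B + 2 * e * A)]) (by push_cast at hN; linarith) hd' hv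
        (by
          rw [inner_add_right, ← Int.cast_smul_eq_zsmul ℝ, inner_smul_right, hv]
          push_cast
          linear_combination hvw)
        (by
          rw [inner_add_right, inner_add_left, inner_add_left, ← Int.cast_smul_eq_zsmul ℝ,
            inner_smul_right, inner_smul_right, inner_smul_left, inner_smul_left,
            real_inner_comm v w, hv, hw]
          simp only [conj_trivial]
          push_cast
          linear_combination e * hvw + t * A * heR)
      exact ⟨v', w', hl.trans (latticeOf_add v w e), h⟩
    intro A B C v w hA hC hN hd hv hvw hw
    by_cases h1 : A + B < 0
    · exact step A B C v w 1 hA hC hN hd hv hvw hw (by norm_num) (by linarith)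
    by_cases h2 : A - B < 0
    · exact step A B C v w (-1) hA hC hN hd hv hvw hw (by norm_num) (by linarith)
    have hwv : 2 * inner ℝ w v = t * B := by rw [real_inner_comm]; exact hvw
    by_cases h3 : C + B < 0
    · obtain ⟨v', w', hl, h⟩ := step C B A w v 1 hC hA (by linarith) (by linarith) hw hwv hv
        (by norm_num) (by linarith)
      exact ⟨v', w', hl.trans (latticeOf_swap v w), h⟩
    by_cases h4 : C - B < 0
    · obtain ⟨v', w', hl, h⟩ := step C B A w v (-1) hC hA (by linarith) (by linarith) hw hwv hv
        (by norm_num) (by linarith)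
      exact ⟨v', w', hl.trans (latticeOf_swap v w), h⟩
    have hB : B ^ 2 ≤ A * C := by
      rcases le_total 0 B with hB0 | hB0 <;> nlinarith
    have hAC : A * C ≤ 1 := by linarith
    have hA1 : A = 1 := by nlinarith
    have hC1 : C = 1 := by nlinarith
    subst hA1 hC1
    have hB1 : (B - 1) * (B + 1) = 0 := by linarith
    rw [Int.cast_one, mul_one] at hv hw
    rcases mul_eq_zero.1 hB1 with h | h
    · obtain rfl : B = 1 := by linarith
      exact ⟨v, w, rfl, hv, by simpa using hvw, hw⟩
    · obtain rfl : B = -1 := by linarith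
      refine ⟨v, -w, latticeOf_neg v w, hv, ?_, by rw [inner_neg_neg, hw]⟩
      rw [inner_neg_right]
      push_cast at hvw
      linarith

lemma image_latticeOf (T : Plane ≃ₗᵢ[ℝ] Plane) (v w : Plane) :
  T '' latticeOf v w = latticeOf (T v) (T w) := by
  ext z
  constructor
  · rintro ⟨_, ⟨m, n, rfl⟩, rfl⟩
    exact ⟨m, n, by rw [map_add, map_zsmul, map_zsmul]⟩
  · rintro ⟨m, n, rfl⟩
    exact ⟨_, ⟨m, n, rfl⟩, by rw [map_add, map_zsmul, map_zsmul]⟩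

lemma exists_isometry_hexLattice {v w : Plane} (hv : inner ℝ v v = 2 / √3)
    (hvw : 2 * inner ℝ v w = 2 / √3) (hw : inner ℝ w w = 2 / √3) :
    ∃ T : Plane ≃ₗᵢ[ℝ] Plane, T '' hexLattice = latticeOf v w := by
  obtain ⟨s, hs⟩ : ∃ s, s = √(2 / √3) := ⟨_, rfl⟩
  have h3 : (0 : ℝ) < √3 := by positivity
  have h33 : √3 ^ 2 = 3 := Real.sq_sqrt (by norm_num)
  have hs0 : 0 < s := by rw [hs]; positivity
  have hs2 : 2 / √3 = s ^ 2 := by rw [hs, Real.sq_sqrt (by positivity)]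
  rw [hs2] at hv hvw hw
  have hvw' : inner ℝ v w = s ^ 2 / 2 := by linarith
  have hwv' : inner ℝ w v = s ^ 2 / 2 := by rw [real_inner_comm]; exact hvw'
  let e : Fin 2 → Plane := ![s⁻¹ • v, (2 / (s * √3)) • (w - (1 / 2 : ℝ) • v)]
  have h00 : inner ℝ (e 0) (e 0) = 1 := by
    simp only [e, Matrix.cons_val_zero, inner_smul_left, inner_smul_right, hv, conj_trivial]
    field_simp
  have h01 : inner ℝ (e 0) (e 1) = 0 := by
    simp only [e, Matrix.cons_val_zero, Matrix.cons_val_one, inner_smul_left, inner_smul_right,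
      inner_sub_right, hv, hvw', conj_trivial]
    ring
  have h11 : inner ℝ (e 1) (e 1) = 1 := by
    simp only [e, Matrix.cons_val_one, Matrix.cons_val_zero, inner_smul_left, inner_smul_right,
      inner_sub_left, inner_sub_right, hv, hw, hvw', hwv', conj_trivial]
    field_simp
    rw [h33]
    norm_num
  have he : Orthonormal ℝ e := by
    rw [orthonormal_iff_ite]
    intro i j
    fin_cases i <;> fin_cases j
    · exact h00
    · exact h01
    · exact (real_inner_comm _ _).trans h01
    · exact h11
  obtain ⟨B, hB⟩ := Orthonormal.exists_orthonormalBasis_extension_of_card_eq (𝕜 := ℝ) (E := Plane)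
    (ι := Fin 2) (by simp) (v := e) (s := Set.univ)
    (he.comp _ Subtype.val_injective)
  have hB0 : B 0 = s⁻¹ • v := hB 0 (Set.mem_univ _)
  have hB1 : B 1 = (2 / (s * √3)) • (w - (1 / 2 : ℝ) • v) := hB 1 (Set.mem_univ _)
  have hT : ∀ x : Fin 2 → ℝ, B.repr.symm ((WithLp.equiv 2 (Fin 2 → ℝ)).symm x) =
      x 0 • B 0 + x 1 • B 1 := by
    intro x
    rw [← B.sum_repr_symm, Fin.sum_univ_two]
    rfl
  refine ⟨B.repr.symm, ?_⟩
  rw [hexLattice, image_latticeOf, hT, hT, ← hs, hB0, hB1]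
  congr 1
  · simp [smul_smul, hs0.ne']
  · simp only [Matrix.cons_val_zero, Matrix.cons_val_one, smul_smul]
    rw [show s * (1 / 2) * s⁻¹ = 1 / 2 by field_simp,
      show s * (√3 / 2) * (2 / (s * √3)) = 1 by field_simp]
    module

end Hexagonal

end QuadLat

namespace QuadLat

lemma hexErdos_lt (v₁ v₂ : EuclideanSpace ℝ (Fin 2)) (hcovol : |v₁ 0 * v₂ 1 - v₁ 1 * v₂ 0| = 1)
    (hnot : ¬ ∃ T : EuclideanSpace ℝ (Fin 2) ≃ₗᵢ[ℝ] EuclideanSpace ℝ (Fin 2),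
      T '' hexLattice = latticeOf v₁ v₂)
    (F : ℝ)
    (hF : Tendsto (fun x : ℝ => (NL (latticeOf v₁ v₂) x : ℝ) * Real.sqrt (Real.log x) / x)
      atTop (nhds F)) :
    hexErdos < F := by
  obtain ⟨a, ha⟩ : ∃ a, a = v₁ 0 ^ 2 + v₁ 1 ^ 2 := ⟨_, rfl⟩
  obtain ⟨b, hb⟩ : ∃ b, b = 2 * (v₁ 0 * v₂ 0 + v₁ 1 * v₂ 1) := ⟨_, rfl⟩
  obtain ⟨c, hc⟩ : ∃ c, c = v₂ 0 ^ 2 + v₂ 1 ^ 2 := ⟨_, rfl⟩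
  simp only [NL_latticeOf, ← ha, ← hb, ← hc] at hF
  have hd : b ^ 2 + 4 = 4 * a * c := by
    have h1 : (v₁ 0 * v₂ 1 - v₁ 1 * v₂ 0) ^ 2 = 1 := by rw [← sq_abs, hcovol, one_pow]
    rw [ha, hb, hc]
    linear_combination -4 * h1
  have ha0 : 0 < a := by
    refine lt_of_le_of_ne (by rw [ha]; positivity) fun h0 => ?_
    rw [← h0] at hd
    nlinarith [sq_nonneg b]
  obtain ⟨t, D, A, B, C, ht, hD0, hA, hB, hC, hA0, hdisc, hprim, htD⟩ :=
    (isRat_of_tendsto ha0 hd hF).exists_form ha0 hd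
  have hNeg : NegDisc D := ⟨hD0, by
    have h1 : (D : ℤ) = 4 * (A * C) - B ^ 2 := by linarith
    rcases Int.even_or_odd' B with ⟨k, rfl | rfl⟩
    · have : (D : ℤ) = 4 * (A * C - k ^ 2) := by rw [h1]; ring
      omega
    · have : (D : ℤ) = 4 * (A * C - k ^ 2 - k - 1) + 3 := by rw [h1]; ring
      omega⟩
  have hform : IsForm D A B C := ⟨hA0, hdisc, hprim⟩
  rcases (NegDisc.three_le D).eq_or_lt with rfl | h3
  · have hinn : ∀ u w : EuclideanSpace ℝ (Fin 2), inner ℝ u w = u 0 * w 0 + u 1 * w 1 := by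
      intro u w
      rw [PiLp.inner_apply, Fin.sum_univ_two]
      simp [mul_comm]
    have hC0 : 0 < C := by
      push_cast at hdisc
      nlinarith [sq_nonneg B]
    obtain ⟨v, w, hl, h1, h2, h3⟩ := exists_basis_of_disc_three (A + C).toNat A B C v₁ v₂ hA0 hC0
      (by omega) (by exact_mod_cast hdisc) (t := t) (by rw [hinn, ← hA, ha]; ring)
      (by rw [hinn, ← hB, hb]) (by rw [hinn, ← hC, hc]; ring)
    have ht' : t = 2 / √3 := by
      rw [eq_div_iff (by positivity)]
      exact_mod_cast htD
    rw [ht'] at h1 h2 h3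
    rw [← hl] at hnot
    exact absurd (exists_isometry_hexLattice h1 h2 h3) hnot
  · have hF0 : 0 ≤ F := ge_of_tendsto hF (by
      filter_upwards [eventually_gt_atTop 0] with x hx
      positivity)
    rw [hA, hB, hC] at hF
    have h1 := sq_limit_ge h3 _ (tendsto_countUpTo_repr hform ht hF)
    rw [show F * t * (√D / 2) = F by
      calc F * t * (√D / 2) = F * (t * √D) / 2 := by ring
        _ = F := by rw [htD]; ring] at h1
    exact hexErdos_lt_of_sq_ge hF0 h1

end QuadLat

theorem stmt1 (v₁ v₂ : EuclideanSpace ℝ (Fin 2))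
    (hind : LinearIndependent ℝ ![v₁, v₂])
    (hcovol : |v₁ 0 * v₂ 1 - v₁ 1 * v₂ 0| = 1)
    (hnot : ¬ ∃ T : EuclideanSpace ℝ (Fin 2) ≃ₗᵢ[ℝ] EuclideanSpace ℝ (Fin 2),
      T '' hexLattice = latticeOf v₁ v₂)
    (F : ℝ)
    (hF : Tendsto (fun x : ℝ => (NL (latticeOf v₁ v₂) x : ℝ) * Real.sqrt (Real.log x) / x)
      atTop (nhds F)) :
    F > hexErdos :=
  QuadLat.hexErdos_lt v₁ v₂ hcovol hnot F hF
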